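/- arXiv:2511.22604 — 4 statements merged into one kernel-verified Lean document; each statement's English description precedes it below -/
import Mathlib

section
/- There exists an absolute constant C > 0 such that the following holds. Let k ≥ 1 be an integer and let G = (G_t)_{t ∈ ℕ, t ≥ 1} be an always-connected temporal graph on a vertex set of size n ≥ 2 whose underlying graph has treewidth at most k. Then for every start vertex s, there exists a temporal exploration of G starting at s that spans at most C · n^{3/2} · sqrt(k · log₂ n) time steps. -/
/-- `H` has treewidth at most `k`: there is a tree decomposition of `H` (a tree `T`
with bags `β i ⊆ V`, every vertex in some bag, every edge inside some bag, and for
each vertex the set of bags containing it inducing a connected subtree) all of whose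
bags have size at most `k + 1`. -/
def TreewidthAtMost {V : Type} (H : SimpleGraph V) (k : ℕ) : Prop :=
  ∃ (ι : Type) (T : SimpleGraph ι) (β : ι → Finset V),
    T.Connected ∧ T.IsAcyclic ∧
    (∀ v : V, ∃ i, v ∈ β i) ∧
    (∀ u v : V, H.Adj u v → ∃ i, u ∈ β i ∧ v ∈ β i) ∧
    (∀ v : V, (SimpleGraph.induce {i : ι | v ∈ β i} T).Connected) ∧
    (∀ i, (β i).card ≤ k + 1)

namespace SimpleGraph

variable {ι : Type*} {T : SimpleGraph ι}

lemma IsTree.eq_of_adj_of_dist_eq (hT : T.IsTree) {r x a b : ι} (ha : T.Adj a x)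
    (hb : T.Adj b x) (hda : T.dist r x = T.dist r a + 1) (hdb : T.dist r x = T.dist r b + 1) :
    a = b := by
  obtain ⟨p, hp⟩ := hT.connected.exists_walk_length_eq_dist r a
  obtain ⟨q, hq⟩ := hT.connected.exists_walk_length_eq_dist r b
  have hp' : (p.concat ha).IsPath := Walk.isPath_of_length_eq_dist _ (by simp [hp, hda])
  have hq' : (q.concat hb).IsPath := Walk.isPath_of_length_eq_dist _ (by simp [hq, hdb])
  have h := (hT.isAcyclic.subsingleton_path _ _).elim ⟨_, hp'⟩ ⟨_, hq'⟩
  have h2 : (p.concat ha).penultimate = (q.concat hb).penultimate := by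
    rw [Subtype.mk.inj h]
  simpa using h2

lemma IsTree.exists_adj_dist_eq_of_isPath (hT : T.IsTree) (r : ι) {x y : ι} (p : T.Walk x y)
    (hp : p.IsPath) (hxy : x ≠ y) (hd : T.dist r y ≤ T.dist r x) :
    ∃ j ∈ p.support, T.Adj j x ∧ T.dist r x = T.dist r j + 1 := by
  induction p with
  | nil => exact absurd rfl hxy
  | @cons x x₁ y h p ih =>
    rcases hT.dist_eq_dist_add_one_of_adj r h with h1 | h1
    · exact ⟨x₁, by simp, h.symm, h1⟩
    · exfalso
      rw [Walk.cons_isPath_iff] at hp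
      have hne : x₁ ≠ y := by rintro rfl; omega
      obtain ⟨j, hj, hadj, hdj⟩ := ih hp.1 hne (by omega)
      have := hT.eq_of_adj_of_dist_eq hadj h hdj h1
      exact hp.2 (this ▸ hj)

lemma IsTree.exists_mem_adj_dist_eq (hT : T.IsTree) (r : ι) {U : Set ι}
    (hU : (T.induce U).Connected) {x y : ι} (hx : x ∈ U) (hy : y ∈ U) (hxy : x ≠ y)
    (hd : T.dist r y ≤ T.dist r x) :
    ∃ j ∈ U, T.Adj j x ∧ T.dist r x = T.dist r j + 1 := by
  obtain ⟨p, hp⟩ := hU.exists_isPath ⟨x, hx⟩ ⟨y, hy⟩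
  obtain ⟨j, hj, h⟩ := hT.exists_adj_dist_eq_of_isPath r
    (p.map (Embedding.induce (G := T) U).toHom)
    (Walk.IsPath.map (Embedding.induce (G := T) U).injective hp) hxy hd
  refine ⟨j, ?_, h⟩
  rw [Walk.support_map, List.mem_map] at hj
  obtain ⟨z, -, rfl⟩ := hj
  exact z.2

/-- Of two intersecting subtrees of a rooted tree, the one whose highest node is lower has its
highest node inside the other. -/
lemma IsTree.mem_of_isMinOn_dist (hT : T.IsTree) (r : ι) {U W : Set ι}
    (hU : (T.induce U).Connected) (hW : (T.induce W).Connected) {a b : ι}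
    (ha : a ∈ U) (ha' : ∀ j ∈ U, T.dist r a ≤ T.dist r j)
    (hb : b ∈ W) (hab : T.dist r b ≤ T.dist r a) {i : ι} (hiU : i ∈ U) (hiW : i ∈ W) :
    a ∈ W := by
  induction hn : T.dist r i using Nat.strong_induction_on generalizing i with
  | _ n ih =>
    by_cases hia : i = a
    · exact hia ▸ hiW
    obtain ⟨j, hj, hji, hdj⟩ := hT.exists_mem_adj_dist_eq r hU hiU ha hia (ha' i hiU)
    have hib : i ≠ b := by
      rintro rfl
      have := ha' j hj
      omega
    obtain ⟨l, hl, hli, hdl⟩ := hT.exists_mem_adj_dist_eq r hW hiW hb hib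
      (hab.trans (ha' i hiU))
    obtain rfl := hT.eq_of_adj_of_dist_eq hji hli hdj hdl
    exact ih _ (by omega) hj hl rfl

end SimpleGraph

/-- A graph of treewidth at most `k` on `n` vertices has at most `k * n` edges, that is, at most
`2 * (k * n)` ordered pairs of adjacent vertices. -/
lemma TreewidthAtMost.card_adj_le {V : Type} [Fintype V] [DecidableEq V] {H : SimpleGraph V}
    [DecidableRel H.Adj] {k : ℕ} (h : TreewidthAtMost H k) :
    ({p : V × V | H.Adj p.1 p.2} : Finset (V × V)).card ≤ 2 * (k * Fintype.card V) := by
  obtain ⟨ι, T, β, hconn, hacyc, hcov, hedge, hsub, hcard⟩ := h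
  have hT : T.IsTree := ⟨hconn, hacyc⟩
  obtain ⟨r⟩ := hconn.nonempty
  have htop : ∀ v : V, ∃ a, v ∈ β a ∧ ∀ j, v ∈ β j → T.dist r a ≤ T.dist r j := by
    intro v
    have hne : {i | v ∈ β i}.Nonempty := hcov v
    exact ⟨Function.argminOn (T.dist r) _ hne, Function.argminOn_mem (T.dist r) _ hne,
      fun j hj ↦ Function.argminOn_le (T.dist r) _ hj⟩
  choose top htop_mem htop_min using htop
  let E : Finset (V × V) := Finset.univ.biUnion fun u ↦ ((β (top u)).erase u).image (Prod.mk u)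
  have hE : E.card ≤ k * Fintype.card V := by
    refine Finset.card_biUnion_le.trans ?_
    rw [mul_comm, ← smul_eq_mul, ← Finset.card_univ]
    refine Finset.sum_le_card_nsmul _ _ _ fun u _ ↦ Finset.card_image_le.trans ?_
    rw [Finset.card_erase_of_mem (htop_mem u)]
    have := hcard (top u)
    omega
  have hsubset : ({p : V × V | H.Adj p.1 p.2} : Finset (V × V)) ⊆ E ∪ E.image Prod.swap := by
    rintro ⟨u, v⟩ huv
    have huv : H.Adj u v := by simpa using huv
    obtain ⟨i, hu, hv⟩ := hedge u v huv
    rw [Finset.mem_union]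
    rcases le_total (T.dist r (top v)) (T.dist r (top u)) with hle | hle
    · left
      have : v ∈ β (top u) := hT.mem_of_isMinOn_dist r (hsub u) (hsub v) (htop_mem u)
        (htop_min u) (htop_mem v) hle hu hv
      simp [E, this, huv.ne.symm]
    · right
      have : u ∈ β (top v) := hT.mem_of_isMinOn_dist r (hsub v) (hsub u) (htop_mem v)
        (htop_min v) (htop_mem u) hle hv hu
      simp [E, this, huv.ne]
  calc _ ≤ (E ∪ E.image Prod.swap).card := Finset.card_le_card hsubset
    _ ≤ E.card + (E.image Prod.swap).card := Finset.card_union_le _ _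
    _ ≤ E.card + E.card := Nat.add_le_add_left Finset.card_image_le _
    _ ≤ 2 * (k * Fintype.card V) := by omega

/-- In the temporal graph `G` there is a temporal walk from `u` at time `t` to `v` at time `t'`
that visits every vertex of `N`. -/
def TemporalTour {V : Type*} (G : ℕ → SimpleGraph V) (t t' : ℕ) (u v : V) (N : Finset V) : Prop :=
  ∃ w : ℕ → V, w t = u ∧ w t' = v ∧
    (∀ i, t ≤ i → i < t' → w i = w (i + 1) ∨ (G i).Adj (w i) (w (i + 1))) ∧
    ∀ x ∈ N, ∃ i, t ≤ i ∧ i ≤ t' ∧ w i = x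

namespace TemporalTour

variable {V : Type*} {G : ℕ → SimpleGraph V} {t t' t'' : ℕ} {u v x : V} {N M : Finset V}

lemma refl (G : ℕ → SimpleGraph V) (t : ℕ) (u : V) : TemporalTour G t t u u {u} :=
  ⟨fun _ ↦ u, rfl, rfl, fun _ _ _ ↦ .inl rfl, fun x hx ↦ ⟨t, le_rfl, le_rfl, by simp_all⟩⟩

lemma stay (G : ℕ → SimpleGraph V) (t t' : ℕ) (u : V) : TemporalTour G t t' u u ∅ :=
  ⟨fun _ ↦ u, rfl, rfl, fun _ _ _ ↦ .inl rfl, fun x hx ↦ by simp at hx⟩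

lemma trans [DecidableEq V] (h : TemporalTour G t t' u v N) (h' : TemporalTour G t' t'' v x M)
    (ht : t ≤ t') (ht' : t' ≤ t'') : TemporalTour G t t'' u x (N ∪ M) := by
  obtain ⟨w, h1, h2, h3, h4⟩ := h
  obtain ⟨w', h1', h2', h3', h4'⟩ := h'
  refine ⟨fun i ↦ if i ≤ t' then w i else w' i, by simp [ht, h1], ?_, ?_, ?_⟩
  · dsimp only
    split_ifs with h
    · obtain rfl : t' = t'' := by omega
      rw [← h2', h1', h2]
    · exact h2'
  · intro i hi hi'
    dsimp only
    rcases lt_trichotomy i t' with h | h | h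
    · rw [if_pos h.le, if_pos (by omega)]
      exact h3 i hi h
    · subst h
      rw [if_pos le_rfl, if_neg (by omega), h2, ← h1']
      exact h3' i le_rfl hi'
    · rw [if_neg (by omega), if_neg (by omega)]
      exact h3' i h.le hi'
  · intro y hy
    rcases Finset.mem_union.1 hy with hy | hy
    · obtain ⟨i, hi, hi', rfl⟩ := h4 y hy
      exact ⟨i, hi, hi'.trans ht', by simp [hi']⟩
    · obtain ⟨i, hi, hi', rfl⟩ := h4' y hy
      refine ⟨i, ht.trans hi, hi', ?_⟩
      dsimp only
      split_ifs with h
      · obtain rfl : i = t' := by omega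
        rw [h2, h1']
      · rfl

lemma trans_empty (h : TemporalTour G t t' u v ∅) (h' : TemporalTour G t' t'' v x ∅)
    (ht : t ≤ t') (ht' : t' ≤ t'') : TemporalTour G t t'' u x ∅ := by
  classical
  simpa using h.trans h' ht ht'

lemma of_adj (h : (G t).Adj u v) : TemporalTour G t (t + 1) u v ∅ :=
  ⟨fun i ↦ if i ≤ t then u else v, by simp, by simp, fun i hi hi' ↦ by
    obtain rfl : i = t := by omega
    simp [h], fun x hx ↦ by simp at hx⟩

end TemporalTour

lemma SimpleGraph.Connected.exists_adj_mem_notMem {V : Type*} {H : SimpleGraph V}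
    (hH : H.Connected) {S : Set V} {a b : V} (ha : a ∈ S) (hb : b ∉ S) :
    ∃ x ∈ S, ∃ y ∉ S, H.Adj x y := by
  obtain ⟨p⟩ := hH.preconnected a b
  obtain ⟨d, -, h1, h2⟩ := p.exists_boundary_dart S ha hb
  exact ⟨_, h1, _, h2, d.adj⟩

lemma temporalTour_add_card {V : Type*} [Fintype V] {G : ℕ → SimpleGraph V}
    (hG : ∀ t, 1 ≤ t → (G t).Connected) {t : ℕ} (ht : 1 ≤ t) (u v : V) :
    TemporalTour G t (t + Fintype.card V) u v ∅ := by
  classical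
  let R : ℕ → Finset V := fun i ↦ {x | TemporalTour G t (t + i) u x ∅}
  have hR : ∀ i x, x ∈ R i ↔ TemporalTour G t (t + i) u x ∅ := fun i x ↦ by simp [R]
  have key : ∀ i, min i (Fintype.card V) ≤ (R i).card := by
    intro i
    induction i with
    | zero => simp
    | succ i ih =>
      have hsub : R i ⊆ R (i + 1) := by
        intro x hx
        rw [hR] at hx ⊢
        exact hx.trans_empty (.stay _ _ _ _) (by omega) (by omega)
      by_cases hall : ∀ x, x ∈ R i
      · have := Finset.card_le_card hsub
        rw [Finset.eq_univ_iff_forall.2 hall, Finset.card_univ] at this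
        omega
      · push Not at hall
        obtain ⟨b, hb⟩ := hall
        have hu : u ∈ R i := (hR _ _).2 (.stay _ _ _ _)
        obtain ⟨x, hx, y, hy, hxy⟩ := (hG (t + i) (by omega)).exists_adj_mem_notMem
          (S := R i) hu hb
        have hlt : R i ⊂ R (i + 1) := by
          refine (Finset.ssubset_iff_of_subset hsub).2 ⟨y, ?_, hy⟩
          exact (hR _ _).2 (((hR _ _).1 hx).trans_empty (.of_adj hxy) (by omega) (by omega))
        have := Finset.card_lt_card hlt
        omega
  have h := key (Fintype.card V)
  rw [min_self] at h
  rw [← hR, Finset.eq_univ_of_card _ (le_antisymm (Finset.card_le_univ _) h)]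
  exact Finset.mem_univ v

/-- If `X` is large compared with the number of underlying edges per time step, then some vertex
of `X` can reach another one. -/
lemma exists_temporalTour_of_lt_card_mul {V : Type*} [DecidableEq V] {G : ℕ → SimpleGraph V}
    (hG : ∀ t, 1 ≤ t → (G t).Connected) {E : Finset (V × V)}
    (hE : ∀ t, 1 ≤ t → ∀ x y, (G t).Adj x y → (x, y) ∈ E) {t : ℕ} (ht : 1 ≤ t)
    {X : Finset V} (hX : 1 < X.card) {L : ℕ} (hL : 2 * E.card < X.card * L) :
    ∃ u ∈ X, ∃ v ∈ X, u ≠ v ∧ TemporalTour G t (t + L) u v ∅ := by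
  by_contra! hno
  have huniq : ∀ u ∈ X, ∀ v ∈ X, ∀ i ≤ L, ∀ x, TemporalTour G t (t + i) u x ∅ →
      TemporalTour G (t + i) (t + L) x v ∅ → u = v := by
    intro u hu v hv i hi x h1 h2
    by_contra hne
    exact hno u hu v hv hne (h1.trans_empty h2 (by omega) (by omega))
  have hstep' : ∀ i < L, ∀ u x, TemporalTour G (t + (i + 1)) (t + L) x u ∅ →
      TemporalTour G (t + i) (t + L) x u ∅ := fun i hi u x h ↦
    (TemporalTour.stay _ _ _ _).trans_empty h (by omega) (by omega)
  have hmono : ∀ i j, i ≤ j → ∀ u x, TemporalTour G t (t + i) u x ∅ →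
      TemporalTour G t (t + j) u x ∅ := fun i j hij u x h ↦
    h.trans_empty (.stay _ _ _ _) (by omega) (by omega)
  have hmono' : ∀ i j, i ≤ j → j ≤ L → ∀ u x, TemporalTour G (t + j) (t + L) x u ∅ →
      TemporalTour G (t + i) (t + L) x u ∅ := fun i j hij hj u x h ↦
    (TemporalTour.stay _ _ _ _).trans_empty h (by omega) (by omega)
  have key : ∀ q ∈ X ×ˢ Finset.range L, ∃ e : Bool × V × V, e.2 ∈ E ∧
      TemporalTour G t (t + q.2) q.1 e.2.1 ∅ ∧
      TemporalTour G (t + (q.2 + 1)) (t + L) e.2.1 q.1 ∅ ∧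
      ((e.1 = true ∧ (∃ u ∈ X, TemporalTour G t (t + (q.2 + 1)) u e.2.2 ∅) ∧
          ∀ u ∈ X, ¬ TemporalTour G t (t + q.2) u e.2.2 ∅) ∨
        (e.1 = false ∧ (∃ u ∈ X, TemporalTour G (t + q.2) (t + L) e.2.2 u ∅) ∧
          ∀ u ∈ X, ¬ TemporalTour G (t + (q.2 + 1)) (t + L) e.2.2 u ∅)) := by
    rintro ⟨v, i⟩ hq
    obtain ⟨hv, hi⟩ : v ∈ X ∧ i < L := by simpa using hq
    obtain ⟨u, hu, huv⟩ := Finset.exists_mem_ne hX v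
    obtain ⟨x, ⟨hx, hx'⟩, y, hy, hxy⟩ := (hG (t + i) (by omega)).exists_adj_mem_notMem
      (S := {x | TemporalTour G t (t + i) v x ∅ ∧ TemporalTour G (t + (i + 1)) (t + L) x v ∅})
      (a := v) (b := u) ⟨.stay _ _ _ _, .stay _ _ _ _⟩ (fun h ↦ huv (huniq v hv u hu i hi.le u h.1
        (.stay _ _ _ _)).symm)
    have hy1 : TemporalTour G t (t + (i + 1)) v y ∅ :=
      hx.trans_empty (.of_adj hxy) (by omega) (by omega)
    have hy2 : TemporalTour G (t + i) (t + L) y v ∅ :=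
      (TemporalTour.of_adj hxy.symm).trans_empty hx' (by omega) (by omega)
    have hxyE := hE (t + i) (by omega) x y hxy
    by_cases hy3 : TemporalTour G t (t + i) v y ∅
    · refine ⟨(false, x, y), hxyE, hx, hx', .inr ⟨rfl, ⟨v, hv, hy2⟩, fun z hz hzy ↦ ?_⟩⟩
      obtain rfl := huniq v hv z hz (i + 1) hi y hy1 hzy
      exact hy ⟨hy3, hzy⟩
    · refine ⟨(true, x, y), hxyE, hx, hx', .inl ⟨rfl, ⟨v, hv, hy1⟩, fun z hz hzy ↦ ?_⟩⟩
      obtain rfl := huniq z hz v hv i hi.le y hzy hy2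
      exact hy3 hzy
  have : Nonempty V := (Finset.card_pos.1 (by omega : 0 < X.card)).to_type
  choose! f hf using key
  have hcard : (X ×ˢ Finset.range L).card ≤ ((Finset.univ : Finset Bool) ×ˢ E).card := by
    refine Finset.card_le_card_of_injOn f (fun q hq ↦ by simpa using (hf q hq).1) ?_
    rintro ⟨u, i⟩ hu ⟨v, j⟩ hv huv
    have hf1 := hf _ hu
    have hf2 := hf _ hv
    rw [huv] at hf1
    simp only [Finset.coe_product, Set.mem_prod, Finset.mem_coe, Finset.mem_range] at hu hv
    obtain ⟨-, hf3, hf4, hf5⟩ := hf1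
    obtain ⟨-, hf6, hf7, hf8⟩ := hf2
    obtain rfl : i = j := by
      rcases hf5 with ⟨hb, ⟨a, ha, ha1⟩, ha2⟩ | ⟨hb, ⟨a, ha, ha1⟩, ha2⟩ <;>
        rcases hf8 with ⟨hb', ⟨b, hb1, hb2⟩, hb3⟩ | ⟨hb', ⟨b, hb1, hb2⟩, hb3⟩
      · rcases lt_trichotomy i j with h | h | h
        · exact absurd (hmono _ _ h _ _ ha1) (hb3 a ha)
        · exact h
        · exact absurd (hmono _ _ h _ _ hb2) (ha2 b hb1)
      · simp_all
      · simp_all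
      · rcases lt_trichotomy i j with h | h | h
        · exact absurd (hmono' _ _ h hv.2.le _ _ hb2) (ha2 b hb1)
        · exact h
        · exact absurd (hmono' _ _ h hu.2.le _ _ ha1) (hb3 a ha)
    rw [huniq u hu.1 v hv.1 i hu.2.le _ hf3 (hstep' i hu.2 _ _ hf7)]
  rw [Finset.card_product, Finset.card_product, Finset.card_range, Finset.card_univ,
    Fintype.card_bool] at hcard
  omega

/-- Greedy independent sets in a digraph with bounded in- and out-degrees. -/
lemma Finset.exists_subset_pairwise_not {α : Type*} [DecidableEq α] (c : α → α → Prop)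
    [DecidableRel c] (D : ℕ) (W : Finset α) (hout : ∀ y ∈ W, (W.filter (c y ·)).card ≤ D)
    (hin : ∀ y ∈ W, (W.filter (c · y)).card ≤ D) :
    ∃ W' ⊆ W, W.card ≤ W'.card * (2 * D + 1) ∧ ∀ y ∈ W', ∀ z ∈ W', y ≠ z → ¬ c y z := by
  induction W using Finset.strongInduction with
  | H W ih =>
    rcases W.eq_empty_or_nonempty with rfl | ⟨y, hy⟩
    · exact ⟨∅, by simp⟩
    let B := insert y (W.filter (c y ·) ∪ W.filter (c · y))
    have hB : B.card ≤ 2 * D + 1 := by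
      have h1 := Finset.card_insert_le y (W.filter (c y ·) ∪ W.filter (c · y))
      have h2 := Finset.card_union_le (W.filter (c y ·)) (W.filter (c · y))
      have h3 := hout y hy
      have h4 := hin y hy
      grind
    have hss : W \ B ⊂ W := (Finset.ssubset_iff_of_subset Finset.sdiff_subset).2
      ⟨y, hy, by simp [B]⟩
    obtain ⟨W', hW', hcard, hind⟩ := ih (W \ B) hss
      (fun z hz ↦ (Finset.card_le_card (Finset.filter_subset_filter _ hss.1)).trans
        (hout z (hss.1 hz)))
      (fun z hz ↦ (Finset.card_le_card (Finset.filter_subset_filter _ hss.1)).trans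
        (hin z (hss.1 hz)))
    have hyW' : y ∉ W' := fun h ↦ by simpa [B] using hW' h
    have hnot : ∀ z ∈ W', ¬ c y z ∧ ¬ c z y := by
      intro z hz
      have := hW' hz
      simp only [B, Finset.mem_sdiff, Finset.mem_insert, Finset.mem_union,
        Finset.mem_filter] at this
      tauto
    refine ⟨insert y W', Finset.insert_subset hy (hW'.trans hss.1), ?_, ?_⟩
    · rw [Finset.card_insert_of_notMem hyW', add_mul, one_mul]
      have := Finset.card_le_card_sdiff_add_card (s := W) (t := B)
      omega
    · intro a ha b hb hab
      rcases Finset.mem_insert.1 ha with rfl | ha' <;> rcases Finset.mem_insert.1 hb with rfl | hb'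
      · exact absurd rfl hab
      · exact (hnot b hb').1
      · exact (hnot a ha').2
      · exact hind a ha' b hb' hab

/-- The deficiency version of Hall's marriage theorem. -/
lemma Finset.exists_injOn_of_card_le_add {α β : Type*} [DecidableEq α] [DecidableEq β]
    [Nonempty β] (r : α → β → Prop) [∀ a b, Decidable (r a b)] (S : Finset α) (T : Finset β) (d : ℕ)
    (h : ∀ A ⊆ S, A.card ≤ (T.filter fun z ↦ ∃ a ∈ A, r a z).card + d) :
    ∃ S' ⊆ S, S.card ≤ S'.card + d ∧ ∃ φ : α → β, Set.InjOn φ S' ∧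
      ∀ a ∈ S', φ a ∈ T ∧ r a (φ a) := by
  let τ : S → Finset (β ⊕ Fin d) := fun a ↦ (T.filter (r a ·)).disjSum Finset.univ
  have hall : ∀ A : Finset S, A.card ≤ (A.biUnion τ).card := by
    intro A
    rcases A.eq_empty_or_nonempty with rfl | ⟨a₀, ha₀⟩
    · simp
    have h1 := h (A.image Subtype.val) (fun x hx ↦ by
      obtain ⟨y, -, rfl⟩ := Finset.mem_image.1 hx
      exact y.2)
    rw [Finset.card_image_of_injective _ Subtype.val_injective] at h1
    have h2 := Finset.card_disjSum (T.filter fun z ↦ ∃ a ∈ A.image Subtype.val, r a z)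
      (Finset.univ : Finset (Fin d))
    rw [Finset.card_univ, Fintype.card_fin] at h2
    rw [← h2] at h1
    refine h1.trans ?_
    refine Finset.card_le_card fun x hx ↦ ?_
    rcases x with z | i
    · simp only [Finset.inl_mem_disjSum, Finset.mem_filter, Finset.mem_image] at hx
      obtain ⟨hz, a, ⟨b, hb, rfl⟩, hr⟩ := hx
      exact Finset.mem_biUnion.2 ⟨b, hb, by simp [τ, hz, hr]⟩
    · exact Finset.mem_biUnion.2 ⟨a₀, ha₀, by simp [τ]⟩
  obtain ⟨f, hf, hfτ⟩ := (Finset.all_card_le_biUnion_card_iff_exists_injective τ).1 hall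
  let S₀ : Finset S := Finset.univ.filter fun a ↦ (f a).isLeft
  have hS₀ : S.card ≤ S₀.card + d := by
    have h1 : (Finset.univ.filter fun a : S ↦ ¬ (f a).isLeft).card ≤
        ((Finset.univ : Finset (Fin d)).map ⟨Sum.inr, Sum.inr_injective⟩ :
          Finset (β ⊕ Fin d)).card := by
      refine Finset.card_le_card_of_injOn f (fun a ha ↦ ?_) hf.injOn
      have ha : ¬ (f a).isLeft := by simpa using ha
      cases h : f a <;> simp_all
    rw [Finset.card_map, Finset.card_univ, Fintype.card_fin] at h1
    have h2 := Finset.card_filter_add_card_filter_not (s := (Finset.univ : Finset S))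
      (fun a ↦ (f a).isLeft = true)
    rw [Finset.card_univ, Fintype.card_coe] at h2
    simp only [S₀]
    omega
  have hval : ∀ a : S, a ∈ S₀ → ∃ z, f a = Sum.inl z ∧ z ∈ T ∧ r a z := by
    intro a ha
    have h1 : (f a).isLeft := by simpa [S₀] using ha
    obtain ⟨z, hz⟩ := Sum.isLeft_iff.1 h1
    have h2 := hfτ a
    rw [hz] at h2
    exact ⟨z, hz, by simpa [τ] using h2⟩
  have hval' : ∀ a : α, a ∈ S₀.image Subtype.val →
      ∃ z, (∃ h : a ∈ S, f ⟨a, h⟩ = Sum.inl z) ∧ z ∈ T ∧ r a z := by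
    intro a ha
    obtain ⟨b, hb, rfl⟩ := Finset.mem_image.1 ha
    obtain ⟨z, h1, h2⟩ := hval b hb
    exact ⟨z, ⟨b.2, h1⟩, h2⟩
  have : S₀.image Subtype.val ⊆ S := fun x hx ↦ by
    obtain ⟨y, -, rfl⟩ := Finset.mem_image.1 hx
    exact y.2
  refine ⟨S₀.image Subtype.val, this, ?_, ?_⟩
  · rwa [Finset.card_image_of_injective _ Subtype.val_injective]
  · choose! φ hφ using hval'
    refine ⟨φ, fun a ha b hb hab ↦ ?_, fun a ha ↦ (hφ a ha).2⟩
    obtain ⟨h1, h2⟩ := (hφ a ha).1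
    obtain ⟨h3, h4⟩ := (hφ b hb).1
    rw [hab, ← h4] at h2
    simpa using hf h2

/-- A set of at most `M` vertices can have large intersection with only few sets of a family of
multiplicity at most `M`. -/
lemma Finset.card_filter_lt_card_inter_le {V : Type*} [DecidableEq V] {S F : Finset V}
    {N : V → Finset V} {M : ℕ} (hF : F.card ≤ M)
    (hN : ∀ v, (S.filter fun s ↦ v ∈ N s).card ≤ M) (o : ℕ) :
    (S.filter fun s ↦ o < (F ∩ N s).card).card ≤ M * M / (o + 1) := by
  rw [Nat.le_div_iff_mul_le (by omega), ← smul_eq_mul]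
  calc _ ≤ ∑ s ∈ S.filter fun s ↦ o < (F ∩ N s).card, (F ∩ N s).card :=
        Finset.card_nsmul_le_sum _ _ _ fun s hs ↦ (Finset.mem_filter.1 hs).2
    _ ≤ ∑ s ∈ S, (F ∩ N s).card :=
        Finset.sum_le_sum_of_subset (Finset.filter_subset _ _)
    _ = ∑ s ∈ S, (F.filter fun v ↦ v ∈ N s).card := by simp_rw [Finset.filter_mem_eq_inter]
    _ = ∑ v ∈ F, (S.filter fun s ↦ v ∈ N s).card :=
        Finset.sum_card_bipartiteAbove_eq_sum_card_bipartiteBelow fun s v ↦ v ∈ N s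
    _ ≤ F.card * M := Finset.sum_le_card_nsmul _ _ _ fun v _ ↦ hN v
    _ ≤ M * M := Nat.mul_le_mul_right _ hF

/-- From all but `d` vertices of `X` start tours from time `t` to time `t + τ` which end at
distinct vertices of `X`, such that each tour is assigned between `ℓ` and `M` visited vertices of
`X`, and each vertex is assigned to at most `M` tours. -/
def HasTourSystem {V : Type*} [DecidableEq V] (G : ℕ → SimpleGraph V) (X : Finset V)
    (t τ d M ℓ : ℕ) : Prop :=
  ∃ (S : Finset V) (e : V → V) (N : V → Finset V), S ⊆ X ∧ X.card ≤ S.card + d ∧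
    (∀ s ∈ S, e s ∈ X) ∧ Set.InjOn e S ∧
    (∀ s ∈ S, TemporalTour G t (t + τ) s (e s) (N s)) ∧
    (∀ s ∈ S, N s ⊆ X ∧ (N s).card ≤ M ∧ ℓ ≤ (N s).card) ∧
    ∀ v, (S.filter fun s ↦ v ∈ N s).card ≤ M

namespace HasTourSystem

variable {V : Type*} [DecidableEq V] {G : ℕ → SimpleGraph V} {X : Finset V}

lemma zero (G : ℕ → SimpleGraph V) (X : Finset V) (t : ℕ) : HasTourSystem G X t 0 0 1 1 := by
  refine ⟨X, id, fun s ↦ {s}, subset_rfl, le_rfl, fun s hs ↦ hs, Function.injective_id.injOn,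
    fun s _ ↦ .refl G t s, fun s hs ↦ by simpa using hs, fun v ↦ ?_⟩
  refine Finset.card_le_one.2 fun a ha b hb ↦ ?_
  simp only [Finset.mem_filter, Finset.mem_singleton] at ha hb
  rw [← ha.2, hb.2]

/-- Concatenating two tour systems, with `L` time steps in between to move from the ends of the
tours of the first system to the starts of the tours of the second one. -/
lemma merge (hG : ∀ t, 1 ≤ t → (G t).Connected) {E : Finset (V × V)}
    (hE : ∀ t, 1 ≤ t → ∀ x y, (G t).Adj x y → (x, y) ∈ E) {t : ℕ} (ht : 1 ≤ t)
    {τ d M ℓ ℓ' L o α w : ℕ} (h₁ : HasTourSystem G X t τ d M ℓ)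
    (h₂ : HasTourSystem G X (t + τ + L) τ d M ℓ) (hℓ : ℓ' + o ≤ 2 * ℓ) (hα : 1 ≤ α)
    (hL : 2 * E.card < (α + 1) * L) (hw : α * (2 * (M * M / (o + 1)) + 1) ≤ w) :
    HasTourSystem G X t (2 * τ + L) (2 * d + w) (2 * M) ℓ' := by
  classical
  have hV : Nonempty V := (hG 1 le_rfl).nonempty
  obtain ⟨S₁, e₁, N₁, hS₁, hd₁, he₁, hinj₁, htour₁, hN₁, hmul₁⟩ := h₁
  obtain ⟨S₂, e₂, N₂, hS₂, hd₂, he₂, hinj₂, htour₂, hN₂, hmul₂⟩ := h₂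
  let r : V → V → Prop := fun s z ↦
    TemporalTour G (t + τ) (t + τ + L) (e₁ s) z ∅ ∧ (N₁ s ∩ N₂ z).card ≤ o
  have hcardS₂ := Finset.card_le_card hS₂
  have hall : ∀ A ⊆ S₁, A.card ≤
      (S₂.filter fun z ↦ ∃ a ∈ A, r a z).card + (X.card - S₂.card + w) := by
    intro A hA
    let B := S₂.filter fun z ↦ ¬ ∃ a ∈ A, r a z
    have hB := Finset.card_filter_add_card_filter_not (s := S₂) (fun z ↦ ∃ a ∈ A, r a z)
    have himg : (A.image e₁).card = A.card :=
      Finset.card_image_of_injOn (hinj₁.mono (Finset.coe_subset.2 hA))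
    have hunion : (A.image e₁ ∪ B).card ≤ X.card := by
      refine Finset.card_le_card (Finset.union_subset (fun x hx ↦ ?_)
        ((Finset.filter_subset _ _).trans hS₂))
      obtain ⟨a, ha, rfl⟩ := Finset.mem_image.1 hx
      exact he₁ a (hA ha)
    have hinter := Finset.card_union_add_card_inter (A.image e₁) B
    suffices hW : (A.image e₁ ∩ B).card ≤ w by
      simp only [B] at *
      omega
    let W := A.image e₁ ∩ B
    have hg : ∀ y ∈ W, ∃ s ∈ A, e₁ s = y := fun y hy ↦
      Finset.mem_image.1 (Finset.mem_inter.1 hy).1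
    choose! g hgA hge using hg
    have hWS₂ : W ⊆ S₂ := Finset.inter_subset_right.trans (Finset.filter_subset _ _)
    obtain ⟨W', hW', hcard, hind⟩ := Finset.exists_subset_pairwise_not
      (fun y z ↦ o < (N₁ (g y) ∩ N₂ z).card) (M * M / (o + 1)) W
      (fun y hy ↦ (Finset.card_le_card (Finset.filter_subset_filter _ hWS₂)).trans
        (Finset.card_filter_lt_card_inter_le (hN₁ _ (hA (hgA y hy))).2.1 hmul₂ o))
      (fun z hz ↦ by
        refine (Finset.card_le_card_of_injOn g (fun y hy ↦ ?_) fun y hy x hx hyx ↦ ?_).trans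
          (Finset.card_filter_lt_card_inter_le (hN₂ _ (hWS₂ hz)).2.1 hmul₁ o)
        · simp only [Finset.coe_filter, Set.mem_ofPred_eq] at hy ⊢
          rw [Finset.inter_comm]
          exact ⟨hA (hgA y hy.1), hy.2⟩
        · simp only [Finset.coe_filter, Set.mem_ofPred_eq] at hy hx
          rw [← hge y hy.1, ← hge x hx.1, hyx])
    by_cases hle : W'.card ≤ α
    · exact hcard.trans ((Nat.mul_le_mul_right _ hle).trans hw)
    · push Not at hle
      exfalso
      obtain ⟨y, hy, z, hz, hyz, htour⟩ := exists_temporalTour_of_lt_card_mul hG hE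
        (t := t + τ) (by omega) (X := W') (by omega)
        (hL.trans_le (Nat.mul_le_mul_right L hle))
      have hzB := (Finset.mem_filter.1 (Finset.mem_inter.1 (hW' hz)).2).2
      refine hzB ⟨g y, hgA y (hW' hy), ?_, not_lt.1 (hind y hy z hz hyz)⟩
      rwa [hge y (hW' hy)]
  obtain ⟨S, hS, hScard, φ, hφ, hφr⟩ := Finset.exists_injOn_of_card_le_add r S₁ S₂ _ hall
  refine ⟨S, e₂ ∘ φ, fun s ↦ N₁ s ∪ N₂ (φ s), hS.trans hS₁, by omega,
    fun s hs ↦ he₂ _ (hφr s hs).1, hinj₂.comp hφ fun s hs ↦ (hφr s hs).1, fun s hs ↦ ?_,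
    fun s hs ↦ ⟨?_, ?_, ?_⟩, fun v ↦ ?_⟩
  · obtain ⟨hz, hr, -⟩ := hφr s hs
    have h := ((htour₁ s (hS hs)).trans hr (by omega) (by omega)).trans (htour₂ _ hz)
      (by omega) (by omega)
    rw [Finset.union_empty] at h
    rwa [show t + τ + L + τ = t + (2 * τ + L) by ring] at h
  · exact Finset.union_subset (hN₁ s (hS hs)).1 (hN₂ _ (hφr s hs).1).1
  · have h1 := (hN₁ s (hS hs)).2.1
    have h2 := (hN₂ _ (hφr s hs).1).2.1
    have h3 := Finset.card_union_le (N₁ s) (N₂ (φ s))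
    dsimp only
    omega
  · have h1 := (hN₁ s (hS hs)).2.2
    have h2 := (hN₂ _ (hφr s hs).1).2.2
    have h3 := Finset.card_union_add_card_inter (N₁ s) (N₂ (φ s))
    have h4 := (hφr s hs).2.2
    dsimp only
    omega
  · have h1 : (S.filter fun s ↦ v ∈ N₂ (φ s)).card ≤ M := by
      refine (Finset.card_le_card_of_injOn φ (fun s hs ↦ ?_)
        (hφ.mono fun s hs ↦ (Finset.mem_filter.1 hs).1)).trans (hmul₂ v)
      simp only [Finset.coe_filter, Set.mem_ofPred_eq] at hs ⊢
      exact ⟨(hφr s hs.1).1, hs.2⟩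
    have h2 := (Finset.card_le_card (Finset.filter_subset_filter (fun s ↦ v ∈ N₁ s) hS)).trans
      (hmul₁ v)
    simp_rw [Finset.mem_union, Finset.filter_or]
    have h3 := Finset.card_union_le (S.filter fun s ↦ v ∈ N₁ s) (S.filter fun s ↦ v ∈ N₂ (φ s))
    omega

end HasTourSystem

section Exploration

variable {V : Type*} [Fintype V] [DecidableEq V] {G : ℕ → SimpleGraph V} {E : Finset (V × V)}
  {k : ℕ}

lemma exists_hasTourSystem (hG : ∀ t, 1 ≤ t → (G t).Connected)
    (hE : ∀ t, 1 ≤ t → ∀ x y, (G t).Adj x y → (x, y) ∈ E) (hk : 1 ≤ k)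
    (hcard : E.card ≤ 2 * (k * Fintype.card V)) (X : Finset V) {A : ℕ}
    (hA : 2 ^ A ≤ Fintype.card V) {a : ℕ} (ha : a ≤ A) :
    ∃ τ d ℓ : ℕ, (τ : ℝ) ≤ 4 * (Fintype.card V / 2 ^ A) * (2 ^ a - (3 / 2) ^ a) ∧
      (d : ℝ) ≤ 405 / 2 * (k * 2 ^ A) * (2 ^ a - (16 / 9) ^ a) ∧
      (2 ^ a + (3 / 2) ^ a) / 2 ≤ (ℓ : ℝ) ∧ ∀ t, 1 ≤ t → HasTourSystem G X t τ d (2 ^ a) ℓ := by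
  induction a with
  | zero => exact ⟨0, 0, 1, by simp, by simp, by norm_num, fun t _ ↦ .zero G X t⟩
  | succ a ih =>
    obtain ⟨τ, d, ℓ, hτ, hd, hℓ, hsys⟩ := ih (by omega)
    have hk' : (1 : ℝ) ≤ k := by exact_mod_cast hk
    set n : ℝ := (Fintype.card V : ℝ) with hn
    set P : ℝ := 2 ^ A with hP
    have hP0 : 0 < P := by positivity
    have hPn : P ≤ n := by rw [hn, hP]; exact_mod_cast hA
    have hρ1 : (1 : ℝ) ≤ (3 / 2) ^ a := one_le_pow₀ (by norm_num)
    have hρP : (3 / 2 : ℝ) ^ a ≤ P :=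
      (pow_le_pow_left₀ (by norm_num) (by norm_num) a).trans
        (pow_le_pow_right₀ (by norm_num) (by omega : a ≤ A))
    set ρ : ℝ := (3 / 2) ^ a with hρ
    have hnP : 1 ≤ n / P := (one_le_div hP0).2 hPn
    have hL0 : 0 < n / P * ρ := by positivity
    set L : ℕ := ⌈n / P * ρ⌉₊
    have hL1 : n / P * ρ ≤ L := Nat.le_ceil _
    have hL2 : (L : ℝ) ≤ 2 * (n / P) * ρ := by
      have := (Nat.ceil_lt_add_one hL0.le).le
      nlinarith
    have hLpos : (0 : ℝ) < L := hL0.trans_le hL1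
    set o : ℕ := ⌊ρ / 4⌋₊
    have ho1 : (o : ℝ) ≤ ρ / 4 := Nat.floor_le (by positivity)
    have ho2 : ρ / 4 < o + 1 := Nat.lt_floor_add_one _
    set α : ℕ := ⌊4 * (k * n) / L⌋₊ + 1 with hαdef
    have hα1 : (α : ℝ) ≤ 5 * (k * P) / ρ := by
      have h1 : (⌊4 * (k * n) / L⌋₊ : ℝ) ≤ 4 * (k * n) / L := Nat.floor_le (by positivity)
      have h2 : 4 * (k * n) / L ≤ 4 * (k * P) / ρ := by
        rw [div_le_div_iff₀ hLpos (by positivity)]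
        have : n * ρ ≤ P * L := by
          rwa [div_mul_eq_mul_div, div_le_iff₀ hP0, mul_comm (L : ℝ)] at hL1
        nlinarith
      have h3 : 1 ≤ k * P / ρ := by
        rw [one_le_div (by positivity)]
        nlinarith
      rw [hαdef]
      push_cast
      rw [mul_div_assoc 4 (k * P)] at h2
      rw [mul_div_assoc 5 (k * P)]
      linarith
    have hα2 : 2 * E.card < (α + 1) * L := by
      have h1 : 4 * (k * n) / L < α := by
        rw [hαdef]
        push_cast
        exact Nat.lt_floor_add_one _
      rw [div_lt_iff₀ hLpos] at h1
      have h2 : (E.card : ℝ) ≤ 2 * (k * n) := by rw [hn]; exact_mod_cast hcard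
      have h3 : (2 * E.card : ℝ) < (α + 1) * L := by nlinarith
      exact_mod_cast h3
    have hD : ((2 ^ a * 2 ^ a / (o + 1) : ℕ) : ℝ) ≤ 4 * (8 / 3) ^ a := by
      refine Nat.cast_div_le.trans ?_
      push_cast
      rw [div_le_iff₀ (by positivity)]
      have h1 : (2 : ℝ) ^ a * 2 ^ a = (8 / 3) ^ a * ρ := by
        rw [hρ, ← mul_pow, ← mul_pow]
        norm_num
      have h2 : (0 : ℝ) < (8 / 3) ^ a := by positivity
      nlinarith
    set w : ℕ := α * (2 * (2 ^ a * 2 ^ a / (o + 1)) + 1) with hwdef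
    have hw : (w : ℝ) ≤ 45 * (k * P) * (16 / 9) ^ a := by
      have h1 : (1 : ℝ) ≤ (8 / 3) ^ a := one_le_pow₀ (by norm_num)
      have h2 : (16 / 9 : ℝ) ^ a * ρ = (8 / 3) ^ a := by
        rw [hρ, ← mul_pow]
        norm_num
      calc (w : ℝ) = α * (2 * ((2 ^ a * 2 ^ a / (o + 1) : ℕ) : ℝ) + 1) := by
            rw [hwdef]
            push_cast
            rfl
        _ ≤ 5 * (k * P) / ρ * (9 * (8 / 3) ^ a) := by
            gcongr
            linarith
        _ = 45 * (k * P) * (16 / 9) ^ a := by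
            rw [← h2]
            field_simp
            norm_num
    refine ⟨2 * τ + L, 2 * d + w, 2 * ℓ - o, ?_, ?_, ?_, fun t ht ↦ ?_⟩
    · push_cast
      rw [pow_succ, pow_succ, ← hρ]
      linarith
    · push_cast
      rw [pow_succ, pow_succ]
      linarith
    · have h1 : ((2 * ℓ : ℕ) : ℝ) - (o : ℕ) ≤ ((2 * ℓ - o : ℕ) : ℝ) := by
        rw [sub_le_iff_le_add]
        exact_mod_cast le_tsub_add
      push_cast at h1
      rw [pow_succ, pow_succ, ← hρ]
      linarith
    · rw [pow_succ, mul_comm (2 ^ a)]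
      refine (hsys t ht).merge hG hE ht (hsys (t + τ + L) (by omega)) ?_ (by omega) hα2 le_rfl
      refine (Nat.sub_add_cancel ?_).le
      have h1 : (1 : ℝ) ≤ 2 ^ a := one_le_pow₀ (by norm_num)
      have h2 : (o : ℝ) ≤ 2 * ℓ := by linarith
      exact_mod_cast h2

/-- Within `4 * n` time steps some tour visits a fraction of order `1 / √(k * |X|)` of `X`. -/
lemma exists_temporalTour_card_le (hG : ∀ t, 1 ≤ t → (G t).Connected)
    (hE : ∀ t, 1 ≤ t → ∀ x y, (G t).Adj x y → (x, y) ∈ E) (hk : 1 ≤ k)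
    (hcard : E.card ≤ 2 * (k * Fintype.card V)) {X : Finset V} (hX : X.Nonempty) {t : ℕ}
    (ht : 1 ≤ t) :
    ∃ τ ≤ 4 * Fintype.card V, ∃ x y, ∃ N ⊆ X, N.Nonempty ∧
      X.card ≤ 3600 * k * N.card ^ 2 ∧ TemporalTour G t (t + τ) x y N := by
  by_cases hsmall : X.card ≤ 203 * k
  · obtain ⟨x, hx⟩ := hX
    exact ⟨0, by omega, x, x, {x}, by simpa using hx, by simp, by simp; omega, .refl G t x⟩
  push Not at hsmall
  have hex : ∃ A, 203 * k * 4 ^ A < X.card ∧ X.card ≤ 203 * k * 4 ^ (A + 1) := by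
    have hle : ∃ B, X.card ≤ 203 * k * 4 ^ B :=
      ⟨X.card, (Nat.lt_pow_self (by norm_num)).le.trans (Nat.le_mul_of_pos_left _ (by omega))⟩
    obtain ⟨A, hA⟩ : ∃ A, Nat.find hle = A + 1 := Nat.exists_eq_succ_of_ne_zero fun h ↦ by
      have := Nat.find_spec hle
      rw [h] at this
      omega
    exact ⟨A, not_le.1 (Nat.find_min hle (by omega)), hA ▸ Nat.find_spec hle⟩
  obtain ⟨A, hA1, hA2⟩ := hex
  have hA : 2 ^ A ≤ Fintype.card V := by
    have h1 : 2 ^ A ≤ 4 ^ A := Nat.pow_le_pow_left (by norm_num) A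
    have h2 := Finset.card_le_univ X
    nlinarith
  obtain ⟨τ, d, ℓ, hτ, hd, hℓ, hsys⟩ := exists_hasTourSystem hG hE hk hcard X hA le_rfl
  obtain ⟨S, e, N, hSX, hS, -, -, htour, hN, -⟩ := hsys t ht
  have h4 : (4 : ℝ) ^ A = 2 ^ A * 2 ^ A := by
    rw [← mul_pow]
    norm_num
  have hdX : d < X.card := by
    have h1 : (203 * k * 4 ^ A : ℝ) < X.card := by exact_mod_cast hA1
    have h2 : (d : ℝ) ≤ 405 / 2 * (k * 2 ^ A) * 2 ^ A := by
      refine hd.trans ?_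
      gcongr
      exact sub_le_self _ (by positivity)
    have h3 : (0 : ℝ) ≤ k * 2 ^ A * 2 ^ A := by positivity
    have : (d : ℝ) < X.card := by
      rw [h4] at h1
      linarith
    exact_mod_cast this
  obtain ⟨s, hs⟩ : S.Nonempty := Finset.card_pos.1 (by omega)
  have hNs : (2 : ℝ) ^ A ≤ 2 * (N s).card := by
    have h1 : (ℓ : ℝ) ≤ (N s).card := by exact_mod_cast (hN s hs).2.2
    have h2 : (0 : ℝ) < (3 / 2) ^ A := by positivity
    linarith
  have hNs' : 2 ^ A ≤ 2 * (N s).card := by exact_mod_cast hNs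
  refine ⟨τ, ?_, s, e s, N s, (hN s hs).1, ?_, ?_, htour s hs⟩
  · have h1 : (τ : ℝ) ≤ 4 * (Fintype.card V / 2 ^ A) * 2 ^ A := by
      refine hτ.trans ?_
      gcongr
      exact sub_le_self _ (by positivity)
    rw [mul_assoc, div_mul_cancel₀ _ (by positivity)] at h1
    exact_mod_cast h1
  · have : 0 < 2 ^ A := by positivity
    exact Finset.card_pos.1 (by omega)
  · have h1 : 4 ^ (A + 1) = 4 * (2 ^ A * 2 ^ A) := by
      rw [← mul_pow, pow_succ, mul_comm]
      norm_num
    have h2 := Nat.mul_le_mul hNs' hNs'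
    rw [h1] at hA2
    nlinarith

/-- All vertices of `X` can be visited within `600 * n * √(k * |X|)` time steps. -/
lemma exists_temporalTour_le_sqrt (hG : ∀ t, 1 ≤ t → (G t).Connected)
    (hE : ∀ t, 1 ≤ t → ∀ x y, (G t).Adj x y → (x, y) ∈ E) (hk : 1 ≤ k)
    (hcard : E.card ≤ 2 * (k * Fintype.card V)) (X : Finset V) {t : ℕ} (ht : 1 ≤ t) (u : V) :
    ∃ (τ : ℕ) (v : V), (τ : ℝ) ≤ 600 * Fintype.card V * √k * √X.card ∧
      TemporalTour G t (t + τ) u v X := by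
  induction X using Finset.strongInduction generalizing t u with
  | H X ih =>
    rcases X.eq_empty_or_nonempty with rfl | hX
    · exact ⟨0, u, by simp, .stay G _ _ u⟩
    obtain ⟨τ, hτ, x, y, N, hNX, hN, hXN, htour⟩ :=
      exists_temporalTour_card_le hG hE hk hcard hX (t := t + Fintype.card V) (by omega)
    have hss : X \ N ⊂ X := by
      obtain ⟨z, hz⟩ := hN
      exact (Finset.ssubset_iff_of_subset Finset.sdiff_subset).2 ⟨z, hNX hz, by simp [hz]⟩
    obtain ⟨τ', v, hτ', htour'⟩ := ih _ hss (by omega : 1 ≤ t + Fintype.card V + τ) y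
    refine ⟨Fintype.card V + τ + τ', v, ?_, ?_⟩
    · have h1 : (X.card : ℝ) = (X \ N).card + N.card := by
        exact_mod_cast (Finset.card_sdiff_add_card_eq_card hNX).symm
      have h2 : (X.card : ℝ) ≤ 3600 * k * N.card ^ 2 := by exact_mod_cast hXN
      have hN0 : (0 : ℝ) < N.card := by exact_mod_cast Finset.card_pos.2 hN
      have h3 : √(X \ N).card ≤ √X.card := Real.sqrt_le_sqrt (by linarith)
      have h4 : √X.card ≤ 60 * √k * N.card := by
        refine Real.sqrt_le_iff.2 ⟨by positivity, h2.trans_eq ?_⟩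
        rw [mul_pow, mul_pow, Real.sq_sqrt (by positivity)]
        norm_num
      have h5 : √X.card ^ 2 = X.card := Real.sq_sqrt (by positivity)
      have h6 : √(X \ N).card ^ 2 = (X \ N).card := Real.sq_sqrt (by positivity)
      have h7 : 1 ≤ 120 * √k * (√X.card - √(X \ N).card) := by
        refine le_of_mul_le_mul_right ?_ hN0
        calc 1 * (N.card : ℝ) = (√X.card - √(X \ N).card) * (√X.card + √(X \ N).card) := by
              linear_combination h6 - h5 - h1
          _ ≤ (√X.card - √(X \ N).card) * (2 * (60 * √k * N.card)) := by
              gcongr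
              linarith
          _ = _ := by ring
      have h8 : (τ : ℝ) ≤ 4 * Fintype.card V := by exact_mod_cast hτ
      have h9 : (0 : ℝ) ≤ Fintype.card V := by positivity
      push_cast
      nlinarith
    · have h := ((temporalTour_add_card hG ht u x).trans htour (by omega) (by omega)).trans htour'
        (by omega) (by omega)
      rw [Finset.empty_union, Finset.union_sdiff_of_subset hNX] at h
      rwa [show t + Fintype.card V + τ + τ' = t + (Fintype.card V + τ + τ') by ring] at h

end Exploration

/-- There is an absolute constant `C > 0` such that for every integer
`k ≥ 1`, any always-connected temporal graph `(G_t)_{t ≥ 1}` on `n ≥ 2` vertices whose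
underlying graph has treewidth at most `k` admits, from any start vertex `s`, a temporal
exploration spanning at most `C · n^{3/2} · √(k · log₂ n)` time steps. -/
theorem temporal_exploration_bounded_treewidth :
    ∃ C : ℝ, 0 < C ∧
      ∀ (k : ℕ) (V : Type) [Fintype V] (G : ℕ → SimpleGraph V),
        1 ≤ k → 2 ≤ Fintype.card V →
        (∀ t : ℕ, 1 ≤ t → (G t).Connected) →
        TreewidthAtMost (⨆ t : ℕ, ⨆ _ : 1 ≤ t, G t : SimpleGraph V) k →
        ∀ s : V, ∃ (r : ℕ) (w : ℕ → V),
          w 1 = s ∧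
          (∀ t : ℕ, 1 ≤ t → t ≤ r → (w t = w (t + 1) ∨ (G t).Adj (w t) (w (t + 1)))) ∧
          (∀ v : V, ∃ t : ℕ, 1 ≤ t ∧ t ≤ r + 1 ∧ w t = v) ∧
          (r : ℝ) ≤ C * (Fintype.card V : ℝ) ^ (3/2 : ℝ) *
            Real.sqrt ((k : ℝ) * Real.logb 2 (Fintype.card V)) := by
  refine ⟨600, by norm_num, fun k V _ G hk hn hG hH s ↦ ?_⟩
  classical
  obtain ⟨τ, v, hτ, w, hw1, -, hw, hcov⟩ := exists_temporalTour_le_sqrt hG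
    (E := {p : V × V | (⨆ t : ℕ, ⨆ _ : 1 ≤ t, G t : SimpleGraph V).Adj p.1 p.2})
    (fun t ht x y hxy ↦ by
      simp only [Finset.mem_filter, Finset.mem_univ, true_and]
      exact (le_iSup₂_of_le t ht le_rfl : G t ≤ ⨆ t : ℕ, ⨆ _ : 1 ≤ t, G t) hxy)
    hk hH.card_adj_le Finset.univ le_rfl s
  refine ⟨τ, w, hw1, fun t ht htτ ↦ hw t ht (by omega), fun x ↦ ?_, hτ.trans ?_⟩
  · obtain ⟨t, ht, htτ, hx⟩ := hcov x (Finset.mem_univ x)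
    exact ⟨t, ht, by omega, hx⟩
  · have hn' : (2 : ℝ) ≤ Fintype.card V := by exact_mod_cast hn
    have hlog : 1 ≤ Real.logb 2 (Fintype.card V) := by
      rw [Real.le_logb_iff_rpow_le (by norm_num) (by linarith)]
      simpa using hn'
    have hpow : (Fintype.card V : ℝ) ^ (3 / 2 : ℝ) = Fintype.card V * √(Fintype.card V) := by
      rw [show (3 / 2 : ℝ) = 1 + 1 / 2 by norm_num, Real.rpow_add (by linarith), Real.rpow_one,
        Real.sqrt_eq_rpow]
    calc 600 * (Fintype.card V : ℝ) * √k * √(Finset.univ : Finset V).card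
        = 600 * (Fintype.card V : ℝ) ^ (3 / 2 : ℝ) * √k := by
          rw [hpow, Finset.card_univ]
          ring
      _ ≤ _ := by
          gcongr
          exact le_mul_of_one_le_right (by positivity) hlog
end

section
/- There exists an absolute constant C > 0 such that the following holds. Let t ≥ 3 be an integer and let G = (G_s)_{s ∈ ℕ, s ≥ 1} be an always-connected temporal graph on a vertex set of size n ≥ 2 whose underlying graph contains no K_t minor. Then for every start vertex v, there exists a temporal exploration of G starting at v that spans at most C · t^{1/2} · (log₂ t)^{1/4} · n^{3/2} · sqrt(log₂ n) time steps. -/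
/-- `H` contains a `K_t` minor: there are `t` pairwise disjoint branch sets, each
inducing a connected (hence nonempty) subgraph of `H`, with an edge of `H` between
every two distinct branch sets. -/
def HasCompleteMinor {V : Type} (H : SimpleGraph V) (t : ℕ) : Prop :=
  ∃ B : Fin t → Set V,
    (∀ i, (SimpleGraph.induce (B i) H).Connected) ∧
    (Pairwise fun i j => Disjoint (B i) (B j)) ∧
    ∀ i j : Fin t, i ≠ j → ∃ u ∈ B i, ∃ v ∈ B j, H.Adj u v

/-- There is a temporal walk from `x` at time `a` to `y` at time `b` visiting all of `S`. -/
def TemporalWalk {V : Type} (G : ℕ → SimpleGraph V) (a b : ℕ) (x y : V) (S : Set V) : Prop :=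
  ∃ w : ℕ → V, w a = x ∧ w b = y ∧
    (∀ s, a ≤ s → s < b → (w s = w (s + 1) ∨ (G s).Adj (w s) (w (s + 1)))) ∧
    ∀ u ∈ S, ∃ s, a ≤ s ∧ s ≤ b ∧ w s = u

namespace TemporalWalk

variable {V : Type} {G : ℕ → SimpleGraph V} {a b c : ℕ} {x y z : V} {S T : Set V}

theorem mono (h : TemporalWalk G a b x y S) (hT : T ⊆ S) : TemporalWalk G a b x y T := by
  obtain ⟨w, h1, h2, h3, h4⟩ := h
  exact ⟨w, h1, h2, h3, fun u hu => h4 u (hT hu)⟩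

theorem wait (hab : a ≤ b) (x : V) : TemporalWalk G a b x x {x} :=
  ⟨fun _ => x, rfl, rfl, fun _ _ _ => Or.inl rfl, fun _ hu => ⟨a, le_rfl, hab, hu.symm⟩⟩

theorem step (h : (G a).Adj x y) : TemporalWalk G a (a + 1) x y ∅ := by
  refine ⟨fun s => if s ≤ a then x else y, by simp, by simp, fun s h1 h2 => ?_, by simp⟩
  obtain rfl : s = a := by omega
  simp [h]

theorem trans (h₁ : TemporalWalk G a b x y S) (h₂ : TemporalWalk G b c y z T)
    (hab : a ≤ b) (hbc : b ≤ c) : TemporalWalk G a c x z (S ∪ T) := by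
  obtain ⟨w, h1, h2, h3, h4⟩ := h₁
  obtain ⟨w', h1', h2', h3', h4'⟩ := h₂
  have key : ∀ s, b ≤ s → (if s ≤ b then w s else w' s) = w' s := by
    intro s hs
    split_ifs with h
    · obtain rfl : s = b := by omega
      rw [h2, h1']
    · rfl
  refine ⟨fun s => if s ≤ b then w s else w' s, by simp [hab, h1], (key c hbc).trans h2', ?_, ?_⟩
  · intro s hs hs'
    by_cases hsb : s < b
    · simpa [hsb.le, Nat.succ_le_of_lt hsb] using h3 s hs hsb
    · simp only [key s (by omega), key (s + 1) (by omega)]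
      exact h3' s (by omega) hs'
  · rintro u (hu | hu)
    · obtain ⟨s, p, q, r⟩ := h4 u hu
      exact ⟨s, p, by omega, by simp [q, r]⟩
    · obtain ⟨s, p, q, r⟩ := h4' u hu
      exact ⟨s, by omega, q, (key s p).trans r⟩

theorem mem_end (h : TemporalWalk G a b x y S) (hab : a ≤ b) :
    TemporalWalk G a b x y (S ∪ {y}) :=
  h.trans (wait le_rfl y) hab le_rfl

end TemporalWalk

/-- A connected graph has an edge leaving every nonempty proper vertex set. -/
theorem SimpleGraph.Connected.exists_adj_boundary {V : Type} {H : SimpleGraph V}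
    (hH : H.Connected) {p : V → Prop} {x y : V} (hx : p x) (hy : ¬ p y) :
    ∃ z z', H.Adj z z' ∧ p z ∧ ¬ p z' := by
  by_contra! hcon
  obtain ⟨w⟩ := hH.preconnected x y
  have : ∀ {u v : V} (_ : H.Walk u v), p u → p v := by
    intro u v w
    induction w with
    | nil => exact id
    | cons h _ ih => exact fun hu => ih (hcon _ _ h hu)
  exact hy (this w hx)

section Exploration

variable {V : Type} [Fintype V] {G : ℕ → SimpleGraph V}

open Finset Classical in
theorem TemporalWalk.exists_of_card_le (hG : ∀ s, 1 ≤ s → (G s).Connected) {a : ℕ} (ha : 1 ≤ a)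
    (x y : V) : TemporalWalk G a (a + Fintype.card V) x y ∅ := by
  let R : ℕ → Finset V := fun i => univ.filter fun z => TemporalWalk G a (a + i) x z ∅
  have hmono : ∀ i, R i ⊆ R (i + 1) := by
    intro i z hz
    simp only [R, mem_filter, mem_univ, true_and] at hz ⊢
    exact (hz.trans (wait (Nat.le_succ _) z) (by omega) (by omega)).mono (by simp)
  have hcard : ∀ i, R i = univ ∨ i + 1 ≤ #(R i) := by
    intro i
    induction i with
    | zero =>
      right
      refine card_pos.2 ⟨x, ?_⟩
      simp only [R, mem_filter, mem_univ, true_and]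
      exact (wait le_rfl x).mono (by simp)
    | succ i ih =>
      rcases ih with ih | ih
      · left
        exact univ_subset_iff.1 (ih ▸ hmono i)
      · by_cases h : ∀ z, z ∈ R i
        · left
          exact univ_subset_iff.1 fun z _ => hmono i (h z)
        · right
          push Not at h
          obtain ⟨y, hy⟩ := h
          obtain ⟨z, hz⟩ : (R i).Nonempty := card_pos.1 (by omega)
          obtain ⟨z, z', hzz, hz, hz'⟩ :=
            (hG (a + i) (by omega)).exists_adj_boundary (p := (· ∈ R i)) hz hy
          have hz1 : z' ∈ R (i + 1) := by
            simp only [R, mem_filter, mem_univ, true_and] at hz ⊢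
            exact (hz.trans (step hzz) (by omega) (by omega)).mono (by simp)
          have : #(R i) < #(R (i + 1)) :=
            card_lt_card ⟨hmono i, fun h => hz' (h hz1)⟩
          omega
  have : y ∈ R (Fintype.card V) := by
    rcases hcard (Fintype.card V) with h | h
    · simp [h]
    · have := card_le_univ (R (Fintype.card V))
      omega
  simpa [R] using this

open Finset Classical in
/-- A set of vertices none of which reaches another one during a window of length `ℓ` is small. -/
theorem mul_card_le_of_forall_not_reach (hG : ∀ s, 1 ≤ s → (G s).Connected)
    {H : SimpleGraph V} (hH : ∀ s, 1 ≤ s → G s ≤ H) {a ℓ : ℕ} (ha : 1 ≤ a)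
    {X : Finset V} (hX : 2 ≤ #X)
    (hind : ∀ x ∈ X, ∀ y ∈ X, x ≠ y → ¬ TemporalWalk G a (a + ℓ) x y ∅) :
    ℓ * #X ≤ 4 * #(univ.filter fun e : V × V => H.Adj e.1 e.2) := by
  set E := univ.filter fun e : V × V => H.Adj e.1 e.2 with hE
  let L : ℕ → V → Finset V := fun i z => X.filter fun x => TemporalWalk G a (a + i) x z ∅
  let ρ : ℕ → V → ℕ := fun i z => min #(L i z) 2
  have hLwait : ∀ i z, L i z ⊆ L (i + 1) z := by
    intro i z x hx
    simp only [L, mem_filter] at hx ⊢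
    exact ⟨hx.1, (hx.2.trans (TemporalWalk.wait (Nat.le_succ _) z) (by omega) (by omega)).mono
      (by simp)⟩
  have hLmono : ∀ z, Monotone fun i => L i z := fun z => monotone_nat_of_le_succ (hLwait · z)
  have hLstep : ∀ i z z', (G (a + i)).Adj z z' → L i z ⊆ L (i + 1) z' := by
    intro i z z' h x hx
    simp only [L, mem_filter] at hx ⊢
    exact ⟨hx.1, (hx.2.trans (TemporalWalk.step h) (by omega) (by omega)).mono (by simp)⟩
  have hself : ∀ i ≤ ℓ, ∀ x ∈ X, L i x = {x} := by
    intro i hi x hx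
    ext y
    simp only [L, mem_filter, mem_singleton]
    constructor
    · rintro ⟨hy, h⟩
      by_contra hne
      exact hind y hy x hx hne
        ((h.trans (TemporalWalk.wait (show a + i ≤ a + ℓ by omega) x) (by omega)
          (by omega)).mono (by simp))
    · rintro rfl
      exact ⟨hx, (TemporalWalk.wait (by omega) y).mono (by simp)⟩
  have hρmono : ∀ i z, ρ i z ≤ ρ (i + 1) z := fun i z =>
    min_le_min_right _ (card_le_card (hLwait i z))
  have hround : ∀ i < ℓ, #X ≤ ∑ e ∈ E, ((ρ (i + 1) e.1 - ρ i e.1) + (ρ (i + 1) e.2 - ρ i e.2)) := by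
    intro i hi
    have hex : ∀ x ∈ X, ∃ e ∈ E, L i e.1 = {x} ∧
        1 ≤ (ρ (i + 1) e.1 - ρ i e.1) + (ρ (i + 1) e.2 - ρ i e.2) := by
      intro x hx
      obtain ⟨y, hy, hyx⟩ := exists_mem_ne (by omega : 1 < #X) x
      obtain ⟨z, z', hzz, hz, hz'⟩ :=
        (hG (a + i) (by omega)).exists_adj_boundary (p := fun z => L i z = {x})
          (hself i hi.le x hx)
          (by rw [hself i hi.le y hy]; simpa using hyx : ¬ L i y = {x})
      refine ⟨(z, z'), by simpa [hE] using hH _ (by omega) hzz, hz, ?_⟩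
      by_contra hlt
      have h1 := hρmono i z
      have h2 := hρmono i z'
      have e1 : ρ (i + 1) z = ρ i z := by simp only at hlt; omega
      have e2 : ρ (i + 1) z' = ρ i z' := by simp only at hlt; omega
      have h3 : L i z ⊆ L (i + 1) z' := hLstep i z z' hzz
      have h4 : L i z' ⊆ L (i + 1) z := hLstep i z' z hzz.symm
      have c1 : #(L (i + 1) z) = 1 := by
        simp only [ρ, hz, card_singleton] at e1
        omega
      have h5 : L (i + 1) z = {x} := by
        refine (eq_of_subset_of_card_le (hz ▸ hLwait i z) ?_).symm
        simp [c1]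
      rw [h5] at h4
      rcases subset_singleton_iff.1 h4 with h | h
      · have : x ∈ L (i + 1) z' := h3 (by simp [hz])
        have := card_pos.2 ⟨x, this⟩
        simp only [ρ, h, card_empty] at e2
        omega
      · exact hz' h
    choose! f hfE hfL hf1 using hex
    have hinj : Set.InjOn f X := by
      intro x hx y hy hxy
      have := hfL x hx
      rw [hxy, hfL y hy] at this
      exact (singleton_injective this).symm
    calc #X = ∑ e ∈ X.image f, 1 := by rw [sum_const, card_image_of_injOn hinj]; simp
      _ ≤ ∑ e ∈ X.image f, ((ρ (i + 1) e.1 - ρ i e.1) + (ρ (i + 1) e.2 - ρ i e.2)) := by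
        refine sum_le_sum fun e he => ?_
        obtain ⟨x, hx, rfl⟩ := mem_image.1 he
        exact hf1 x hx
      _ ≤ _ := sum_le_sum_of_subset (image_subset_iff.2 hfE)
  have htel : ∀ z, ∑ i ∈ range ℓ, (ρ (i + 1) z - ρ i z) ≤ 2 := by
    intro z
    rw [sum_range_tsub (f := fun i => ρ i z) (monotone_nat_of_le_succ (hρmono · z))]
    exact (Nat.sub_le _ _).trans (min_le_right _ _)
  calc ℓ * #X = ∑ i ∈ range ℓ, #X := by simp
    _ ≤ ∑ i ∈ range ℓ, ∑ e ∈ E, ((ρ (i + 1) e.1 - ρ i e.1) + (ρ (i + 1) e.2 - ρ i e.2)) :=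
      sum_le_sum fun i hi => hround i (mem_range.1 hi)
    _ = ∑ e ∈ E, ((∑ i ∈ range ℓ, (ρ (i + 1) e.1 - ρ i e.1)) +
        ∑ i ∈ range ℓ, (ρ (i + 1) e.2 - ρ i e.2)) := by
      rw [sum_comm]
      exact sum_congr rfl fun e _ => sum_add_distrib
    _ ≤ ∑ e ∈ E, 4 := sum_le_sum fun e _ => by
      have := htel e.1
      have := htel e.2
      omega
    _ = 4 * #E := by simp [mul_comm]

end Exploration

section Domination

open Finset Classical

variable {V : Type} {R : V → V → Prop} {α : ℕ}

/-- A directed form of Turán's theorem. -/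
theorem card_sq_le_of_independent_card_le
    (hα : ∀ X : Finset V, (∀ x ∈ X, ∀ y ∈ X, x ≠ y → ¬ R x y) → #X ≤ α) (Y : Finset V) :
    #Y ^ 2 ≤ α * #Y + 2 * α * ∑ v ∈ Y, ∑ u ∈ Y, if v ≠ u ∧ R v u then 1 else 0 := by
  induction Y using Finset.strongInduction with
  | H Y ih =>
  rcases Y.eq_empty_or_nonempty with rfl | ⟨y₀, hy₀⟩
  · simp
  obtain ⟨I, hI, hmax⟩ := exists_max_image
    (Y.powerset.filter fun X => ∀ x ∈ X, ∀ y ∈ X, x ≠ y → ¬ R x y) card ⟨∅, by simp⟩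
  simp only [mem_filter, mem_powerset] at hI hmax
  obtain ⟨hIY, hind⟩ := hI
  have hIne : I.Nonempty := by
    rw [← card_pos]
    have := hmax {y₀} ⟨by simpa using hy₀, by simp +contextual⟩
    simpa using this
  obtain ⟨J, hJ⟩ : ∃ J, J = Y \ I := ⟨_, rfl⟩
  have hJY : J ⊂ Y := hJ ▸ sdiff_ssubset hIY hIne
  have hdisj : Disjoint I J := hJ ▸ disjoint_sdiff
  have hunion : Y = I ∪ J := by rw [hJ, union_sdiff_of_subset hIY]
  have hcardY : #Y = #I + #J := by rw [hunion, card_union_of_disjoint hdisj]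
  have hIα := hα I hind
  have hadj : ∀ y ∈ J, ∃ i ∈ I, R i y ∨ R y i := by
    intro y hy
    by_contra! hcon
    have hyI : y ∉ I := fun h => disjoint_left.1 hdisj h hy
    have := hmax (insert y I) ⟨insert_subset (hJY.subset hy) hIY, by
      intro u hu v hv huv
      rcases mem_insert.1 hu with rfl | hu' <;> rcases mem_insert.1 hv with rfl | hv'
      · exact absurd rfl huv
      · exact (hcon v hv').2
      · exact (hcon u hu').1
      · exact hind u hu' v hv' huv⟩
    rw [card_insert_of_notMem hyI] at this
    omega
  have hcross : #J ≤ (∑ v ∈ I, ∑ u ∈ J, if v ≠ u ∧ R v u then 1 else 0) +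
      ∑ v ∈ J, ∑ u ∈ I, if v ≠ u ∧ R v u then 1 else 0 := by
    rw [sum_comm, ← sum_add_distrib, card_eq_sum_ones]
    refine sum_le_sum fun y hy => ?_
    rw [← sum_add_distrib]
    obtain ⟨i, hi, h⟩ := hadj y hy
    have hne : i ≠ y := fun h => disjoint_left.1 hdisj hi (h ▸ hy)
    refine le_trans ?_ (single_le_sum (f := fun i => (if i ≠ y ∧ R i y then 1 else 0) +
      if y ≠ i ∧ R y i then 1 else 0) (fun _ _ => Nat.zero_le _) hi)
    rcases h with h | h <;> simp [hne, hne.symm, h]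
  have hsum : (∑ v ∈ Y, ∑ u ∈ Y, if v ≠ u ∧ R v u then 1 else 0) ≥
      #J + ∑ v ∈ J, ∑ u ∈ J, if v ≠ u ∧ R v u then 1 else 0 := by
    rw [hunion]
    simp only [sum_union hdisj, sum_add_distrib]
    omega
  have hJ2 := ih J hJY
  set A := ∑ v ∈ Y, ∑ u ∈ Y, if v ≠ u ∧ R v u then 1 else 0
  set A' := ∑ v ∈ J, ∑ u ∈ J, if v ≠ u ∧ R v u then 1 else 0
  rw [hcardY]
  obtain ⟨k, hk⟩ := Nat.exists_eq_add_of_le hIα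
  have h2 : 2 * α * (#J + A') ≤ 2 * α * A := Nat.mul_le_mul_left _ hsum
  subst hk
  nlinarith [Nat.zero_le (k * #J), Nat.zero_le (k * #I)]

theorem exists_large_outdegree
    (hα : ∀ X : Finset V, (∀ x ∈ X, ∀ y ∈ X, x ≠ y → ¬ R x y) → #X ≤ α) {Y : Finset V}
    (hY : Y.Nonempty) : ∃ v ∈ Y, #Y ≤ 2 * α * #(Y.filter fun u => v = u ∨ R v u) := by
  by_contra! hcon
  have hT := card_sq_le_of_independent_card_le hα Y
  have hsum : ∀ v ∈ Y, #(Y.filter fun u => v = u ∨ R v u) =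
      1 + ∑ u ∈ Y, if v ≠ u ∧ R v u then 1 else 0 := by
    intro v hv
    rw [card_filter, ← sum_erase_add _ _ hv, ← sum_erase_add Y _ hv]
    simp only [true_or, if_true, ne_eq, not_true, false_and, if_false, add_zero]
    rw [add_comm]
    congr 1
    refine sum_congr rfl fun u hu => ?_
    have : v ≠ u := (ne_of_mem_erase hu).symm
    simp [this]
  have h1 : ∑ v ∈ Y, 2 * α * #(Y.filter fun u => v = u ∨ R v u) < ∑ v ∈ Y, #Y :=
    sum_lt_sum_of_nonempty hY hcon
  rw [← mul_sum, sum_congr rfl hsum, sum_add_distrib, sum_const, sum_const] at h1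
  simp only [smul_eq_mul, mul_one] at h1
  nlinarith [Nat.zero_le (α * #Y)]

theorem exists_partial_dominating
    (hα : ∀ X : Finset V, (∀ x ∈ X, ∀ y ∈ X, x ≠ y → ¬ R x y) → #X ≤ α) (hα1 : 1 ≤ α)
    (Y : Finset V) (j : ℕ) : ∃ A ⊆ Y, #A ≤ j ∧
      (#(Y.filter fun y => y ∉ A ∧ ∀ a ∈ A, ¬ R a y) : ℝ) ≤ (1 - 1 / (2 * α)) ^ j * #Y := by
  induction j with
  | zero => exact ⟨∅, by simp, by simp, by simp⟩
  | succ j ih =>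
    obtain ⟨A, hAY, hA, hrest⟩ := ih
    set Z := Y.filter fun y => y ∉ A ∧ ∀ a ∈ A, ¬ R a y with hZ
    have hα0 : (1 : ℝ) ≤ α := by exact_mod_cast hα1
    have hq : 0 ≤ (1 : ℝ) - 1 / (2 * α) := by
      rw [sub_nonneg, div_le_one (by positivity)]
      linarith
    rcases Z.eq_empty_or_nonempty with h0 | hne
    · refine ⟨A, hAY, by omega, ?_⟩
      rw [← hZ, h0]
      simp only [card_empty, Nat.cast_zero]
      positivity
    obtain ⟨v, hv, hv2⟩ := exists_large_outdegree hα hne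
    refine ⟨insert v A, insert_subset (mem_filter.1 hv).1 hAY,
      (card_insert_le _ _).trans (by omega), ?_⟩
    have hsub : (Y.filter fun y => y ∉ insert v A ∧ ∀ a ∈ insert v A, ¬ R a y) ⊆
        Z.filter fun u => ¬ (v = u ∨ R v u) := by
      intro y
      simp only [hZ, mem_filter, mem_insert, forall_eq_or_imp, not_or]
      grind
    have h1 := card_le_card hsub
    have h2 := card_filter_add_card_filter_not (s := Z) (fun u => v = u ∨ R v u)
    have h3 : (#(Z.filter fun u => ¬ (v = u ∨ R v u)) : ℝ) ≤ (1 - 1 / (2 * α)) * #Z := by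
      have e1 : (#Z : ℝ) ≤ 2 * α * #(Z.filter fun u => v = u ∨ R v u) := by exact_mod_cast hv2
      have e2 : (#(Z.filter fun u => v = u ∨ R v u) : ℝ) +
        #(Z.filter fun u => ¬ (v = u ∨ R v u)) = #Z := by exact_mod_cast h2
      have e3 : (#Z : ℝ) / (2 * α) ≤ #(Z.filter fun u => v = u ∨ R v u) := by
        rw [div_le_iff₀ (by positivity)]
        linarith
      have e4 : (1 - 1 / (2 * (α : ℝ))) * #Z = #Z - #Z / (2 * α) := by ring
      linarith
    calc (#(Y.filter fun y => y ∉ insert v A ∧ ∀ a ∈ insert v A, ¬ R a y) : ℝ)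
        ≤ #(Z.filter fun u => ¬ (v = u ∨ R v u)) := by exact_mod_cast h1
      _ ≤ (1 - 1 / (2 * α)) * #Z := h3
      _ ≤ (1 - 1 / (2 * α)) * ((1 - 1 / (2 * α)) ^ j * #Y) := by gcongr
      _ = _ := by ring

theorem exists_dominating
    (hα : ∀ X : Finset V, (∀ x ∈ X, ∀ y ∈ X, x ≠ y → ¬ R x y) → #X ≤ α) (hα1 : 1 ≤ α)
    (Y : Finset V) {j : ℕ} (hj : 2 * α * Real.log #Y < j) :
    ∃ A ⊆ Y, #A ≤ j ∧ ∀ y ∈ Y, y ∉ A → ∃ a ∈ A, R a y := by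
  obtain ⟨A, hAY, hA, h⟩ := exists_partial_dominating hα hα1 Y j
  refine ⟨A, hAY, hA, fun y hy hyA => ?_⟩
  by_contra! hcon
  have hpos : 0 < #(Y.filter fun y => y ∉ A ∧ ∀ a ∈ A, ¬ R a y) :=
    card_pos.2 ⟨y, mem_filter.2 ⟨hy, hyA, hcon⟩⟩
  have hpos' : (1 : ℝ) ≤ #(Y.filter fun y => y ∉ A ∧ ∀ a ∈ A, ¬ R a y) := by exact_mod_cast hpos
  have hα0 : (1 : ℝ) ≤ α := by exact_mod_cast hα1
  have hYpos : (0 : ℝ) < #Y := by exact_mod_cast card_pos.2 ⟨y, hy⟩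
  have hq : 0 ≤ (1 : ℝ) - 1 / (2 * α) := by
    rw [sub_nonneg, div_le_one (by positivity)]
    linarith
  have h1 : ((1 : ℝ) - 1 / (2 * α)) ^ j ≤ Real.exp (-(1 / (2 * α)) * j) := by
    rw [mul_comm _ (j : ℝ), Real.exp_nat_mul]
    exact pow_le_pow_left₀ hq (by linarith [Real.add_one_le_exp (-(1 / (2 * (α : ℝ))))]) j
  have h2 : Real.exp (-(1 / (2 * α)) * j) < Real.exp (- Real.log #Y) := by
    apply Real.exp_lt_exp.2
    have : Real.log #Y < j / (2 * α) := by
      rw [lt_div_iff₀ (by positivity)]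
      linarith
    calc -(1 / (2 * (α : ℝ))) * j = -(j / (2 * α)) := by ring
      _ < _ := by linarith
  rw [Real.exp_neg, Real.exp_log hYpos] at h2
  have h3 : ((1 : ℝ) - 1 / (2 * α)) ^ j * #Y < (#Y : ℝ)⁻¹ * #Y :=
    mul_lt_mul_of_pos_right (h1.trans_lt h2) hYpos
  rw [inv_mul_cancel₀ hYpos.ne'] at h3
  linarith

end Domination

section Exploration

open Finset Classical

variable {V : Type} {G : ℕ → SimpleGraph V}

theorem exists_chain_of_dominating {a ℓ q j : ℕ}
    (hdom : ∀ i < q, ∀ Y : Finset V, ∃ A ⊆ Y, #A ≤ j ∧ ∀ y ∈ Y, y ∉ A →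
      ∃ x ∈ A, TemporalWalk G (a + i * ℓ) (a + i * ℓ + ℓ) x y ∅) (Y : Finset V) :
    ∃ Y' ⊆ Y, #Y ≤ #Y' + q * j ∧ ∀ y ∈ Y', ∃ x, ∃ S : Finset V, S ⊆ Y ∧ #S = q + 1 ∧
      (∀ u ∈ S, u ∈ Y' → u = y) ∧ TemporalWalk G a (a + q * ℓ) x y S := by
  induction q with
  | zero =>
    refine ⟨Y, Subset.rfl, by simp, fun y hy => ⟨y, {y}, by simpa using hy, by simp, by simp, ?_⟩⟩
    simpa using TemporalWalk.wait (G := G) (a := a) le_rfl y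
  | succ q ih =>
    obtain ⟨Y', hY', hcard, hch⟩ := ih fun i hi => hdom i (by omega)
    obtain ⟨A, hA, hAj, hAdom⟩ := hdom q (by omega) Y'
    refine ⟨Y' \ A, sdiff_subset.trans hY', ?_, ?_⟩
    · have := card_sdiff_add_card_eq_card hA
      rw [add_mul]
      omega
    · intro y hy
      obtain ⟨hyY, hyA⟩ := mem_sdiff.1 hy
      obtain ⟨z, hz, hzy⟩ := hAdom y hyY hyA
      obtain ⟨x, S, hSY, hS, huniq, hwalk⟩ := hch z (hA hz)
      have hyS : y ∉ S := fun h => hyA (huniq y h hyY ▸ hz)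
      refine ⟨x, insert y S, insert_subset (hY' hyY) hSY, by rw [card_insert_of_notMem hyS, hS],
        ?_, ?_⟩
      · intro u hu hu'
        rcases mem_insert.1 hu with h | h
        · exact h
        · obtain ⟨h1, h2⟩ := mem_sdiff.1 hu'
          exact absurd (huniq u h h1 ▸ hz) h2
      · have := (hwalk.trans hzy (by omega) (by omega)).mem_end (by omega)
        rw [show a + (q + 1) * ℓ = a + q * ℓ + ℓ by ring]
        refine this.mono ?_
        intro u hu
        simpa [or_comm] using hu

variable [Fintype V]

/-- From any vertex, in linear time, one can visit many vertices of any given set `U`. -/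
theorem exists_visit_many (hn : 2 ≤ Fintype.card V) (hG : ∀ s, 1 ≤ s → (G s).Connected)
    {H : SimpleGraph V} (hH : ∀ s, 1 ≤ s → G s ≤ H) {d : ℝ} (hd : 1 ≤ d)
    (hdM : (#(univ.filter fun e : V × V => H.Adj e.1 e.2) : ℝ) ≤ d * Fintype.card V)
    {a : ℕ} (ha : 1 ≤ a) (x : V) {U : Finset V} (hU : U.Nonempty) :
    ∃ b, a ≤ b ∧ b ≤ a + 3 * Fintype.card V ∧ ∃ y, ∃ S ⊆ U, S.Nonempty ∧
      Real.sqrt #U ≤ 4 * Real.sqrt (d * Real.logb 2 (Fintype.card V)) * #S ∧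
      TemporalWalk G a b x y S := by
  obtain ⟨n, hn'⟩ : ∃ n, n = Fintype.card V := ⟨_, rfl⟩
  rw [← hn'] at hn hdM ⊢
  have hnR : (2 : ℝ) ≤ n := by exact_mod_cast hn
  obtain ⟨Λ, hΛ⟩ : ∃ Λ, Λ = Real.logb 2 n := ⟨_, rfl⟩
  have hΛ1 : 1 ≤ Λ := by
    rw [hΛ, Real.le_logb_iff_rpow_le (by norm_num) (by linarith)]
    simpa using hnR
  have hlogn : Real.log n ≤ Λ := by
    have h2 : Real.log n = Λ * Real.log 2 := by
      rw [hΛ, Real.logb, div_mul_cancel₀ _ (Real.log_pos (by norm_num)).ne']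
    have := Real.log_two_lt_d9
    nlinarith
  rw [← hΛ]
  obtain ⟨k, hk⟩ : ∃ k, k = #U := ⟨_, rfl⟩
  have hk1 : (1 : ℝ) ≤ k := by
    rw [hk]
    exact_mod_cast card_pos.2 hU
  have hkn : k ≤ n := by
    rw [hk, hn']
    exact card_le_univ U
  rw [← hk]
  have hdΛ : 1 ≤ d * Λ := by nlinarith
  obtain ⟨q, hq⟩ : ∃ q, q = ⌊Real.sqrt (k / (16 * (d * Λ)))⌋₊ := ⟨_, rfl⟩
  have hsqrt : Real.sqrt (k / (16 * (d * Λ))) = Real.sqrt k / (4 * Real.sqrt (d * Λ)) := by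
    rw [Real.sqrt_div (by positivity), Real.sqrt_mul (by positivity),
      show (16 : ℝ) = 4 ^ 2 by norm_num, Real.sqrt_sq (by norm_num)]
  have hqlt : Real.sqrt k ≤ 4 * Real.sqrt (d * Λ) * (q + 1 : ℕ) := by
    have h1 := Nat.lt_floor_add_one (Real.sqrt (k / (16 * (d * Λ))))
    rw [← hq, hsqrt, div_lt_iff₀ (by positivity)] at h1
    push_cast
    linarith
  have hqle : 16 * (d * Λ) * (q : ℝ) ^ 2 ≤ k := by
    have h1 : (q : ℝ) ≤ Real.sqrt (k / (16 * (d * Λ))) := by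
      rw [hq]
      exact Nat.floor_le (Real.sqrt_nonneg _)
    have h2 := pow_le_pow_left₀ (Nat.cast_nonneg q) h1 2
    rw [Real.sq_sqrt (by positivity), le_div_iff₀ (by positivity)] at h2
    linarith
  rcases Nat.eq_zero_or_pos q with hq0 | hqpos
  · obtain ⟨y, hy⟩ := hU
    refine ⟨a + n, by omega, by omega, y, {y}, by simpa using hy, by simp, ?_, ?_⟩
    · simpa [hq0] using hqlt
    · have := (TemporalWalk.exists_of_card_le hG ha x y).mem_end (by omega)
      rw [hn']
      exact this.mono (by simp)
  have hqR : (1 : ℝ) ≤ q := by exact_mod_cast hqpos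
  obtain ⟨ℓ, hℓ⟩ : ∃ ℓ, ℓ = n / q + 1 := ⟨_, rfl⟩
  obtain ⟨α, hα⟩ : ∃ α, α = ⌊4 * d * q⌋₊ := ⟨_, rfl⟩
  obtain ⟨j, hj⟩ : ∃ j, j = ⌊2 * α * Real.log n⌋₊ + 1 := ⟨_, rfl⟩
  have hdq : 1 ≤ d * q := by nlinarith
  have hα1 : 1 ≤ α := by
    rw [hα]
    exact Nat.le_floor (by push_cast; nlinarith)
  have hαle : (α : ℝ) ≤ 4 * d * q := by
    rw [hα]
    exact Nat.floor_le (by positivity)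
  have hαlt : 4 * d * q < α + 1 := by
    rw [hα]
    exact Nat.lt_floor_add_one _
  have hℓq : n ≤ ℓ * q := by
    rw [hℓ, add_mul, one_mul]
    exact (Nat.lt_div_mul_add hqpos).le
  have hℓq' : q * ℓ ≤ n + q := by
    rw [hℓ, mul_add, mul_one]
    exact Nat.add_le_add_right (Nat.mul_div_le n q) q
  have hqn : q ≤ n := by
    have h1 : (q : ℝ) ≤ k := by nlinarith
    have h2 : q ≤ k := by exact_mod_cast h1
    omega
  have hMlt : 4 * #(univ.filter fun e : V × V => H.Adj e.1 e.2) < ℓ * (α + 1) := by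
    have h1 : (n : ℝ) ≤ ℓ * q := by exact_mod_cast hℓq
    have hℓ0 : (1 : ℝ) ≤ ℓ := by
      rw [hℓ]
      push_cast
      linarith [Nat.cast_nonneg (α := ℝ) (n / q)]
    have h2 : (4 * #(univ.filter fun e : V × V => H.Adj e.1 e.2) : ℝ) < ℓ * (α + 1) := by
      calc (4 * #(univ.filter fun e : V × V => H.Adj e.1 e.2) : ℝ) ≤ 4 * (d * n) := by linarith
        _ ≤ 4 * (d * (ℓ * q)) := by gcongr
        _ = ℓ * (4 * d * q) := by ring
        _ < ℓ * (α + 1) := by gcongr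
    exact_mod_cast h2
  have hjle : (j : ℝ) ≤ 9 * d * q * Λ := by
    have h1 : (j : ℝ) ≤ 2 * α * Real.log n + 1 := by
      rw [hj]
      push_cast
      gcongr
      exact Nat.floor_le (mul_nonneg (by positivity) (Real.log_nonneg (by linarith)))
    have h2 : 2 * α * Real.log n ≤ 2 * (4 * d * q) * Λ := by
      gcongr
    have h3 : 1 ≤ d * q * Λ := by nlinarith
    linarith
  have hqj : q * j < k := by
    have h1 : (q : ℝ) * j < k := by
      have h2 : (q : ℝ) * j ≤ q * (9 * d * q * Λ) := by gcongr
      have h3 : 0 < d * Λ * (q : ℝ) ^ 2 := by positivity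
      nlinarith
    exact_mod_cast h1
  obtain ⟨Y', hY', hcard, hch⟩ := exists_chain_of_dominating (G := G) (a := a + n) (ℓ := ℓ)
    (q := q) (j := j) (fun i _ Y => by
      refine exists_dominating (α := α) (fun X hX => ?_) hα1 Y ?_
      · rcases Nat.lt_or_ge #X 2 with h | h
        · omega
        · have h1 := mul_card_le_of_forall_not_reach hG hH (a := a + n + i * ℓ) (by omega) h hX
          have h2 := Nat.lt_of_mul_lt_mul_left (h1.trans_lt hMlt)
          omega
      · have h1 : Real.log #Y ≤ Real.log n := by
          rcases Y.eq_empty_or_nonempty with rfl | hY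
          · simpa using Real.log_nonneg (by linarith : (1 : ℝ) ≤ n)
          · have : (0 : ℝ) < #Y := by exact_mod_cast card_pos.2 hY
            have h2 : (#Y : ℝ) ≤ n := by
              rw [hn']
              exact_mod_cast card_le_univ Y
            exact Real.log_le_log this h2
        calc 2 * α * Real.log #Y ≤ 2 * α * Real.log n := by gcongr
          _ < j := by
            rw [hj]
            push_cast
            exact Nat.lt_floor_add_one _) U
  obtain ⟨y, hy⟩ : Y'.Nonempty := card_pos.1 (by omega)
  obtain ⟨z, S, hSU, hS, -, hwalk⟩ := hch y hy
  have hfirst := TemporalWalk.exists_of_card_le hG ha x z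
  rw [← hn'] at hfirst
  refine ⟨a + n + q * ℓ, by omega, by omega, y, S, hSU, card_pos.1 (by omega), ?_, ?_⟩
  · rw [hS]
    exact hqlt
  · exact (hfirst.trans hwalk (by omega) (by omega)).mono (by simp)

theorem exists_exploration (hn : 2 ≤ Fintype.card V) (hG : ∀ s, 1 ≤ s → (G s).Connected)
    {H : SimpleGraph V} (hH : ∀ s, 1 ≤ s → G s ≤ H) {d : ℝ} (hd : 1 ≤ d)
    (hdM : (#(univ.filter fun e : V × V => H.Adj e.1 e.2) : ℝ) ≤ d * Fintype.card V)
    (U : Finset V) {a : ℕ} (ha : 1 ≤ a) (x : V) :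
    ∃ b, a ≤ b ∧ ∃ y, TemporalWalk G a b x y U ∧ ((b - a : ℕ) : ℝ) ≤
      24 * Fintype.card V * Real.sqrt (d * Real.logb 2 (Fintype.card V)) * Real.sqrt #U := by
  induction U using Finset.strongInduction generalizing a x with
  | H U ih =>
  rcases U.eq_empty_or_nonempty with rfl | hU
  · exact ⟨a, le_rfl, x, (TemporalWalk.wait le_rfl x).mono (by simp), by simp⟩
  obtain ⟨b, hab, hb, y, S, hSU, hS, hsqrt, hwalk⟩ := exists_visit_many hn hG hH hd hdM ha x hU
  obtain ⟨c, hbc, z, hwalk', hc⟩ := ih (U \ S) (sdiff_ssubset hSU hS) (ha.trans hab) y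
  refine ⟨c, hab.trans hbc, z, (hwalk.trans hwalk' hab hbc).mono ?_, ?_⟩
  · intro u hu
    by_cases h : u ∈ S
    · exact Or.inl h
    · exact Or.inr (by simpa using ⟨hu, h⟩)
  · set n := Fintype.card V
    set γ := Real.sqrt (d * Real.logb 2 n)
    have hγ : 0 ≤ γ := Real.sqrt_nonneg _
    have hcard : (#(U \ S) : ℝ) + #S = #U := by exact_mod_cast card_sdiff_add_card_eq_card hSU
    have h1 : ((c - a : ℕ) : ℝ) = ((c - b : ℕ) : ℝ) + ((b - a : ℕ) : ℝ) := by
      rw [← Nat.cast_add]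
      congr 1
      omega
    have h2 : ((b - a : ℕ) : ℝ) ≤ 3 * n := by
      have : b - a ≤ 3 * n := by omega
      exact_mod_cast this
    have hUpos : (0 : ℝ) < #U := by exact_mod_cast card_pos.2 hU
    have hu := Real.sqrt_pos.2 hUpos
    have hv := Real.sqrt_nonneg (#(U \ S) : ℝ)
    have hu2 := Real.sq_sqrt hUpos.le
    have hv2 := Real.sq_sqrt (Nat.cast_nonneg (α := ℝ) #(U \ S))
    have hle : Real.sqrt #(U \ S) ≤ Real.sqrt #U := by
      apply Real.sqrt_le_sqrt
      have : (0 : ℝ) ≤ #S := Nat.cast_nonneg _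
      linarith
    set u := Real.sqrt (#U : ℝ)
    set v := Real.sqrt (#(U \ S) : ℝ)
    have key : 1 ≤ 8 * γ * (u - v) := by
      have e1 : (#S : ℝ) = (u - v) * (u + v) := by nlinarith
      have e2 : u ≤ 4 * γ * ((u - v) * (2 * u)) := by
        rw [e1] at hsqrt
        refine hsqrt.trans ?_
        gcongr
        linarith
      have e3 : u * 1 ≤ u * (8 * γ * (u - v)) := by nlinarith
      exact le_of_mul_le_mul_left e3 hu
    have hn0 : (0 : ℝ) ≤ n := Nat.cast_nonneg _
    nlinarith

end Exploration

namespace HasCompleteMinor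

variable {V W : Type} {H : SimpleGraph V} {K : SimpleGraph W} {t : ℕ}

theorem of_injective_hom (f : H →g K) (hf : Function.Injective f) (h : HasCompleteMinor H t) :
    HasCompleteMinor K t := by
  obtain ⟨B, hB, hdisj, hadj⟩ := h
  refine ⟨fun i => f '' B i, fun i => ?_, fun i j hij => ?_, fun i j hij => ?_⟩
  · let g : H.induce (B i) →g K.induce (f '' B i) :=
      ⟨fun x => ⟨f x, Set.mem_image_of_mem f x.2⟩, fun {x y} hxy => f.map_rel hxy⟩
    refine (hB i).map g ?_
    rintro ⟨_, x, hx, rfl⟩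
    exact ⟨⟨x, hx⟩, rfl⟩
  · exact (Set.disjoint_image_iff hf).2 (hdisj hij)
  · obtain ⟨u, hu, v, hv, huv⟩ := hadj i j hij
    exact ⟨f u, ⟨u, hu, rfl⟩, f v, ⟨v, hv, rfl⟩, f.map_rel huv⟩

theorem of_induce {s : Set V} (h : HasCompleteMinor (H.induce s) t) : HasCompleteMinor H t :=
  h.of_injective_hom (SimpleGraph.Embedding.induce s).toHom Subtype.val_injective

theorem mono {H' : SimpleGraph V} (hle : H' ≤ H) (h : HasCompleteMinor H' t) :
    HasCompleteMinor H t :=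
  h.of_injective_hom (SimpleGraph.Hom.ofLE hle) Function.injective_id

/-- A complete minor pulls back along a contraction whose fibres are cliques. -/
theorem of_contraction (φ : V → W) (hφ : Function.Surjective φ)
    (hfib : ∀ x y, φ x = φ y → x = y ∨ H.Adj x y)
    (hK : ∀ v w, K.Adj v w → ∃ x y, φ x = v ∧ φ y = w ∧ H.Adj x y)
    (h : HasCompleteMinor K t) : HasCompleteMinor H t := by
  obtain ⟨B, hB, hdisj, hadj⟩ := h
  refine ⟨fun i => φ ⁻¹' B i, fun i => ?_, fun i j hij => ?_, fun i j hij => ?_⟩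
  · have hfibre : ∀ x y : φ ⁻¹' B i, φ x = φ y → (H.induce (φ ⁻¹' B i)).Reachable x y := by
      intro x y hxy
      rcases hfib x y hxy with h | h
      · rw [Subtype.ext h]
      · exact SimpleGraph.Adj.reachable h
    have hwalk : ∀ {v w : B i} (_ : (K.induce (B i)).Walk v w) (x y : φ ⁻¹' B i),
        φ x = v → φ y = w → (H.induce (φ ⁻¹' B i)).Reachable x y := by
      intro v w p
      induction p with
      | nil => exact fun x y hx hy => hfibre x y (hx.trans hy.symm)
      | cons hvw _ ih =>
        intro x y hx hy
        obtain ⟨x', y', hx', hy', hxy⟩ := hK _ _ hvw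
        have mx : x' ∈ φ ⁻¹' B i := by simp [hx']
        have my : y' ∈ φ ⁻¹' B i := by simp [hy']
        have h1 : (H.induce (φ ⁻¹' B i)).Adj ⟨x', mx⟩ ⟨y', my⟩ := hxy
        exact (hfibre x ⟨x', mx⟩ (hx.trans hx'.symm)).trans
          (h1.reachable.trans (ih ⟨y', my⟩ y hy' hy))
    obtain ⟨v⟩ := (hB i).nonempty
    obtain ⟨x, hx⟩ := hφ v
    have : Nonempty (φ ⁻¹' B i) := ⟨⟨x, by simp [hx]⟩⟩
    refine ⟨fun x y => ?_⟩
    obtain ⟨p⟩ := (hB i).preconnected ⟨φ x, x.2⟩ ⟨φ y, y.2⟩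
    exact hwalk p x y rfl rfl
  · exact (hdisj hij).preimage φ
  · obtain ⟨u, hu, v, hv, huv⟩ := hadj i j hij
    obtain ⟨x, y, rfl, rfl, hxy⟩ := hK u v huv
    exact ⟨x, hu, y, hv, hxy⟩

end HasCompleteMinor

section EdgeCount

open Finset Classical

variable {V : Type}

/-- The ordered pairs of adjacent vertices. -/
noncomputable def SimpleGraph.adjPairs [Fintype V] (H : SimpleGraph V) : Finset (V × V) :=
  univ.filter fun e : V × V => H.Adj e.1 e.2

/-- The vertex map merging `b` into `a`. -/
noncomputable def mergeVertex {a b : V} (hab : a ≠ b) (x : V) : {x : V // x ≠ b} :=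
  if h : x = b then ⟨a, hab⟩ else ⟨x, h⟩

theorem mergeVertex_eq_iff {a b : V} (hab : a ≠ b) {x y : V} :
    mergeVertex hab x = mergeVertex hab y ↔ x = y ∨ (x = a ∧ y = b) ∨ (x = b ∧ y = a) := by
  unfold mergeVertex
  split_ifs <;> simp only [Subtype.mk.injEq] <;> grind

/-- The graph obtained by merging `b` into `a`. -/
def SimpleGraph.mergeVertex (H : SimpleGraph V) {a b : V} (hab : a ≠ b) :
    SimpleGraph {x : V // x ≠ b} where
  Adj v w := v ≠ w ∧ ∃ x y, _root_.mergeVertex hab x = v ∧ _root_.mergeVertex hab y = w ∧ H.Adj x y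
  symm := ⟨fun _ _ ⟨hne, x, y, hx, hy, h⟩ => ⟨hne.symm, y, x, hy, hx, h.symm⟩⟩
  loopless := ⟨fun _ h => h.1 rfl⟩

theorem HasCompleteMinor.of_mergeVertex {H : SimpleGraph V} {a b : V} {t : ℕ} (hab : H.Adj a b)
    (h : HasCompleteMinor (H.mergeVertex hab.ne) t) : HasCompleteMinor H t := by
  refine HasCompleteMinor.of_contraction (K := H.mergeVertex hab.ne) (_root_.mergeVertex hab.ne)
    (fun v => ⟨v, ?_⟩) (fun x y hxy => ?_) (fun v w hvw => hvw.2) h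
  · simp [_root_.mergeVertex, v.2]
  · rcases (mergeVertex_eq_iff _).1 hxy with h | ⟨rfl, rfl⟩ | ⟨rfl, rfl⟩
    · exact Or.inl h
    · exact Or.inr hab
    · exact Or.inr hab.symm

variable [Fintype V]

theorem SimpleGraph.card_adjPairs_le_mergeVertex {H : SimpleGraph V} {a b : V} (hab : H.Adj a b) :
    #H.adjPairs ≤ #(H.mergeVertex hab.ne).adjPairs +
      2 * (#(univ.filter fun u => H.Adj a u ∧ H.Adj b u) + 1) := by
  set T := insert a (univ.filter fun u => H.Adj a u ∧ H.Adj b u) with hT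
  have hTcard : #T ≤ #(univ.filter fun u => H.Adj a u ∧ H.Adj b u) + 1 := card_insert_le _ _
  set X := ({b} ×ˢ T) ∪ (T ×ˢ {b}) with hX
  have hXcard : #X ≤ 2 * #T := by
    refine (card_union_le _ _).trans ?_
    simp [two_mul]
  have hne := hab.ne
  have hmem : ∀ x y, (x, y) ∈ X ↔
      (x = b ∧ (y = a ∨ H.Adj a y ∧ H.Adj b y)) ∨ (y = b ∧ (x = a ∨ H.Adj a x ∧ H.Adj b x)) := by
    intro x y
    simp only [hX, hT, mem_union, mem_product, mem_singleton, mem_insert, mem_filter, mem_univ,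
      true_and]
    tauto
  have hinj : #(H.adjPairs \ X) ≤ #(H.mergeVertex hab.ne).adjPairs := by
    refine card_le_card_of_injOn (Prod.map (_root_.mergeVertex hne) (_root_.mergeVertex hne)) ?_ ?_
    · rintro ⟨x, y⟩ hxy
      simp only [coe_sdiff, Set.mem_sdiff, mem_coe, adjPairs, mem_filter, mem_univ, true_and,
        hmem] at hxy
      simp only [adjPairs, coe_filter, mem_univ, true_and, Set.mem_ofPred_eq, Prod.map_apply]
      refine ⟨fun h => ?_, x, y, rfl, rfl, hxy.1⟩
      rcases (mergeVertex_eq_iff _).1 h with h | h | h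
      · exact hxy.1.ne h
      · exact hxy.2 (Or.inr ⟨h.2, Or.inl h.1⟩)
      · exact hxy.2 (Or.inl ⟨h.1, Or.inl h.2⟩)
    · rintro ⟨x, y⟩ hxy ⟨x', y'⟩ hxy' heq
      simp only [coe_sdiff, Set.mem_sdiff, mem_coe, adjPairs, mem_filter, mem_univ, true_and,
        hmem] at hxy hxy'
      simp only [Prod.map_apply, Prod.mk.injEq, mergeVertex_eq_iff] at heq
      have hs : ∀ u v, H.Adj u v → H.Adj v u := fun _ _ h => h.symm
      rw [Prod.mk.injEq]
      grind
  have := le_card_sdiff X H.adjPairs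
  omega

theorem SimpleGraph.card_adjPairs_eq_sum (H : SimpleGraph V) :
    #H.adjPairs = ∑ v, #(univ.filter (H.Adj v)) := by
  rw [adjPairs, card_filter, Fintype.sum_prod_type]
  simp only [card_filter]

theorem SimpleGraph.card_adjPairs_le_induce {H : SimpleGraph V} {v : V} (hv : ∀ u, ¬ H.Adj v u) :
    #H.adjPairs ≤ #(H.induce {x | x ≠ v}).adjPairs := by
  refine card_le_card_of_surjOn (Prod.map Subtype.val Subtype.val) ?_
  rintro ⟨x, y⟩ hxy
  have h : H.Adj x y := by simpa [adjPairs] using hxy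
  have hx : x ≠ v := by
    rintro rfl
    exact hv _ h
  have hy : y ≠ v := by
    rintro rfl
    exact hv _ h.symm
  exact ⟨(⟨x, hx⟩, ⟨y, hy⟩), by simpa [adjPairs] using h, rfl⟩

theorem SimpleGraph.card_adjPairs_le_deleteEdges {H : SimpleGraph V} (a b : V) :
    #H.adjPairs ≤ #(H.deleteEdges {s(a, b)}).adjPairs + 2 := by
  have hsub : H.adjPairs \ {(a, b), (b, a)} ⊆ (H.deleteEdges {s(a, b)}).adjPairs := by
    rintro ⟨x, y⟩ h
    simp only [adjPairs, mem_sdiff, mem_filter, mem_univ, true_and, mem_insert, mem_singleton,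
      Prod.mk.injEq, deleteEdges_adj, Set.mem_singleton_iff, Sym2.eq_iff] at h ⊢
    exact h
  have h1 := card_le_card hsub
  have h2 := le_card_sdiff {(a, b), (b, a)} H.adjPairs
  have h3 : #({(a, b), (b, a)} : Finset (V × V)) ≤ 2 := card_le_two
  omega

theorem SimpleGraph.card_adjPairs_deleteEdges_lt {H : SimpleGraph V} {a b : V} (hab : H.Adj a b) :
    #(H.deleteEdges {s(a, b)}).adjPairs < #H.adjPairs := by
  refine card_lt_card ⟨fun e he => ?_, fun hsub => ?_⟩
  · simp only [adjPairs, mem_filter, mem_univ, true_and, deleteEdges_adj] at he ⊢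
    exact he.1
  · have := hsub (show (a, b) ∈ H.adjPairs by simpa [adjPairs] using hab)
    simp [adjPairs] at this

/-- If every dense graph of order at least `d` and minimum degree at least half its order has a
`K_t` minor, then every graph with average degree at least `2 * d` has one. -/
theorem card_adjPairs_lt_of_dense {t d : ℕ} (hd : 1 ≤ d)
    (hdense : ∀ (W : Type) [Fintype W] (K : SimpleGraph W), d ≤ Fintype.card W →
      (∀ v, Fintype.card W ≤ 2 * #(univ.filter (K.Adj v))) → HasCompleteMinor K t)
    (n : ℕ) : ∀ (m : ℕ) (V : Type) [Fintype V] [Nonempty V] (H : SimpleGraph V),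
      Fintype.card V = n → #H.adjPairs = m → ¬ HasCompleteMinor H t → m < 2 * d * n := by
  induction n using Nat.strong_induction_on with
  | _ n ihn =>
  intro m
  induction m using Nat.strong_induction_on with
  | _ m ihm =>
  intro V _ _ H hn hm hH
  by_contra! hcon
  have hn0 : 0 < n := hn ▸ Fintype.card_pos
  have hmpos : 0 < m := lt_of_lt_of_le (by positivity) hcon
  have hadj : ∃ a b, H.Adj a b := by
    rw [← hm] at hmpos
    obtain ⟨⟨a, b⟩, h⟩ := card_pos.1 hmpos
    exact ⟨a, b, by simpa [SimpleGraph.adjPairs] using h⟩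
  have hcard' : ∀ v : V, Fintype.card {x : V // x ≠ v} = n - 1 := by
    intro v
    rw [Fintype.card_subtype_compl, Fintype.card_subtype_eq, hn]
  have hn2 : 2 ≤ n := by
    obtain ⟨a, b, hab⟩ := hadj
    rw [← hn]
    exact Fintype.one_lt_card_iff.2 ⟨a, b, hab.ne⟩
  have hstep : 2 * d * n = 2 * d * (n - 1) + 2 * d := by
    obtain ⟨k, rfl⟩ := Nat.exists_eq_add_of_le hn2
    rw [show 2 + k - 1 = k + 1 by omega]
    ring
  have hmup : m < 2 * d * n + 2 := by
    by_contra! hm2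
    obtain ⟨a, b, hab⟩ := hadj
    have h1 := SimpleGraph.card_adjPairs_deleteEdges_lt hab
    have h2 := SimpleGraph.card_adjPairs_le_deleteEdges (H := H) a b
    have h3 := ihm _ (hm ▸ h1) V (H.deleteEdges {s(a, b)}) hn rfl
      fun h => hH (h.mono (SimpleGraph.deleteEdges_le _))
    omega
  have hcommon : ∀ a b, H.Adj a b → d ≤ #(univ.filter fun u => H.Adj a u ∧ H.Adj b u) := by
    intro a b hab
    have : Nonempty {x : V // x ≠ b} := ⟨⟨a, hab.ne⟩⟩
    have h1 := SimpleGraph.card_adjPairs_le_mergeVertex hab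
    have h2 := ihn (n - 1) (by omega) _ {x : V // x ≠ b} (H.mergeVertex hab.ne) (hcard' b) rfl
      fun h => hH (h.of_mergeVertex hab)
    omega
  obtain ⟨v, hv⟩ : ∃ v, #(univ.filter (H.Adj v)) ≤ 2 * d := by
    by_contra! h
    have h1 : ∑ v : V, (2 * d + 1) ≤ ∑ v, #(univ.filter (H.Adj v)) := sum_le_sum fun v _ => h v
    rw [← SimpleGraph.card_adjPairs_eq_sum, hm, sum_const, card_univ, hn, smul_eq_mul] at h1
    nlinarith
  obtain ⟨u, hvu⟩ : ∃ u, H.Adj v u := by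
    by_contra! h
    have : Nontrivial V := Fintype.one_lt_card_iff_nontrivial.1 (by omega)
    obtain ⟨w, hw⟩ := exists_ne v
    have : Nonempty {x : V // x ≠ v} := ⟨⟨w, hw⟩⟩
    have h1 := SimpleGraph.card_adjPairs_le_induce h
    have h2 := ihn (n - 1) (by omega) _ {x : V // x ≠ v} (H.induce {x | x ≠ v}) (hcard' v) rfl
      fun h => hH h.of_induce
    omega
  have hcardW : Fintype.card {x | H.Adj v x} = #(univ.filter (H.Adj v)) :=
    Fintype.card_subtype _
  refine hH (HasCompleteMinor.of_induce (s := {x | H.Adj v x}) (hdense _ _ ?_ fun w => ?_))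
  · rw [hcardW]
    refine (hcommon v u hvu).trans (card_le_card fun x => ?_)
    simp +contextual
  · rw [hcardW]
    have h2 := hcommon v w w.2
    refine (show _ ≤ 2 * #(univ.filter fun x => H.Adj v x ∧ H.Adj w x) by omega).trans
      (Nat.mul_le_mul_left 2 ?_)
    refine card_le_card_of_surjOn Subtype.val fun x hx => ?_
    simp only [coe_filter, mem_univ, true_and, Set.mem_ofPred_eq] at hx
    exact ⟨⟨x, hx.1⟩, by simpa using hx.2, rfl⟩

end EdgeCount

section DenseGraph

open Finset Classical

variable {V : Type}

theorem mul_card_filter_lt_le_of_sum_le {W : Finset V} {f : V → ℝ} (hf : ∀ v, 0 ≤ f v) {c p : ℝ}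
    (hc : 0 ≤ c) (hp : 0 ≤ p) (h : ∑ v ∈ W, f v ≤ p * c * #W) :
    (#(W.filter fun v => c < f v) : ℝ) ≤ p * #W := by
  rcases hc.eq_or_lt with rfl | hc
  · have h0 : ∑ v ∈ W, f v = 0 := le_antisymm (by simpa using h) (sum_nonneg fun v _ => hf v)
    rw [sum_eq_zero_iff_of_nonneg fun v _ => hf v] at h0
    rw [filter_false_of_mem fun v hv => by simp [h0 v hv]]
    simp only [card_empty, Nat.cast_zero]
    positivity
  · have h1 : (#(W.filter fun v => c < f v) : ℝ) * c ≤ ∑ v ∈ W, f v := by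
      rw [← nsmul_eq_mul, ← sum_const]
      exact (sum_le_sum fun v hv => (mem_filter.1 hv).2.le).trans
        (sum_le_sum_of_subset_of_nonneg (filter_subset _ _) fun v _ _ => hf v)
    refine le_of_mul_le_mul_right ?_ hc
    linarith

variable [Fintype V] {H : SimpleGraph V}

/-- Minimum degree at least half the order, and connectivity that survives the deletion of up to
a twentieth of the vertices. -/
def SimpleGraph.RobustlyConnected (H : SimpleGraph V) : Prop :=
  (∀ v, Fintype.card V ≤ 2 * #(univ.filter (H.Adj v))) ∧
  ∀ X S : Finset V, 20 * #X ≤ Fintype.card V → Disjoint S X → S.Nonempty →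
    (∃ v, v ∉ S ∧ v ∉ X) → ∃ u ∈ S, ∃ w, w ∉ S ∧ w ∉ X ∧ H.Adj u w

/-- The vertices with no neighbour in `S`. -/
noncomputable def SimpleGraph.undominated (H : SimpleGraph V) (S : Finset V) : Finset V :=
  univ.filter fun y => ∀ v ∈ S, ¬ H.Adj v y

namespace SimpleGraph

theorem robustlyConnected_of_degree_ge [Nonempty V]
    (hdeg : ∀ v, 9 * Fintype.card V ≤ 10 * #(univ.filter (H.Adj v))) : H.RobustlyConnected := by
  have hN : 0 < Fintype.card V := Fintype.card_pos
  refine ⟨fun v => by have := hdeg v; omega, ?_⟩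
  rintro X S hX hSX ⟨u, hu⟩ ⟨v, hvS, hvX⟩
  obtain ⟨z, hz, hzX⟩ : ∃ z ∈ univ.filter (H.Adj u) ∩ univ.filter (H.Adj v), z ∉ X := by
    by_contra! h
    have h1 := card_le_card h
    have h2 := card_union_add_card_inter (univ.filter (H.Adj u)) (univ.filter (H.Adj v))
    have h3 := card_le_univ (univ.filter (H.Adj u) ∪ univ.filter (H.Adj v))
    have := hdeg u
    have := hdeg v
    omega
  simp only [mem_inter, mem_filter, mem_univ, true_and] at hz
  by_cases hzS : z ∈ S
  · exact ⟨z, hzS, v, hvS, hvX, hz.2.symm⟩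
  · exact ⟨u, hu, z, hzS, hzX, hz.1⟩

theorem RobustlyConnected.exists_common_neighbor (hH : H.RobustlyConnected) {X : Finset V}
    (hX : 20 * #X ≤ Fintype.card V) (hN : 0 < Fintype.card V) (u v w : V) :
    ∃ z ∉ X, (H.Adj u z ∧ H.Adj v z) ∨ (H.Adj u z ∧ H.Adj w z) ∨ (H.Adj v z ∧ H.Adj w z) := by
  by_contra! hcon
  have hdisj : ∀ {a b : V}, (∀ z ∉ X, H.Adj a z → ¬ H.Adj b z) →
      Disjoint (univ.filter (H.Adj a) \ X) (univ.filter (H.Adj b) \ X) := by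
    intro a b h
    rw [Finset.disjoint_left]
    intro z hz hz'
    simp only [mem_sdiff, mem_filter, mem_univ, true_and] at hz hz'
    exact h z hz.2 hz.1 hz'.1
  have h1 := hdisj fun z hz => (hcon z hz).1
  have h2 := hdisj fun z hz => (hcon z hz).2.1
  have h3 := hdisj fun z hz => (hcon z hz).2.2
  have h4 := card_le_univ ((univ.filter (H.Adj u) \ X ∪ univ.filter (H.Adj v) \ X) ∪
    univ.filter (H.Adj w) \ X)
  rw [card_union_of_disjoint (disjoint_union_left.2 ⟨h2, h3⟩), card_union_of_disjoint h1] at h4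
  have := le_card_sdiff X (univ.filter (H.Adj u))
  have := le_card_sdiff X (univ.filter (H.Adj v))
  have := le_card_sdiff X (univ.filter (H.Adj w))
  have := hH.1 u
  have := hH.1 v
  have := hH.1 w
  omega

theorem RobustlyConnected.exists_short_walk (hH : H.RobustlyConnected) {X : Finset V}
    (hX : 20 * #X ≤ Fintype.card V) {u v : V} (hu : u ∉ X) (hv : v ∉ X) :
    ∃ p : H.Walk u v, p.length ≤ 5 ∧ ∀ x ∈ p.support, x ∉ X := by
  have hN : 0 < Fintype.card V := Fintype.card_pos_iff.2 ⟨u⟩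
  set S : Finset V := univ.filter fun w =>
    ∃ p : H.Walk u w, p.length ≤ 2 ∧ ∀ x ∈ p.support, x ∉ X with hS
  have hmemS : ∀ w, w ∈ S ↔ ∃ p : H.Walk u w, p.length ≤ 2 ∧ ∀ x ∈ p.support, x ∉ X := by
    simp [hS]
  by_cases hvS : v ∈ S
  · obtain ⟨p, hp, hpX⟩ := (hmemS v).1 hvS
    exact ⟨p, by omega, hpX⟩
  have hpath : ∀ w, w ∉ X → (∃ z ∉ X, H.Adj u z ∧ H.Adj w z) → w ∈ S := by
    rintro w hw ⟨z, hz, huz, hwz⟩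
    refine (hmemS w).2 ⟨.cons huz (.cons hwz.symm .nil), by simp, ?_⟩
    simp [hu, hz, hw]
  have hSX : Disjoint S X := by
    rw [Finset.disjoint_left]
    intro w hw
    obtain ⟨p, -, hpX⟩ := (hmemS w).1 hw
    exact hpX w p.end_mem_support
  obtain ⟨a, ha, b, hbS, hbX, hab⟩ := hH.2 X S hX hSX
    ⟨u, (hmemS u).2 ⟨.nil, by simp, by simpa using hu⟩⟩ ⟨v, hvS, hv⟩
  obtain ⟨p, hp, hpX⟩ := (hmemS a).1 ha
  obtain ⟨z, hz, h | h | ⟨hvz, hbz⟩⟩ := hH.exists_common_neighbor hX hN u v b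
  · exact absurd (hpath v hv ⟨z, hz, h⟩) hvS
  · exact absurd (hpath b hbX ⟨z, hz, h⟩) hbS
  · refine ⟨p.append (.cons hab (.cons hbz (.cons hvz.symm .nil))), ?_, ?_⟩
    · simp only [Walk.length_append, Walk.length_cons, Walk.length_nil]
      omega
    · intro x hx
      rw [Walk.mem_support_append_iff] at hx
      rcases hx with hx | hx
      · exact hpX x hx
      · simp only [Walk.support_cons, Walk.support_nil, List.mem_cons, List.not_mem_nil,
          or_false] at hx
        rcases hx with rfl | rfl | rfl | rfl
        · exact hpX _ p.end_mem_support
        · exact hbX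
        · exact hz
        · exact hv

theorem RobustlyConnected.exists_connected_superset (hH : H.RobustlyConnected) {X S : Finset V}
    (hX : 20 * #X ≤ Fintype.card V) (hSX : Disjoint S X) (hS : S.Nonempty) :
    ∃ B, S ⊆ B ∧ Disjoint B X ∧ #B ≤ 6 * #S ∧ (H.induce (B : Set V)).Connected := by
  obtain ⟨u, hu⟩ := hS
  have hw : ∀ v : V, ∃ P : Finset V, v ∈ S → u ∈ P ∧ v ∈ P ∧ #P ≤ 6 ∧ Disjoint P X ∧
      (H.induce (P : Set V)).Connected := by
    intro v
    by_cases hv : v ∈ S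
    · obtain ⟨p, hp, hpX⟩ := hH.exists_short_walk hX (Finset.disjoint_left.1 hSX hu)
        (Finset.disjoint_left.1 hSX hv)
      refine ⟨p.support.toFinset, fun _ => ⟨by simp, by simp, ?_, ?_, ?_⟩⟩
      · refine (List.toFinset_card_le _).trans ?_
        rw [Walk.length_support]
        omega
      · rw [Finset.disjoint_left]
        exact fun x hx => hpX x (by simpa using hx)
      · rw [List.coe_toFinset]
        exact p.connected_induce_support
    · exact ⟨∅, fun h => absurd h hv⟩
  choose P hP using hw
  refine ⟨S.biUnion P, fun v hv => mem_biUnion.2 ⟨v, hv, (hP v hv).2.1⟩, ?_, ?_, ?_⟩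
  · rw [disjoint_biUnion_left]
    exact fun v hv => (hP v hv).2.2.2.1
  · rw [mul_comm]
    exact card_biUnion_le_card_mul _ _ _ fun v hv => (hP v hv).2.2.1
  · have : ((S.biUnion P : Finset V) : Set V) = ⋃₀ ((fun v => (P v : Set V)) '' S) := by
      ext
      simp
    rw [this]
    refine induce_sUnion_connected_of_pairwise_not_disjoint ⟨_, u, hu, rfl⟩ ?_ ?_
    · rintro _ _ ⟨v, hv, rfl⟩ ⟨w, hw, rfl⟩
      exact ⟨u, (hP v hv).1, (hP w hw).1⟩
    · rintro _ ⟨v, hv, rfl⟩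
      exact (hP v hv).2.2.2.2

theorem RobustlyConnected.exists_improving_vertex (hH : H.RobustlyConnected) {X : Finset V}
    (hX : 20 * #X ≤ Fintype.card V) (hN : 0 < Fintype.card V) {ι : Type} (I : Finset ι)
    (Z : ι → Finset V) {β : ℝ} (hβ : 0 ≤ β) (hZ : ∀ i ∈ I, (#(Z i) : ℝ) ≤ β * Fintype.card V)
    (Y : Finset V) : ∃ v ∉ X, (#(Y.filter fun y => ¬ H.Adj v y) : ℝ) ≤ 8 / 10 * #Y ∧
      (#(I.filter fun i => v ∈ Z i) : ℝ) ≤ 10 * β * #I := by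
  have hW1 : #Xᶜ + #X = Fintype.card V := card_compl_add_card X
  have hW2 : (19 : ℝ) * Fintype.card V ≤ 20 * #Xᶜ := by
    have : 19 * Fintype.card V ≤ 20 * #Xᶜ := by omega
    exact_mod_cast this
  have hN' : (0 : ℝ) < Fintype.card V := by exact_mod_cast hN
  have hY : ∑ v ∈ Xᶜ, (#(Y.filter fun y => ¬ H.Adj v y) : ℝ) ≤ 55 / 80 * (8 / 10 * #Y) * #Xᶜ := by
    have h1 : ∑ v ∈ Xᶜ, #(Y.filter fun y => ¬ H.Adj v y) =
        ∑ y ∈ Y, #(Xᶜ.filter fun v => ¬ H.Adj v y) := by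
      simp only [card_filter]
      exact sum_comm
    have h2 : ∀ y ∈ Y, (#(Xᶜ.filter fun v => ¬ H.Adj v y) : ℝ) ≤ 55 / 100 * #Xᶜ := by
      intro y _
      have e1 := card_filter_add_card_filter_not (s := Xᶜ) (fun v => H.Adj v y)
      have e2 : univ.filter (H.Adj y) \ X ⊆ Xᶜ.filter fun v => H.Adj v y := by
        intro v
        simp only [mem_sdiff, mem_filter, mem_univ, true_and, mem_compl]
        exact fun h => ⟨h.2, h.1.symm⟩
      have e3 := card_le_card e2
      have e4 := le_card_sdiff X (univ.filter (H.Adj y))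
      have e5 := hH.1 y
      have e6 : 20 * #(Xᶜ.filter fun v => ¬ H.Adj v y) ≤ 11 * #Xᶜ := by omega
      have e7 : (20 : ℝ) * #(Xᶜ.filter fun v => ¬ H.Adj v y) ≤ 11 * #Xᶜ := by exact_mod_cast e6
      linarith
    have h3 := sum_le_sum h2
    rw [sum_const, nsmul_eq_mul] at h3
    have h4 : (∑ v ∈ Xᶜ, (#(Y.filter fun y => ¬ H.Adj v y) : ℝ)) =
        ∑ y ∈ Y, (#(Xᶜ.filter fun v => ¬ H.Adj v y) : ℝ) := by exact_mod_cast h1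
    rw [h4]
    linarith
  have hI : ∑ v ∈ Xᶜ, (#(I.filter fun i => v ∈ Z i) : ℝ) ≤ 1 / 8 * (10 * β * #I) * #Xᶜ := by
    have h1 : ∑ v ∈ Xᶜ, #(I.filter fun i => v ∈ Z i) =
        ∑ i ∈ I, #(Xᶜ.filter fun v => v ∈ Z i) := by
      simp only [card_filter]
      exact sum_comm
    have h2 : ∀ i ∈ I, (#(Xᶜ.filter fun v => v ∈ Z i) : ℝ) ≤ β * Fintype.card V := by
      intro i hi
      refine le_trans ?_ (hZ i hi)
      exact_mod_cast card_le_card fun v hv => (mem_filter.1 hv).2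
    have h3 := sum_le_sum h2
    rw [sum_const, nsmul_eq_mul] at h3
    have h4 : (∑ v ∈ Xᶜ, (#(I.filter fun i => v ∈ Z i) : ℝ)) =
        ∑ i ∈ I, (#(Xᶜ.filter fun v => v ∈ Z i) : ℝ) := by exact_mod_cast h1
    rw [h4]
    have h5 : 0 ≤ (#I : ℝ) * β := by positivity
    nlinarith
  have m1 := mul_card_filter_lt_le_of_sum_le (fun v => by positivity) (by positivity)
    (by norm_num) hY
  have m2 := mul_card_filter_lt_le_of_sum_le (fun v => by positivity) (by positivity)
    (by norm_num) hI
  by_contra! hcon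
  have hsub : Xᶜ ⊆ (Xᶜ.filter fun v => 8 / 10 * (#Y : ℝ) < #(Y.filter fun y => ¬ H.Adj v y)) ∪
      Xᶜ.filter fun v => 10 * β * #I < #(I.filter fun i => v ∈ Z i) := by
    intro v hv
    by_cases h : 8 / 10 * (#Y : ℝ) < #(Y.filter fun y => ¬ H.Adj v y)
    · exact mem_union_left _ (mem_filter.2 ⟨hv, h⟩)
    · exact mem_union_right _ (mem_filter.2 ⟨hv, hcon v (by simpa using hv) (not_lt.1 h)⟩)
  have h1 := (card_le_card hsub).trans (card_union_le _ _)
  have h2 : (#Xᶜ : ℝ) ≤ #(Xᶜ.filter fun v => 8 / 10 * (#Y : ℝ) < #(Y.filter fun y => ¬ H.Adj v y)) +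
      #(Xᶜ.filter fun v => 10 * β * #I < #(I.filter fun i => v ∈ Z i)) := by exact_mod_cast h1
  linarith

theorem RobustlyConnected.exists_dominating_transversal (hH : H.RobustlyConnected) {X : Finset V}
    (hX : 20 * #X ≤ Fintype.card V) (hN : 0 < Fintype.card V) {ι : Type} (I : Finset ι)
    (Z : ι → Finset V) {β : ℝ} (hβ : 0 ≤ β) (hZ : ∀ i ∈ I, (#(Z i) : ℝ) ≤ β * Fintype.card V)
    (j : ℕ) : ∃ S : Finset V, #S ≤ j ∧ Disjoint S X ∧
      (#(H.undominated S) : ℝ) ≤ (8 / 10) ^ j * Fintype.card V ∧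
      (#(I.filter fun i => S ⊆ Z i) : ℝ) ≤ (10 * β) ^ j * #I := by
  induction j with
  | zero =>
    refine ⟨∅, by simp, by simp, ?_, by simp⟩
    simpa using card_le_univ (H.undominated ∅)
  | succ j ih =>
    obtain ⟨S, hS, hSX, hSY, hSI⟩ := ih
    obtain ⟨v, hv, hvY, hvI⟩ := hH.exists_improving_vertex hX hN (I.filter fun i => S ⊆ Z i) Z hβ
      (fun i hi => hZ i (mem_filter.1 hi).1) (H.undominated S)
    refine ⟨insert v S, (card_insert_le _ _).trans (by omega), ?_, ?_, ?_⟩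
    · exact disjoint_insert_left.2 ⟨hv, hSX⟩
    · have h1 : H.undominated (insert v S) = (H.undominated S).filter fun y => ¬ H.Adj v y := by
        ext y
        simp [undominated, and_comm]
      rw [h1]
      refine hvY.trans ?_
      rw [pow_succ]
      linarith
    · have h1 : (I.filter fun i => insert v S ⊆ Z i) =
          (I.filter fun i => S ⊆ Z i).filter fun i => v ∈ Z i := by
        ext i
        simp only [mem_filter, insert_subset_iff]
        tauto
      rw [h1]
      refine hvI.trans ?_
      calc 10 * β * #(I.filter fun i => S ⊆ Z i) ≤ 10 * β * ((10 * β) ^ j * #I) := by gcongr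
        _ = _ := by ring

theorem RobustlyConnected.hasCompleteMinor (hH : H.RobustlyConnected) {t s : ℕ} (ht : 1 ≤ t)
    (hs : 22 ≤ s) (hts : t ^ 8 ≤ 2 ^ (s ^ 2)) (hcard : 120 * (t * s) ≤ Fintype.card V) :
    HasCompleteMinor H t := by
  have hN : 0 < Fintype.card V := lt_of_lt_of_le (by positivity) hcard
  have hN' : (0 : ℝ) < Fintype.card V := by exact_mod_cast hN
  set β : ℝ := (8 / 10) ^ s with hβ
  have hβ0 : 0 ≤ β := by positivity
  have hsmall : (10 * β) ^ s * t < 1 := by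
    have h1 : 10 * β ≤ (8 / 10) ^ (s - 11) := by
      rw [hβ, show s = (s - 11) + 11 by omega, Nat.add_sub_cancel, pow_add]
      have : (0 : ℝ) ≤ (8 / 10) ^ (s - 11) := by positivity
      nlinarith [show (10 : ℝ) * (8 / 10) ^ 11 ≤ 1 by norm_num]
    have h2 : (10 * β) ^ s ≤ (8 / 10) ^ ((s - 11) * s) := by
      rw [pow_mul]
      exact pow_le_pow_left₀ (by positivity) h1 s
    have h3 : ((10 * β) ^ s * t) ^ 8 < 1 := by
      calc ((10 * β) ^ s * t) ^ 8 ≤ ((8 / 10) ^ ((s - 11) * s) * t) ^ 8 := by gcongr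
        _ = (8 / 10) ^ ((s - 11) * s * 8) * (t : ℝ) ^ 8 := by rw [mul_pow, ← pow_mul]
        _ ≤ (8 / 10) ^ (s ^ 2 * 4) * 2 ^ (s ^ 2) := by
          have e1 : s ^ 2 * 4 ≤ (s - 11) * s * 8 := by
            obtain ⟨k, rfl⟩ := Nat.exists_eq_add_of_le hs
            rw [show 22 + k - 11 = 11 + k by omega]
            nlinarith
          have e2 : (t : ℝ) ^ 8 ≤ 2 ^ (s ^ 2) := by exact_mod_cast hts
          exact mul_le_mul (pow_le_pow_of_le_one (by norm_num) (by norm_num) e1) e2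
            (by positivity) (by positivity)
        _ = ((8 / 10) ^ 4 * 2) ^ (s ^ 2) := by rw [mul_pow, ← pow_mul, mul_comm 4]
        _ < 1 := pow_lt_one₀ (by norm_num) (by norm_num) (by positivity)
    by_contra! h
    exact absurd h3 (not_lt.2 (one_le_pow₀ h))
  have main : ∀ j ≤ t, ∃ B S : ℕ → Finset V,
      (∀ i < j, S i ⊆ B i ∧ #(B i) ≤ 6 * s ∧ (#(H.undominated (S i)) : ℝ) ≤ β * Fintype.card V ∧
        (H.induce (B i : Set V)).Connected) ∧
      ∀ i k, i < k → k < j → Disjoint (B i) (B k) ∧ ¬ S k ⊆ H.undominated (S i) := by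
    intro j
    induction j with
    | zero => exact fun _ => ⟨fun _ => ∅, fun _ => ∅, by simp, by simp⟩
    | succ j ih =>
      intro hj
      obtain ⟨B, S, h1, h2⟩ := ih (by omega)
      set X := (range j).biUnion B with hXdef
      have hX : 20 * #X ≤ Fintype.card V := by
        have e1 : #X ≤ #(range j) * (6 * s) :=
          card_biUnion_le_card_mul _ _ _ fun i hi => (h1 i (mem_range.1 hi)).2.1
        rw [card_range] at e1
        have e2 : j * (6 * s) ≤ t * (6 * s) := Nat.mul_le_mul_right _ (by omega)
        nlinarith
      obtain ⟨T, hT, hTX, hTY, hTI⟩ := hH.exists_dominating_transversal hX hN (range j)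
        (fun i => H.undominated (S i)) hβ0 (fun i hi => (h1 i (mem_range.1 hi)).2.2.1) s
      have hTne : T.Nonempty := by
        rw [nonempty_iff_ne_empty]
        rintro rfl
        have e1 : H.undominated ∅ = univ := by simp [undominated]
        rw [e1, card_univ] at hTY
        have e2 : ((8 : ℝ) / 10) ^ s < 1 := pow_lt_one₀ (by norm_num) (by norm_num) (by omega)
        nlinarith
      have hhit : ∀ i < j, ¬ T ⊆ H.undominated (S i) := by
        intro i hi hsub
        have e1 : 0 < #((range j).filter fun i => T ⊆ H.undominated (S i)) :=
          card_pos.2 ⟨i, mem_filter.2 ⟨mem_range.2 hi, hsub⟩⟩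
        have e2 : (1 : ℝ) ≤ #((range j).filter fun i => T ⊆ H.undominated (S i)) := by
          exact_mod_cast e1
        have e3 : (10 * β) ^ s * (#(range j) : ℝ) ≤ (10 * β) ^ s * t := by
          rw [card_range]
          have : (j : ℝ) ≤ t := by exact_mod_cast (by omega : j ≤ t)
          gcongr
        linarith
      obtain ⟨C, hTC, hCX, hC, hconn⟩ := hH.exists_connected_superset hX hTX hTne
      refine ⟨fun i => if i = j then C else B i, fun i => if i = j then T else S i, ?_, ?_⟩
      · intro i hi
        by_cases hij : i = j
        · beta_reduce
          rw [if_pos hij, if_pos hij]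
          exact ⟨hTC, hC.trans (by omega), hTY, hconn⟩
        · beta_reduce
          rw [if_neg hij, if_neg hij]
          exact h1 i (by omega)
      · intro i k hik hk
        have hij : i ≠ j := by omega
        by_cases hkj : k = j
        · simp only [hkj, hij, if_true, if_false]
          rw [hXdef, disjoint_biUnion_right] at hCX
          exact ⟨(hCX i (mem_range.2 (by omega))).symm, hhit i (by omega)⟩
        · simp only [hkj, hij, if_false]
          exact h2 i k hik (by omega)
  obtain ⟨B, S, h1, h2⟩ := main t le_rfl
  have hadj : ∀ i k : Fin t, i < k → ∃ u ∈ B i, ∃ v ∈ B k, H.Adj u v := by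
    intro i k hik
    obtain ⟨v, hv, hv'⟩ := not_subset.1 (h2 i k hik k.2).2
    simp only [undominated, mem_filter, mem_univ, true_and, not_forall, not_not] at hv'
    obtain ⟨u, hu, huv⟩ := hv'
    exact ⟨u, (h1 i i.2).1 hu, v, (h1 k k.2).1 hv, huv⟩
  refine ⟨fun i => B i, fun i => (h1 i i.2).2.2.2, fun i k hik => ?_, fun i k hik => ?_⟩
  · show Disjoint (B i : Set V) (B k)
    rw [Finset.disjoint_coe]
    rcases lt_or_gt_of_ne hik with h | h
    · exact (h2 i k h k.2).1
    · exact (h2 k i h i.2).1.symm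
  · rcases lt_or_gt_of_ne hik with h | h
    · exact hadj i k h
    · obtain ⟨u, hu, v, hv, huv⟩ := hadj k i h
      exact ⟨v, hv, u, hu, huv.symm⟩

/-- A graph with minimum degree at least half its order is robustly connected, or contains an
almost complete subgraph on almost half of the vertices. -/
theorem robustlyConnected_or_exists_induce [Nonempty V]
    (hdeg : ∀ v, Fintype.card V ≤ 2 * #(univ.filter (H.Adj v))) :
    H.RobustlyConnected ∨ ∃ C : Finset V, 9 * Fintype.card V ≤ 20 * #C ∧
      (H.induce (C : Set V)).RobustlyConnected := by
  by_contra! hcon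
  obtain ⟨hrob, hind⟩ := hcon
  have hpos : 0 < Fintype.card V := Fintype.card_pos
  have hsmall : ∀ X C : Finset V, 20 * #X ≤ Fintype.card V → C.Nonempty →
      2 * #C ≤ Fintype.card V → (∀ u ∈ C, ∀ w, w ∉ C → w ∉ X → ¬ H.Adj u w) → False := by
    intro X C hX hC hCcard hclosed
    have hdegC : ∀ v ∈ C, 9 * Fintype.card V ≤ 20 * #(C.filter (H.Adj v)) := by
      intro v hv
      have hsub : univ.filter (H.Adj v) \ X ⊆ C.filter (H.Adj v) := by
        intro w hw
        simp only [mem_sdiff, mem_filter, mem_univ, true_and] at hw ⊢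
        refine ⟨?_, hw.1⟩
        by_contra h
        exact hclosed v hv w h hw.2 hw.1
      have h1 := card_le_card hsub
      have h2 := le_card_sdiff X (univ.filter (H.Adj v))
      have h3 := hdeg v
      omega
    obtain ⟨c, hc⟩ := hC
    have : Nonempty (C : Set V) := ⟨⟨c, hc⟩⟩
    refine hind C ?_ (robustlyConnected_of_degree_ge fun v => ?_)
    · exact (hdegC c hc).trans (Nat.mul_le_mul_left _ (card_filter_le _ _))
    · have h2 := hdegC v v.2
      have h3 : Fintype.card (C : Set V) = #C := by simp
      refine (show 9 * Fintype.card (C : Set V) ≤ 10 * #(C.filter (H.Adj v)) by omega).trans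
        (Nat.mul_le_mul_left 10 (card_le_card_of_surjOn Subtype.val fun x hx => ?_))
      simp only [coe_filter, Set.mem_ofPred_eq] at hx
      exact ⟨⟨x, hx.1⟩, by simpa using hx.2, rfl⟩
  refine hrob ⟨hdeg, fun X S hX hSX hS hout => ?_⟩
  by_contra! hclosed
  by_cases hScard : 2 * #S ≤ Fintype.card V
  · exact hsmall X S hX hS hScard hclosed
  · obtain ⟨v, hvS, hvX⟩ := hout
    refine hsmall X (S ∪ X)ᶜ hX ⟨v, by simp [hvS, hvX]⟩ ?_ ?_
    · have h1 := card_compl_add_card (S ∪ X)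
      have h2 := card_le_card (subset_union_left : S ⊆ S ∪ X)
      omega
    · intro u hu w hw hwX huw
      simp only [compl_union, mem_inter, mem_compl, not_and, not_not] at hu hw
      by_cases hwS : w ∈ S
      · exact hclosed w hwS u hu.1 hu.2 huw.symm
      · exact hwX (hw hwS)

end SimpleGraph

theorem hasCompleteMinor_of_minDegree {t s : ℕ} (ht : 1 ≤ t) (hs : 22 ≤ s)
    (hts : t ^ 8 ≤ 2 ^ (s ^ 2)) (hcard : 300 * (t * s) ≤ Fintype.card V)
    (hdeg : ∀ v, Fintype.card V ≤ 2 * #(univ.filter (H.Adj v))) : HasCompleteMinor H t := by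
  have : Nonempty V := Fintype.card_pos_iff.1 (lt_of_lt_of_le (by positivity) hcard)
  rcases SimpleGraph.robustlyConnected_or_exists_induce hdeg with h | ⟨C, hC, h⟩
  · exact h.hasCompleteMinor ht hs hts (by omega)
  · refine (h.hasCompleteMinor ht hs hts ?_).of_induce
    have : Fintype.card (C : Set V) = #C := by simp
    omega

end DenseGraph

open Finset Classical in
/-- The Kostochka–Thomason bound on the number of edges of a graph without a `K_t` minor. -/
theorem card_adjPairs_le_of_not_hasCompleteMinor {V : Type} [Fintype V] [Nonempty V]
    {H : SimpleGraph V} {t : ℕ} (ht : 3 ≤ t) (hH : ¬ HasCompleteMinor H t) :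
    (#H.adjPairs : ℝ) ≤ 13800 * (t * Real.sqrt (Real.logb 2 t)) * Fintype.card V := by
  have htR : (3 : ℝ) ≤ t := by exact_mod_cast ht
  have hlog : 1 ≤ Real.logb 2 t := by
    rw [Real.le_logb_iff_rpow_le (by norm_num) (by linarith), Real.rpow_one]
    linarith
  set L := Real.sqrt (Real.logb 2 t) with hL
  have hL1 : 1 ≤ L := Real.one_le_sqrt.2 hlog
  set s := ⌈22 * L⌉₊ with hs
  have hsL : 22 * L ≤ s := Nat.le_ceil _
  have hsL' : (s : ℝ) < 22 * L + 1 := Nat.ceil_lt_add_one (by positivity)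
  have hs22 : 22 ≤ s := by
    have : (22 : ℝ) ≤ s := by linarith
    exact_mod_cast this
  have hts : t ^ 8 ≤ 2 ^ (s ^ 2) := by
    have h1 : 8 * Real.logb 2 t ≤ ((s ^ 2 : ℕ) : ℝ) := by
      have : Real.logb 2 t = L ^ 2 := (Real.sq_sqrt (by linarith)).symm
      rw [this]
      push_cast
      nlinarith
    have h2 : (t : ℝ) ^ 8 ≤ 2 ^ (s ^ 2) := by
      rw [← Real.rpow_natCast 2 (s ^ 2), ← Real.logb_le_iff_le_rpow (by norm_num) (by positivity),
        Real.logb_pow]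
      exact_mod_cast h1
    exact_mod_cast h2
  have hd : 1 ≤ 300 * (t * s) := by
    have : 0 < t * s := by positivity
    omega
  have h := card_adjPairs_lt_of_dense hd
    (fun W _ K hW hdeg => hasCompleteMinor_of_minDegree (by omega) hs22 hts hW hdeg)
    _ _ V H rfl rfl hH
  have h' : (#H.adjPairs : ℝ) ≤ 2 * (300 * (t * s)) * Fintype.card V := by exact_mod_cast h.le
  refine h'.trans ?_
  have h3 : (s : ℝ) ≤ 23 * L := by linarith
  calc (2 * (300 * (t * s)) * Fintype.card V : ℝ)
      ≤ 2 * (300 * (t * (23 * L))) * Fintype.card V := by gcongr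
    _ = _ := by ring

/-- There is an absolute constant `C > 0` such that for every integer
`t ≥ 3`, any always-connected temporal graph `(G_s)_{s ≥ 1}` on `n ≥ 2` vertices whose
underlying graph has no `K_t` minor admits, from any start vertex `v`, a temporal
exploration spanning at most `C · t^{1/2} · (log₂ t)^{1/4} · n^{3/2} · √(log₂ n)`
time steps. -/
theorem temporal_exploration_Kt_minor_free :
    ∃ C : ℝ, 0 < C ∧
      ∀ (t : ℕ) (V : Type) [Fintype V] (G : ℕ → SimpleGraph V),
        3 ≤ t → 2 ≤ Fintype.card V →
        (∀ s : ℕ, 1 ≤ s → (G s).Connected) →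
        ¬ HasCompleteMinor (⨆ s : ℕ, ⨆ _ : 1 ≤ s, G s : SimpleGraph V) t →
        ∀ v : V, ∃ (r : ℕ) (w : ℕ → V),
          w 1 = v ∧
          (∀ s : ℕ, 1 ≤ s → s ≤ r → (w s = w (s + 1) ∨ (G s).Adj (w s) (w (s + 1)))) ∧
          (∀ u : V, ∃ s : ℕ, 1 ≤ s ∧ s ≤ r + 1 ∧ w s = u) ∧
          (r : ℝ) ≤ C * (t : ℝ) ^ (1/2 : ℝ) * (Real.logb 2 t) ^ (1/4 : ℝ) *
            (Fintype.card V : ℝ) ^ (3/2 : ℝ) *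
            Real.sqrt (Real.logb 2 (Fintype.card V)) := by
  refine ⟨24 * Real.sqrt 13800, by positivity, ?_⟩
  intro t V _ G ht hn hG hminor v
  set H : SimpleGraph V := ⨆ s : ℕ, ⨆ _ : 1 ≤ s, G s
  have hH : ∀ s, 1 ≤ s → G s ≤ H := fun s hs => le_iSup₂ (f := fun s (_ : 1 ≤ s) => G s) s hs
  have htR : (3 : ℝ) ≤ t := by exact_mod_cast ht
  have hlog : 1 ≤ Real.logb 2 t := by
    rw [Real.le_logb_iff_rpow_le (by norm_num) (by linarith), Real.rpow_one]
    linarith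
  have hL : 1 ≤ Real.sqrt (Real.logb 2 t) := Real.one_le_sqrt.2 hlog
  have : Nonempty V := ⟨v⟩
  obtain ⟨b, hb, y, ⟨w, hw1, -, hw, hcov⟩, hlen⟩ := exists_exploration hn hG hH
    (d := 13800 * (t * Real.sqrt (Real.logb 2 t))) (by nlinarith)
    (card_adjPairs_le_of_not_hasCompleteMinor ht hminor) Finset.univ le_rfl v
  refine ⟨b - 1, w, hw1, fun s hs hsb => hw s hs (by omega), fun u => ?_, hlen.trans_eq ?_⟩
  · obtain ⟨s, hs, hsb, hsu⟩ := hcov u (by simp)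
    exact ⟨s, hs, by omega, hsu⟩
  · have hroot : Real.logb 2 t ^ (1 / 4 : ℝ) = Real.sqrt (Real.sqrt (Real.logb 2 t)) := by
      rw [Real.sqrt_eq_rpow, Real.sqrt_eq_rpow, ← Real.rpow_mul (by linarith)]
      norm_num
    have hn0 : (0 : ℝ) < Fintype.card V := by exact_mod_cast Fintype.card_pos
    have hpow : (Fintype.card V : ℝ) ^ (3 / 2 : ℝ) =
        Fintype.card V * Real.sqrt (Fintype.card V) := by
      rw [Real.sqrt_eq_rpow, ← Real.rpow_one_add' hn0.le (by norm_num)]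
      norm_num
    rw [hroot, hpow, ← Real.sqrt_eq_rpow, Finset.card_univ, Real.sqrt_mul (by positivity),
      Real.sqrt_mul (by norm_num), Real.sqrt_mul (by positivity)]
    ring
end

section
/- There exists an absolute constant C > 0 such that the following holds. Let G = (G_t)_{t ∈ ℕ, t ≥ 1} be an always-connected temporal graph on a vertex set of size n ≥ 2 whose underlying graph has at most m edges, where m ≥ 1. Then for every start vertex s, there exists a temporal exploration of G starting at s that spans at most C · n · sqrt(m · log₂ n) time steps. -/
/-- Over the time steps `a, …, b - 1` some temporal walk of `G` leads from `u` to `v` and covers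
every vertex of `S`. -/
def Traverses {V : Type*} (G : ℕ → SimpleGraph V) (a b : ℕ) (u v : V) (S : Set V) : Prop :=
  a ≤ b ∧ ∃ w : ℕ → V, w a = u ∧ w b = v ∧
    (∀ t, a ≤ t → t < b → (w t = w (t + 1) ∨ (G t).Adj (w t) (w (t + 1)))) ∧
    ∀ x ∈ S, ∃ t, a ≤ t ∧ t ≤ b ∧ w t = x

namespace Traverses

variable {V : Type*} {G : ℕ → SimpleGraph V} {a b c : ℕ} {u v x : V} {S S' : Set V}

theorem stay (G : ℕ → SimpleGraph V) (h : a ≤ b) (u : V) : Traverses G a b u u {u} :=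
  ⟨h, fun _ => u, rfl, rfl, fun _ _ _ => Or.inl rfl, fun _ hx => ⟨a, le_rfl, h, hx.symm⟩⟩

theorem mono (h : Traverses G a b u v S) (hS : S' ⊆ S) : Traverses G a b u v S' := by
  obtain ⟨hab, w, h1, h2, h3, h4⟩ := h
  exact ⟨hab, w, h1, h2, h3, fun x hx => h4 x (hS hx)⟩

theorem step (h : (G a).Adj u v) : Traverses G a (a + 1) u v ∅ := by
  refine ⟨a.le_succ, fun t => if t ≤ a then u else v, by simp, by simp, ?_, by simp⟩
  intro t h1 h2
  obtain rfl : t = a := by omega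
  simp [h]

theorem trans (h : Traverses G a b u v S) (h' : Traverses G b c v x S') :
    Traverses G a c u x (S ∪ S') := by
  obtain ⟨hab, w, h1, h2, h3, h4⟩ := h
  obtain ⟨hbc, w', h1', h2', h3', h4'⟩ := h'
  refine ⟨hab.trans hbc, fun t => if t ≤ b then w t else w' t, by simp [hab, h1], ?_, ?_, ?_⟩
  · by_cases hcb : c ≤ b
    · obtain rfl : b = c := by omega
      simp [h2, ← h2', h1']
    · simp [hcb, h2']
  · intro t ht1 ht2
    rcases lt_trichotomy t b with htb | rfl | htb
    · simpa [htb.le, Nat.succ_le_of_lt htb] using h3 t ht1 htb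
    · simpa [h2, ← h1'] using h3' t le_rfl ht2
    · simpa [htb.not_ge, show ¬ t + 1 ≤ b by omega] using h3' t htb.le ht2
  · rintro y (hy | hy)
    · obtain ⟨t, ht1, ht2, rfl⟩ := h4 y hy
      exact ⟨t, ht1, ht2.trans hbc, by simp [ht2]⟩
    · obtain ⟨t, ht1, ht2, rfl⟩ := h4' y hy
      refine ⟨t, hab.trans ht1, ht2, ?_⟩
      by_cases htb : t ≤ b
      · obtain rfl : t = b := by omega
        simp [h2, h1']
      · simp [htb]

theorem reach_trans (h : Traverses G a b u v ∅) (h' : Traverses G b c v x ∅) :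
    Traverses G a c u x ∅ := by
  simpa using h.trans h'

theorem reach_refl (G : ℕ → SimpleGraph V) (h : a ≤ b) (u : V) : Traverses G a b u u ∅ :=
  (stay G h u).mono (Set.empty_subset _)

end Traverses

theorem SimpleGraph.Connected.exists_adj_of_mem_of_notMem {V : Type*} {H : SimpleGraph V}
    (hH : H.Connected) {S : Set V} {u v : V} (hu : u ∈ S) (hv : v ∉ S) :
    ∃ x y, x ∈ S ∧ y ∉ S ∧ H.Adj x y := by
  obtain ⟨p⟩ := hH.preconnected u v
  obtain ⟨d, -, h1, h2⟩ := p.exists_boundary_dart S hu hv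
  exact ⟨d.fst, d.snd, h1, h2, d.adj⟩

/-- In an always-connected temporal graph on `n` vertices, every vertex can be reached from every
other one within `n` time steps. -/
theorem traverses_of_card_le {V : Type*} [Fintype V] {G : ℕ → SimpleGraph V}
    (hG : ∀ t, 1 ≤ t → (G t).Connected) {a b : ℕ} (ha : 1 ≤ a) (hb : a + Fintype.card V ≤ b)
    (u v : V) : Traverses G a b u v ∅ := by
  classical
  have key : ∀ i, (∀ v, Traverses G a (a + i) u v ∅) ∨
      i < (Finset.univ.filter fun v => Traverses G a (a + i) u v ∅).card := by
    intro i
    induction i with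
    | zero =>
      right
      exact Finset.card_pos.2 ⟨u, by simpa using Traverses.reach_refl G le_rfl u⟩
    | succ i ih =>
      have wait : ∀ x, Traverses G a (a + i) u x ∅ → Traverses G a (a + (i + 1)) u x ∅ :=
        fun x hx => hx.reach_trans (Traverses.reach_refl G (by omega) x)
      rcases ih with ih | ih
      · exact Or.inl fun x => wait x (ih x)
      by_cases hall : ∀ v, Traverses G a (a + i) u v ∅
      · exact Or.inl fun x => wait x (hall x)
      obtain ⟨z, hz⟩ := not_forall.1 hall
      obtain ⟨x, y, hx, hy, hxy⟩ := (hG (a + i) (by omega)).exists_adj_of_mem_of_notMem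
        (S := {v | Traverses G a (a + i) u v ∅}) (Traverses.reach_refl G (by omega) u) hz
      right
      refine lt_of_le_of_lt (Nat.succ_le_of_lt ih) (Finset.card_lt_card ?_)
      refine ⟨fun x hx => ?_, fun hsub => ?_⟩
      · simp only [Finset.mem_filter, Finset.mem_univ, true_and] at hx ⊢
        exact wait x hx
      · have hy' : Traverses G a (a + (i + 1)) u y ∅ :=
          Traverses.reach_trans hx (Traverses.step hxy)
        have := hsub (Finset.mem_filter.2 ⟨Finset.mem_univ y, hy'⟩)
        exact hy (by simpa using this)
  have h : ∀ v, Traverses G a (a + Fintype.card V) u v ∅ := by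
    rcases key (Fintype.card V) with h | h
    · exact h
    · exact absurd (Finset.card_le_univ _) h.not_ge
  exact (h v).reach_trans (Traverses.reach_refl G hb v)

open Classical in
/-- In every window of `T` time steps, some member of `Y` can be reached from a `T / (4 * m)` fraction
of the members of `Y`. -/
theorem exists_popular_vertex {V : Type*} [Fintype V] {G : ℕ → SimpleGraph V} {m : ℕ}
    (hG : ∀ t, 1 ≤ t → (G t).Connected)
    (hm : (⨆ t : ℕ, ⨆ _ : 1 ≤ t, G t : SimpleGraph V).edgeSet.ncard ≤ m)
    {a T : ℕ} (ha : 1 ≤ a) (hT : T ≤ 4 * m) {Y : Finset V} (hY : Y.Nonempty) :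
    ∃ w ∈ Y, Y.card * T ≤ (Y.filter fun u => Traverses G a (a + T) u w ∅).card * (4 * m) := by
  classical
  set H : SimpleGraph V := ⨆ t : ℕ, ⨆ _ : 1 ≤ t, G t with hH
  have hGH : ∀ t, 1 ≤ t → ∀ x y, (G t).Adj x y → H.Adj x y := by
    intro t ht x y hxy
    exact (le_iSup₂_of_le t ht le_rfl : G t ≤ H) hxy
  by_cases hC : ∃ u ∈ Y, ∃ t < T, ∀ x, Traverses G (a + t + 1) (a + T) x u ∅
  · obtain ⟨u, hu, t, ht, hx⟩ := hC
    refine ⟨u, hu, ?_⟩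
    rw [Finset.filter_true_of_mem
      fun x _ => (Traverses.reach_refl G (by omega) x).reach_trans (hx x)]
    exact Nat.mul_le_mul_left _ hT
  obtain ⟨w, hw, hmax⟩ := Finset.exists_max_image Y
    (fun w => (Y.filter fun u => Traverses G a (a + T) u w ∅).card) hY
  refine ⟨w, hw, ?_⟩
  -- the excursion from `u` present at time `a + t` leaves its closed range along some edge
  have hdart : ∀ p : V × ℕ, p ∈ Y ×ˢ Finset.range T → ∃ d : H.Dart × Bool,
      Traverses G a (a + p.2) p.1 d.1.fst ∅ ∧ Traverses G (a + p.2 + 1) (a + T) d.1.fst p.1 ∅ ∧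
      Traverses G a (a + p.2 + 1) p.1 d.1.snd ∅ ∧ Traverses G (a + p.2) (a + T) d.1.snd p.1 ∅ ∧
      (d.2 = true → ¬ Traverses G a (a + p.2) p.1 d.1.snd ∅) ∧
      (d.2 = false → ¬ Traverses G (a + p.2 + 1) (a + T) d.1.snd p.1 ∅) := by
    rintro ⟨u, t⟩ hp
    simp only [Finset.mem_product, Finset.mem_range] at hp
    have hz : ∃ z, ¬ Traverses G (a + t + 1) (a + T) z u ∅ := by
      by_contra hcon
      exact hC ⟨u, hp.1, t, hp.2, not_exists_not.1 hcon⟩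
    obtain ⟨z, hz⟩ := hz
    obtain ⟨x, y, hx, hy, hxy⟩ := (hG (a + t) (by omega)).exists_adj_of_mem_of_notMem
      (S := {x | Traverses G a (a + t) u x ∅ ∧ Traverses G (a + t + 1) (a + T) x u ∅})
      (u := u) (v := z)
      ⟨Traverses.reach_refl G (by omega) u, Traverses.reach_refl G (by omega) u⟩
      (fun h => hz h.2)
    have hadj := hGH _ (by omega) _ _ hxy
    by_cases hyf : Traverses G a (a + t) u y ∅
    · exact ⟨(⟨(x, y), hadj⟩, false), hx.1, hx.2, hx.1.reach_trans (Traverses.step hxy),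
        (Traverses.step hxy.symm).reach_trans hx.2, by simp, fun _ h => hy ⟨hyf, h⟩⟩
    · exact ⟨(⟨(x, y), hadj⟩, true), hx.1, hx.2, hx.1.reach_trans (Traverses.step hxy),
        (Traverses.step hxy.symm).reach_trans hx.2, fun _ => hyf, by simp⟩
  have hne : Nonempty (H.Dart × Bool) ∨ T = 0 := by
    rcases Nat.eq_zero_or_pos T with h | h
    · exact Or.inr h
    · obtain ⟨y, hy⟩ := hY
      obtain ⟨d, -⟩ := hdart (y, 0) (by simp [hy, h])
      exact Or.inl ⟨d⟩
  rcases hne with hne | rfl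
  swap
  · simp
  choose! f hf using hdart
  have hcardD : Fintype.card (H.Dart × Bool) ≤ 4 * m := by
    rw [Fintype.card_prod, Fintype.card_bool, H.dart_card_eq_twice_card_edges]
    have : H.edgeFinset.card ≤ m := by
      rw [← Set.ncard_coe_finset, SimpleGraph.coe_edgeFinset]
      exact hm
    omega
  have hfib := Finset.card_le_mul_card_image (f := f) (Y ×ˢ Finset.range T)
    ((Y.filter fun u => Traverses G a (a + T) u w ∅).card) (by
      intro d hd
      have hne : ((Y ×ˢ Finset.range T).filter fun p => f p = d).Nonempty := by
        obtain ⟨p, hp, rfl⟩ := Finset.mem_image.1 hd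
        exact ⟨p, Finset.mem_filter.2 ⟨hp, rfl⟩⟩
      obtain ⟨q, hq, hqmax⟩ := Finset.exists_max_image _ (fun p => p.2) hne
      have reach : ∀ p ∈ (Y ×ˢ Finset.range T), ∀ p' ∈ (Y ×ˢ Finset.range T),
          f p = d → f p' = d → p.2 ≤ p'.2 → Traverses G a (a + T) p.1 p'.1 ∅ := by
        intro p hp p' hp' h h' hle
        have h1 := (hf p hp).1
        have h2 := (hf p' hp').2.1
        rw [h] at h1
        rw [h'] at h2
        exact (h1.reach_trans (Traverses.reach_refl G (by omega) _)).reach_trans h2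
      have time : ∀ p ∈ (Y ×ˢ Finset.range T), ∀ p' ∈ (Y ×ˢ Finset.range T),
          f p = d → f p' = d → p.1 = p'.1 → p'.2 ≤ p.2 := by
        intro p hp p' hp' h h' he
        by_contra! hlt
        obtain ⟨-, -, h1, -, -, h2⟩ := hf p hp
        obtain ⟨-, -, -, h1', h2', -⟩ := hf p' hp'
        rw [h] at h1 h2
        rw [h', ← he] at h1' h2'
        cases hd2 : d.2
        · exact h2 hd2 ((Traverses.reach_refl G (by omega) _).reach_trans h1')
        · exact h2' hd2 (h1.reach_trans (Traverses.reach_refl G (by omega) _))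
      rw [Finset.mem_filter] at hq
      refine le_trans ?_ (hmax q.1 (Finset.mem_product.1 hq.1).1)
      refine Finset.card_le_card_of_injOn Prod.fst ?_ ?_
      · intro p hp
        have hp' := Finset.mem_filter.1 hp
        exact Finset.mem_filter.2 ⟨(Finset.mem_product.1 hp'.1).1,
          reach p hp'.1 q hq.1 hp'.2 hq.2 (hqmax p hp)⟩
      · intro p hp p' hp' he
        have hp := Finset.mem_filter.1 hp
        have hp' := Finset.mem_filter.1 hp'
        exact Prod.ext he (le_antisymm
          (time p' hp'.1 p hp.1 hp'.2 hp.2 he.symm) (time p hp.1 p' hp'.1 hp.2 hp'.2 he)))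
  rw [Finset.card_product, Finset.card_range] at hfib
  exact hfib.trans (Nat.mul_le_mul_left _ ((Finset.card_le_univ _).trans hcardD))

/-- Greedy domination: `s` members of `Y` are reached from all but a `(1 - T / (4 * m)) ^ s` fraction
of `Y`. -/
theorem exists_dominating_subset {V : Type*} [Fintype V] {G : ℕ → SimpleGraph V} {m : ℕ}
    (hG : ∀ t, 1 ≤ t → (G t).Connected)
    (hm : (⨆ t : ℕ, ⨆ _ : 1 ≤ t, G t : SimpleGraph V).edgeSet.ncard ≤ m)
    {a T : ℕ} (ha : 1 ≤ a) (hm1 : 1 ≤ m) (hT : T ≤ 4 * m) (s : ℕ) (Y : Finset V) :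
    ∃ D ⊆ Y, ∃ Z ⊆ Y, D.card ≤ s ∧ (Z.card : ℝ) ≤ (1 - (T : ℝ) / (4 * m)) ^ s * Y.card ∧
      ∀ u ∈ Y, u ∉ Z → ∃ w ∈ D, Traverses G a (a + T) u w ∅ := by
  classical
  induction s generalizing Y with
  | zero => exact ⟨∅, by simp, Y, subset_rfl, by simp, by simp, fun u h h' => absurd h h'⟩
  | succ s ih =>
    rcases Y.eq_empty_or_nonempty with rfl | hY
    · exact ⟨∅, by simp, ∅, by simp, by simp, by simp, by simp⟩
    obtain ⟨w, hw, hcard⟩ := exists_popular_vertex hG hm ha hT hY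
    set P := Y.filter fun u => Traverses G a (a + T) u w ∅ with hP
    obtain ⟨D, hD, Z, hZ, hDs, hZs, hdom⟩ := ih (Y \ P)
    refine ⟨insert w D, Finset.insert_subset hw (hD.trans Finset.sdiff_subset), Z,
      hZ.trans Finset.sdiff_subset, (Finset.card_insert_le _ _).trans (by omega), ?_, ?_⟩
    · have hm0 : (0 : ℝ) < 4 * m := by positivity
      have hfrac : (0 : ℝ) ≤ 1 - (T : ℝ) / (4 * m) := by
        rw [sub_nonneg, div_le_one hm0]
        exact_mod_cast hT
      have hsub : ((Y \ P).card : ℝ) = Y.card - P.card := by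
        rw [Finset.card_sdiff_of_subset (Finset.filter_subset _ _),
          Nat.cast_sub (Finset.card_le_card (Finset.filter_subset _ _))]
      have hc : (Y.card : ℝ) * T ≤ P.card * (4 * m) := by exact_mod_cast hcard
      have hstep : ((Y \ P).card : ℝ) ≤ (1 - (T : ℝ) / (4 * m)) * Y.card := by
        have : (Y.card : ℝ) * T / (4 * m) ≤ P.card := by rwa [div_le_iff₀ hm0]
        rw [hsub]
        calc (Y.card : ℝ) - P.card ≤ Y.card - Y.card * T / (4 * m) := by linarith
          _ = _ := by ring
      calc (Z.card : ℝ) ≤ _ := hZs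
        _ ≤ (1 - (T : ℝ) / (4 * m)) ^ s * ((1 - (T : ℝ) / (4 * m)) * Y.card) := by gcongr
        _ = _ := by ring
    · intro u hu huZ
      by_cases hup : u ∈ P
      · exact ⟨w, Finset.mem_insert_self _ _, (Finset.mem_filter.1 hup).2⟩
      · obtain ⟨x, hx, hux⟩ := hdom u (Finset.mem_sdiff.2 ⟨hu, hup⟩) huZ
        exact ⟨x, Finset.mem_insert_of_mem hx, hux⟩

/-- If every set is dominated by `s` of its members in each window of `T` time steps, then some
walk of `p` windows covers `p + 1` vertices of any set with more than `p * s` members. -/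
theorem exists_traverses_of_dominating {V : Type*} {G : ℕ → SimpleGraph V}
    {T s : ℕ} (hdom : ∀ a, 1 ≤ a → ∀ Y : Finset V, ∃ D ⊆ Y, D.card ≤ s ∧
      ∀ u ∈ Y, ∃ w ∈ D, Traverses G a (a + T) u w ∅)
    (p : ℕ) {a : ℕ} (ha : 1 ≤ a) (X : Finset V) (hX : p * s < X.card) :
    ∃ u, ∃ v ∈ X, ∃ S ⊆ X, p + 1 ≤ S.card ∧ Traverses G a (a + p * T) u v S := by
  classical
  induction p generalizing X with
  | zero =>
    obtain ⟨u, hu⟩ := Finset.card_pos.1 (by omega : 0 < X.card)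
    exact ⟨u, u, hu, {u}, by simpa using hu, by simp, by
      simpa using Traverses.stay G (le_refl a) u⟩
  | succ p ih =>
    obtain ⟨D, hD, hDs, hdom⟩ := hdom (a + p * T) (by omega) X
    have hcard : p * s < (X \ D).card := by
      rw [Finset.card_sdiff_of_subset hD]
      rw [Nat.succ_mul] at hX
      omega
    obtain ⟨u, v, hv, S, hS, hSp, hwalk⟩ := ih (X \ D) hcard
    obtain ⟨w, hw, hvw⟩ := hdom v (Finset.mem_sdiff.1 hv).1
    refine ⟨u, w, hD hw, insert w S,
      Finset.insert_subset (hD hw) (hS.trans Finset.sdiff_subset), ?_, ?_⟩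
    · rw [Finset.card_insert_of_notMem fun h => (Finset.mem_sdiff.1 (hS h)).2 hw]
      omega
    · rw [Nat.succ_mul, ← add_assoc]
      refine ((hwalk.trans hvw).trans (Traverses.stay G le_rfl w)).mono ?_
      intro x
      simp only [Finset.coe_insert, Set.mem_insert_iff, Set.union_empty, Set.mem_union,
        Set.mem_singleton_iff]
      tauto

/-- If within `N` time steps one can always cover `c * √k` vertices of any set of `k` vertices,
then `(2 * N / c) * √k` time steps suffice to cover the whole set. -/
theorem exists_traverses_of_rounds {V : Type*} {G : ℕ → SimpleGraph V} {N : ℕ} {c : ℝ}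
    (hc : 0 < c)
    (hround : ∀ a, 1 ≤ a → ∀ (u : V) (X : Finset V), X.Nonempty → ∃ (r : ℕ) (v : V), ∃ S ⊆ X,
      r ≤ N ∧ c * √X.card ≤ S.card ∧ Traverses G a (a + r) u v S)
    {a : ℕ} (ha : 1 ≤ a) (u : V) (X : Finset V) :
    ∃ (r : ℕ) (v : V), (r : ℝ) ≤ 2 * N / c * √X.card ∧ Traverses G a (a + r) u v X := by
  classical
  induction hk : X.card using Nat.strong_induction_on generalizing X a u with
  | _ k ih =>
    subst hk
    rcases X.eq_empty_or_nonempty with rfl | hX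
    · exact ⟨0, u, by simp, by simpa using Traverses.reach_refl G (le_refl a) u⟩
    obtain ⟨r, v, S, hS, hr, hSc, hwalk⟩ := hround a ha u X hX
    have hk : (0 : ℝ) < X.card := by exact_mod_cast hX.card_pos
    have hsq : 0 < √(X.card : ℝ) := Real.sqrt_pos.2 hk
    have hSpos : (0 : ℝ) < S.card := lt_of_lt_of_le (by positivity) hSc
    have hSpos' : 0 < S.card := by exact_mod_cast hSpos
    have hle := Finset.card_le_card hS
    have hcard : (X \ S).card = X.card - S.card := Finset.card_sdiff_of_subset hS
    obtain ⟨r', v', hr', hwalk'⟩ := ih (X \ S).card (by omega) (a := a + r) (by omega) v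
      (X \ S) rfl
    refine ⟨r + r', v', ?_, ?_⟩
    · have hsub : ((X \ S).card : ℝ) = X.card - S.card := by
        rw [hcard, Nat.cast_sub hle]
      have hdec : √((X \ S).card : ℝ) ≤ √(X.card : ℝ) - c / 2 := by
        rw [hsub]
        have h1 := Real.sq_sqrt hk.le
        have hnn : (0 : ℝ) ≤ X.card - S.card := by
          rw [sub_nonneg]
          exact_mod_cast hle
        have hcle : c ≤ √(X.card : ℝ) := by
          by_contra! hlt
          nlinarith
        apply Real.sqrt_le_iff.2 ⟨by linarith, ?_⟩
        nlinarith [sq_nonneg c]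
      have hrN : (r : ℝ) ≤ N := by exact_mod_cast hr
      have hnn : (0 : ℝ) ≤ 2 * N / c := by positivity
      have := mul_le_mul_of_nonneg_left hdec hnn
      have he : 2 * (N : ℝ) / c * (√(X.card : ℝ) - c / 2) = 2 * N / c * √(X.card : ℝ) - N := by
        field_simp
      push_cast
      linarith
    · rw [← add_assoc]
      refine (hwalk.trans hwalk').mono ?_
      intro x hx
      by_cases hxS : x ∈ S
      · exact Or.inl hxS
      · exact Or.inr (by simpa using ⟨hx, hxS⟩)

/-- The arithmetic choice of the number `p` of windows, their length `T`, and the size `s` of the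
dominating sets for a round covering `√(n k / (64 m log n))` out of `k` vertices. -/
theorem exists_round_parameters {n m k : ℕ} (hn : 2 ≤ n) (hnm : n ≤ 2 * m) (hk : 1 ≤ k)
    (hkn : k ≤ n) :
    ∃ p T s : ℕ, √(n / (64 * m * Real.log n)) * √k ≤ p + 1 ∧ p * T ≤ n ∧ T ≤ 4 * m ∧
      p * s < k ∧ (p = 0 ∨ (1 - (T : ℝ) / (4 * m)) ^ s * n < 1) := by
  have hn' : (2 : ℝ) ≤ n := by exact_mod_cast hn
  have hnm' : (n : ℝ) ≤ 2 * m := by exact_mod_cast hnm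
  have hkn' : (k : ℝ) ≤ n := by exact_mod_cast hkn
  have hk0 : (1 : ℝ) ≤ k := by exact_mod_cast hk
  have hm0 : (0 : ℝ) < m := by linarith
  set L := Real.log n with hL
  have hL2 : (1 / 2 : ℝ) ≤ L := by
    have h1 := Real.log_two_gt_d9
    have h2 : Real.log 2 ≤ L := Real.log_le_log (by norm_num) hn'
    linarith
  set q := √(n / (64 * m * L)) * √k with hq
  have hq0 : 0 ≤ q := by positivity
  have hq2 : q ^ 2 * (64 * m * L) = n * k := by
    rw [hq, mul_pow, Real.sq_sqrt (by positivity), Real.sq_sqrt (by positivity)]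
    field_simp
  set p := ⌊q⌋₊ with hp
  have hpq : (p : ℝ) ≤ q := Nat.floor_le hq0
  have hqp : q ≤ p + 1 := (Nat.lt_floor_add_one q).le
  rcases Nat.eq_zero_or_pos p with hp0 | hp0
  · exact ⟨0, 0, 0, by simpa [hp0] using hqp, by simp, by simp, by omega, Or.inl rfl⟩
  have hp1 : (1 : ℝ) ≤ p := by exact_mod_cast hp0
  have hp2 : (p : ℝ) ^ 2 * (64 * m * L) ≤ n * k := by
    rw [← hq2]
    gcongr
  have hpk : (p : ℝ) * 16 ≤ k := by
    have h1 : (p : ℝ) ≤ p ^ 2 := by nlinarith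
    have h2 : 16 * (n : ℝ) ≤ 64 * m * L := by nlinarith
    have h3 : (p : ℝ) * (16 * n) ≤ n * k :=
      le_trans (mul_le_mul h1 h2 (by positivity) (by positivity)) hp2
    have h4 : (n : ℝ) * (p * 16) ≤ n * k := by linarith
    exact le_of_mul_le_mul_left h4 (by linarith)
  have hpn : p ≤ n := by
    have : (p : ℝ) ≤ n := by linarith
    exact_mod_cast this
  set T := n / p with hT
  have hT0 : 0 < T := Nat.div_pos hpn hp0
  have hT0' : (0 : ℝ) < T := by exact_mod_cast hT0
  have hTm : T ≤ 4 * m := (Nat.div_le_self n p).trans (by omega)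
  have hnT : (n : ℝ) ≤ 2 * p * T := by
    have h1 : n < p * (T + 1) := Nat.lt_mul_div_succ n hp0
    have h2 : n ≤ 2 * p * T := by nlinarith
    exact_mod_cast h2
  refine ⟨p, T, ⌊4 * m / T * L⌋₊ + 1, hqp, Nat.mul_div_le n p, hTm, ?_, Or.inr ?_⟩
  · have hs : (⌊4 * m / T * L⌋₊ : ℝ) ≤ 4 * m / T * L := Nat.floor_le (by positivity)
    have h1 : 4 * (m : ℝ) / T * L * n ≤ 8 * m * p * L := by
      calc 4 * (m : ℝ) / T * L * n ≤ 4 * (m : ℝ) / T * L * (2 * p * T) := by gcongr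
        _ = 8 * m * p * L := by field_simp; ring
    have h2 : (p : ℝ) * (4 * m / T * L) * 8 ≤ k := by
      have h3 : (n : ℝ) * ((p : ℝ) * (4 * m / T * L) * 8) ≤ n * k := by
        refine le_trans ?_ hp2
        calc (n : ℝ) * ((p : ℝ) * (4 * m / T * L) * 8)
            = 8 * p * (4 * (m : ℝ) / T * L * n) := by ring
          _ ≤ 8 * p * (8 * m * p * L) := by gcongr
          _ = _ := by ring
      exact le_of_mul_le_mul_left h3 (by linarith)
    have h4 : (p : ℝ) * (⌊4 * m / T * L⌋₊ + 1) < k := by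
      have := mul_le_mul_of_nonneg_left hs (by linarith : (0 : ℝ) ≤ p)
      linarith
    exact_mod_cast h4
  · have hs : 4 * (m : ℝ) / T * L < (⌊4 * m / T * L⌋₊ + 1 : ℕ) := by
      exact_mod_cast Nat.lt_floor_add_one (4 * (m : ℝ) / T * L)
    set s := ⌊4 * (m : ℝ) / T * L⌋₊ + 1
    have hfrac : (0 : ℝ) ≤ 1 - (T : ℝ) / (4 * m) := by
      rw [sub_nonneg, div_le_one (by positivity)]
      exact_mod_cast hTm
    have h1 : (1 - (T : ℝ) / (4 * m)) ^ s ≤ Real.exp (-((T : ℝ) / (4 * m) * s)) := by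
      calc (1 - (T : ℝ) / (4 * m)) ^ s ≤ Real.exp (-((T : ℝ) / (4 * m))) ^ s := by
            gcongr
            exact Real.one_sub_le_exp_neg _
        _ = _ := by rw [← Real.exp_nat_mul]; ring_nf
    have h2 : L < (T : ℝ) / (4 * m) * s := by
      have := mul_lt_mul_of_pos_left hs (by positivity : (0 : ℝ) < (T : ℝ) / (4 * m))
      calc L = (T : ℝ) / (4 * m) * (4 * m / T * L) := by field_simp
        _ < _ := this
    calc (1 - (T : ℝ) / (4 * m)) ^ s * n ≤ Real.exp (-((T : ℝ) / (4 * m) * s)) * n := by gcongr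
      _ < Real.exp (-L) * n := by gcongr
      _ = 1 := by
        rw [Real.exp_neg, hL, Real.exp_log (by linarith)]
        exact inv_mul_cancel₀ (by linarith)

theorem card_le_two_mul_of_ncard_edgeSet_le {V : Type*} [Fintype V] {G : ℕ → SimpleGraph V}
    {m : ℕ} (hn : 2 ≤ Fintype.card V) (hG : ∀ t, 1 ≤ t → (G t).Connected)
    (hm : (⨆ t : ℕ, ⨆ _ : 1 ≤ t, G t : SimpleGraph V).edgeSet.ncard ≤ m) :
    Fintype.card V ≤ 2 * m := by
  have hle : G 1 ≤ ⨆ t : ℕ, ⨆ _ : 1 ≤ t, G t := le_iSup₂_of_le 1 le_rfl le_rfl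
  have hconn := ((hG 1 le_rfl).mono hle).card_vert_le_card_edgeSet_add_one
  rw [Nat.card_eq_fintype_card, Nat.card_coe_set_eq] at hconn
  omega

/-- From any vertex, any set of `k` remaining vertices loses a constant multiple of
`√(n k / (m log n))` vertices within `2 n` time steps. -/
theorem exists_round {V : Type*} [Fintype V] {G : ℕ → SimpleGraph V} {m : ℕ}
    (hn : 2 ≤ Fintype.card V) (hm1 : 1 ≤ m) (hG : ∀ t, 1 ≤ t → (G t).Connected)
    (hm : (⨆ t : ℕ, ⨆ _ : 1 ≤ t, G t : SimpleGraph V).edgeSet.ncard ≤ m)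
    {a : ℕ} (ha : 1 ≤ a) (u : V) {X : Finset V} (hX : X.Nonempty) :
    ∃ (r : ℕ) (v : V), ∃ S ⊆ X, r ≤ 2 * Fintype.card V ∧
      √(Fintype.card V / (64 * m * Real.log (Fintype.card V))) * √X.card ≤ S.card ∧
      Traverses G a (a + r) u v S := by
  obtain ⟨p, T, s, hc, hpT, hTm, hps, hfrac⟩ := exists_round_parameters hn
    (card_le_two_mul_of_ncard_edgeSet_le hn hG hm) hX.card_pos (Finset.card_le_univ X)
  have hchain : ∃ x, ∃ v ∈ X, ∃ S ⊆ X, p + 1 ≤ S.card ∧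
      Traverses G (a + Fintype.card V) (a + Fintype.card V + p * T) x v S := by
    rcases hfrac with rfl | hfrac
    · obtain ⟨x, hx⟩ := hX
      exact ⟨x, x, hx, {x}, by simpa using hx, by simp,
        by simpa using Traverses.stay G (le_refl (a + Fintype.card V)) x⟩
    refine exists_traverses_of_dominating (s := s) (fun b hb Y => ?_) p (by omega) X hps
    obtain ⟨D, hD, Z, -, hDs, hZ, hdom⟩ := exists_dominating_subset hG hm hb hm1 hTm s Y
    have hm0 : (0 : ℝ) < 4 * m := by positivity
    have hnn : (0 : ℝ) ≤ 1 - (T : ℝ) / (4 * m) := by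
      rw [sub_nonneg, div_le_one hm0]
      exact_mod_cast hTm
    have hY : (Y.card : ℝ) ≤ Fintype.card V := by exact_mod_cast Finset.card_le_univ Y
    have hZ1 : (Z.card : ℝ) < 1 :=
      lt_of_le_of_lt (hZ.trans (mul_le_mul_of_nonneg_left hY (by positivity))) hfrac
    have hZ0 : Z = ∅ := by
      rw [← Finset.card_eq_zero, ← Nat.lt_one_iff]
      exact_mod_cast hZ1
    exact ⟨D, hD, hDs, fun u hu => hdom u hu (by simp [hZ0])⟩
  obtain ⟨x, v, -, S, hS, hSp, hwalk⟩ := hchain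
  refine ⟨Fintype.card V + p * T, v, S, hS, by omega, hc.trans (by exact_mod_cast hSp), ?_⟩
  rw [← add_assoc]
  simpa using (traverses_of_card_le hG ha le_rfl u x).trans hwalk

/-- There is an absolute constant `C > 0` such that any always-connected
temporal graph `(G_t)_{t ≥ 1}` on `n ≥ 2` vertices whose underlying graph has at most
`m ≥ 1` edges admits, from any start vertex `s`, a temporal exploration spanning at most
`C · n · √(m · log₂ n)` time steps. -/
theorem temporal_exploration_bounded_edge_count :
    ∃ C : ℝ, 0 < C ∧
      ∀ (m : ℕ) (V : Type) [Fintype V] (G : ℕ → SimpleGraph V),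
        1 ≤ m → 2 ≤ Fintype.card V →
        (∀ t : ℕ, 1 ≤ t → (G t).Connected) →
        (⨆ t : ℕ, ⨆ _ : 1 ≤ t, G t : SimpleGraph V).edgeSet.ncard ≤ m →
        ∀ s : V, ∃ (r : ℕ) (w : ℕ → V),
          w 1 = s ∧
          (∀ t : ℕ, 1 ≤ t → t ≤ r → (w t = w (t + 1) ∨ (G t).Adj (w t) (w (t + 1)))) ∧
          (∀ v : V, ∃ t : ℕ, 1 ≤ t ∧ t ≤ r + 1 ∧ w t = v) ∧
          (r : ℝ) ≤ C * (Fintype.card V : ℝ) *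
            Real.sqrt ((m : ℝ) * Real.logb 2 (Fintype.card V)) := by
  refine ⟨32, by norm_num, fun m V _ G hm1 hn hG hm s => ?_⟩
  set n := Fintype.card V with hndef
  have hn' : (2 : ℝ) ≤ n := by exact_mod_cast hn
  have hm0 : (0 : ℝ) < m := by exact_mod_cast hm1
  have hL : 0 < Real.log n := Real.log_pos (by linarith)
  set c := √(n / (64 * m * Real.log n)) with hc
  have hc0 : 0 < c := Real.sqrt_pos.2 (by positivity)
  obtain ⟨r, v, hr, -, w, hw1, -, hstep, hcov⟩ := exists_traverses_of_rounds (N := 2 * n) hc0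
    (fun a ha u X hX => exists_round hn hm1 hG hm ha u hX) le_rfl s Finset.univ
  refine ⟨r, w, hw1, fun t h1 h2 => hstep t h1 (by omega), fun v => ?_, ?_⟩
  · obtain ⟨t, h1, h2, h3⟩ := hcov v (by simp)
    exact ⟨t, h1, by omega, h3⟩
  refine hr.trans ?_
  rw [Finset.card_univ, ← hndef]
  have hlog : Real.log n ≤ Real.logb 2 n := by
    rw [Real.logb, le_div_iff₀ (Real.log_pos (by norm_num))]
    have := Real.log_two_lt_d9
    nlinarith
  have hquot : √(n : ℝ) = c * (8 * √(m * Real.log n)) := by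
    have h8 : (8 : ℝ) = √64 := by
      rw [show (64 : ℝ) = 8 ^ 2 by norm_num, Real.sqrt_sq (by norm_num)]
    rw [hc, h8, ← Real.sqrt_mul (by norm_num), ← Real.sqrt_mul (by positivity)]
    congr 1
    field_simp
  calc 2 * ((2 * n : ℕ) : ℝ) / c * √(n : ℝ) = 32 * n * √(m * Real.log n) := by
        rw [hquot]
        push_cast
        field_simp
        ring
    _ ≤ 32 * n * √(m * Real.logb 2 n) := by gcongr
end

section
/- Let G = (G_t)_{t ∈ I} be an always-connected temporal graph over a finite interval I = {ℓ, …, r} on a vertex set V of size n, with average temporal maximum degree at most D (D ≥ 1 real), and let X ⊆ V be a set of at least two vertices. If |I| ≥ n, then there exists a temporal walk in G that covers at least (1/8)·sqrt(|X| / (D · log₂ |X|)) vertices of X. -/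
/-- On the time interval from `s` to `t`, each step of `w` stays put or follows an edge of the
current snapshot. -/
def IsTemporalWalk {V : Type*} (G : ℕ → SimpleGraph V) (s t : ℕ) (w : ℕ → V) : Prop :=
  ∀ i, s ≤ i → i < t → (w i = w (i + 1) ∨ (G i).Adj (w i) (w (i + 1)))

/-- Some temporal walk leads from `u` at time `s` to `v` at time `t`. -/
def TemporalReach {V : Type*} (G : ℕ → SimpleGraph V) (s t : ℕ) (u v : V) : Prop :=
  ∃ w : ℕ → V, w s = u ∧ w t = v ∧ IsTemporalWalk G s t w

section TemporalReach

variable {V : Type*} {G : ℕ → SimpleGraph V}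

theorem IsTemporalWalk.concat {s t u : ℕ} {w w' : ℕ → V} (h : IsTemporalWalk G s t w)
    (h' : IsTemporalWalk G t u w') (heq : w t = w' t) :
    IsTemporalWalk G s u fun i => if i ≤ t then w i else w' i := by
  intro i hsi hiu
  rcases lt_trichotomy i t with hit | rfl | hit
  · simpa [hit.le, Nat.succ_le_of_lt hit] using h i hsi hit
  · simpa [heq] using h' i le_rfl hiu
  · simpa [hit.not_ge, show ¬ i + 1 ≤ t by omega] using h' i hit.le hiu

theorem TemporalReach.refl (s t : ℕ) (v : V) : TemporalReach G s t v v :=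
  ⟨fun _ => v, rfl, rfl, fun _ _ _ => Or.inl rfl⟩

theorem TemporalReach.trans {s t u : ℕ} (hst : s ≤ t) (htu : t ≤ u) {x y z : V}
    (h : TemporalReach G s t x y) (h' : TemporalReach G t u y z) : TemporalReach G s u x z := by
  obtain ⟨w, hs, ht, hw⟩ := h
  obtain ⟨w', ht', hu, hw'⟩ := h'
  refine ⟨_, ?_, ?_, hw.concat hw' (ht.trans ht'.symm)⟩
  · simpa [hst] using hs
  · by_cases hut : u ≤ t
    · obtain rfl : u = t := le_antisymm hut htu
      simp [ht, ← hu, ht']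
    · simpa [hut] using hu

theorem TemporalReach.of_adj {t : ℕ} {u v : V} (h : (G t).Adj u v) :
    TemporalReach G t (t + 1) u v := by
  refine ⟨fun i => if i ≤ t then u else v, by simp, by simp, fun i hi hit => ?_⟩
  obtain rfl : i = t := by omega
  simpa using Or.inr h

/-- Vertices that pairwise cannot reach each other within a window have, at every time of the
window, disjoint clouds; each cloud has a boundary edge whose outer end `v` is either reached by
the set for the first time, or able to reach the set for the last time. -/
theorem exists_boundary_edge {a b : ℕ} {Z : Finset V}
    (hZ : ∀ x ∈ Z, ∀ y ∈ Z, TemporalReach G a b x y → x = y) (hcard : 2 ≤ Z.card)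
    {t : ℕ} (hat : a ≤ t) (htb : t < b) (hconn : (G t).Connected) {z : V} (hz : z ∈ Z) :
    ∃ u v, (G t).Adj v u ∧ TemporalReach G a t z u ∧ TemporalReach G (t + 1) b u z ∧
      (((∀ y ∈ Z, ¬ TemporalReach G a t y v) ∧ TemporalReach G a (t + 1) z v) ∨
        ((∀ y ∈ Z, ¬ TemporalReach G (t + 1) b v y) ∧ TemporalReach G t b v z)) := by
  obtain ⟨z', hz', hne⟩ := Finset.exists_mem_ne (by omega : 1 < Z.card) z
  obtain ⟨p⟩ := hconn.preconnected z z'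
  obtain ⟨d, -, ⟨hd₁, hd₂⟩, hd₃⟩ := p.exists_boundary_dart
    {v | TemporalReach G a t z v ∧ TemporalReach G (t + 1) b v z}
    ⟨.refl _ _ _, .refl _ _ _⟩ (fun h => hne.symm <| hZ z hz z' hz'
      (h.1.trans hat htb.le (.refl _ _ _)))
  have hadj := d.adj
  refine ⟨d.fst, d.snd, hadj.symm, hd₁, hd₂, ?_⟩
  have hleft : TemporalReach G a (t + 1) z d.snd :=
    hd₁.trans hat t.le_succ (.of_adj hadj)
  have hright : TemporalReach G t b d.snd z :=
    (TemporalReach.of_adj hadj.symm).trans t.le_succ htb hd₂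
  by_cases h : TemporalReach G a t z d.snd
  · refine Or.inr ⟨fun y hy hvy => hd₃ ⟨h, ?_⟩, hright⟩
    rwa [hZ z hz y hy (hleft.trans (by omega) htb hvy)]
  · refine Or.inl ⟨fun y hy hvy => h ?_, hleft⟩
    rwa [← hZ y hy z hz (hvy.trans hat htb.le hright)]

/-- Double counting of boundary edges: vertices that pairwise cannot reach each other within `m`
steps are few. -/
theorem card_mul_le_of_not_reach [Fintype V] {a m : ℕ} {Δ : V → ℕ}
    (hconn : ∀ t, a ≤ t → t < a + m → (G t).Connected)
    (hΔ : ∀ t, a ≤ t → t < a + m → ∀ v, ((G t).neighborSet v).ncard ≤ Δ v) {Z : Finset V}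
    (hZ : ∀ x ∈ Z, ∀ y ∈ Z, TemporalReach G a (a + m) x y → x = y) (hcard : 2 ≤ Z.card) :
    m * Z.card ≤ 2 * ∑ v, Δ v := by
  classical
  have key : ∀ p : ℕ × V, p ∈ Finset.Ico a (a + m) ×ˢ Z → ∃ u v, ∃ b : Bool,
      (G p.1).Adj v u ∧ TemporalReach G a p.1 p.2 u ∧ TemporalReach G (p.1 + 1) (a + m) u p.2 ∧
      (b = true → (∀ y ∈ Z, ¬ TemporalReach G a p.1 y v) ∧ TemporalReach G a (p.1 + 1) p.2 v) ∧
      (b = false → (∀ y ∈ Z, ¬ TemporalReach G (p.1 + 1) (a + m) v y) ∧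
        TemporalReach G p.1 (a + m) v p.2) := by
    rintro ⟨t, z⟩ hp
    simp only [Finset.mem_product, Finset.mem_Ico] at hp
    obtain ⟨u, v, h₁, h₂, h₃, h₄ | h₄⟩ :=
      exists_boundary_edge hZ hcard hp.1.1 hp.1.2 (hconn t hp.1.1 hp.1.2) hp.2
    · exact ⟨u, v, true, h₁, h₂, h₃, fun _ => h₄, by simp⟩
    · exact ⟨u, v, false, h₁, h₂, h₃, by simp, fun _ => h₄⟩
  obtain ⟨z₀, -⟩ := Finset.card_pos.mp (by omega : 0 < Z.card)
  have : Nonempty V := ⟨z₀⟩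
  choose! u v b hadj hl hr htrue hfalse using key
  set P := Finset.Ico a (a + m) ×ˢ Z with hP
  have hmem : ∀ p ∈ P, a ≤ p.1 ∧ p.1 < a + m ∧ p.2 ∈ Z := by
    intro p hp
    simpa [hP, and_assoc] using hp
  have htime : ∀ p ∈ P, ∀ p' ∈ P, v p = v p' → b p = b p' → p'.1 ≤ p.1 := by
    intro p hp p' hp' hv hb
    by_contra! hlt
    obtain ⟨ha, hm, hpZ⟩ := hmem p hp
    obtain ⟨ha', hm', hpZ'⟩ := hmem p' hp'
    cases hbp : b p
    · refine (hfalse p hp hbp).1 _ hpZ' ?_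
      rw [hv]
      exact (TemporalReach.refl _ _ _).trans hlt hm'.le (hfalse p' hp' (hb ▸ hbp)).2
    · refine (htrue p' hp' (hb ▸ hbp)).1 _ hpZ ?_
      rw [← hv]
      exact (htrue p hp hbp).2.trans (by omega) hlt (.refl _ _ _)
  have hfiber : ∀ c : V × Bool, (P.filter fun p => (v p, b p) = c).card ≤ Δ c.1 := by
    intro c
    rcases (P.filter fun p => (v p, b p) = c).eq_empty_or_nonempty with h | ⟨p₀, hp₀⟩
    · simp [h]
    rw [Finset.mem_filter] at hp₀
    obtain ⟨hp₀, rfl⟩ := hp₀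
    obtain ⟨ha, hm, -⟩ := hmem p₀ hp₀
    have hsame : ∀ p ∈ P.filter (fun p => (v p, b p) = (v p₀, b p₀)),
        p ∈ P ∧ v p = v p₀ ∧ p.1 = p₀.1 := by
      intro p hp
      rw [Finset.mem_filter, Prod.mk.injEq] at hp
      obtain ⟨hp, hv, hb⟩ := hp
      exact ⟨hp, hv, le_antisymm (htime _ hp₀ _ hp hv.symm hb.symm) (htime _ hp _ hp₀ hv hb)⟩
    refine le_trans ?_ (hΔ p₀.1 ha hm (v p₀))
    rw [← Set.ncard_coe_finset]
    refine Set.ncard_le_ncard_of_injOn u (fun p hp => ?_) (fun p hp p' hp' huu => ?_)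
      (Set.toFinite _)
    · obtain ⟨hp, hv, ht⟩ := hsame p hp
      rw [SimpleGraph.mem_neighborSet, ← hv, ← ht]
      exact hadj p hp
    · obtain ⟨hp, -, ht⟩ := hsame p hp
      obtain ⟨hp', -, ht'⟩ := hsame p' hp'
      obtain ⟨hap, hmp, hpZ⟩ := hmem p hp
      obtain ⟨-, -, hpZ'⟩ := hmem p' hp'
      have h₁ := hl p hp
      have h₂ := hr p' hp'
      rw [← huu, ht', ← ht] at h₂
      refine Prod.ext (ht.trans ht'.symm) (hZ _ hpZ _ hpZ' ?_)
      exact h₁.trans hap hmp.le ((TemporalReach.refl _ _ _).trans (by omega) hmp h₂)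
  calc m * Z.card = P.card := by simp [hP]
    _ = ∑ c : V × Bool, (P.filter fun p => (v p, b p) = c).card :=
        Finset.card_eq_sum_card_fiberwise fun _ _ => Finset.mem_coe.2 (Finset.mem_univ _)
    _ ≤ ∑ c : V × Bool, Δ c.1 := Finset.sum_le_sum fun c _ => hfiber c
    _ = 2 * ∑ v, Δ v := by simp [Fintype.sum_prod_type, Finset.mul_sum]

end TemporalReach

section Digraph

variable {α : Type*} (R : α → α → Prop)

/-- A finite digraph whose in-degrees are at most `d` has an independent set
containing at least a `1 / (2 * d + 1)` proportion of the vertices. -/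
theorem exists_independent_of_indegree_le [DecidableEq α] [DecidableRel R] (d : ℕ) (Z : Finset α)
    (hd : ∀ z ∈ Z, (Z.filter fun y => R y z).card ≤ d) :
    ∃ T ⊆ Z, (∀ x ∈ T, ∀ y ∈ T, R x y → x = y) ∧ Z.card ≤ (2 * d + 1) * T.card := by
  induction Z using Finset.strongInduction with
  | H Z ih =>
  rcases Z.eq_empty_or_nonempty with rfl | hne
  · exact ⟨∅, by simp⟩
  obtain ⟨z, hz, hout⟩ : ∃ z ∈ Z, (Z.filter fun y => R z y).card ≤ d := by
    apply Finset.exists_le_of_sum_le hne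
    have := Finset.sum_card_bipartiteAbove_eq_sum_card_bipartiteBelow (s := Z) (t := Z) R
    simp only [Finset.bipartiteAbove, Finset.bipartiteBelow] at this
    rw [this]
    exact Finset.sum_le_sum hd
  set N := insert z (Z.filter (fun y => R y z) ∪ Z.filter fun y => R z y) with hN
  have hNcard : N.card ≤ 2 * d + 1 := by
    have h₁ := Finset.card_insert_le z (Z.filter (fun y => R y z) ∪ Z.filter fun y => R z y)
    have h₂ := Finset.card_union_le (Z.filter fun y => R y z) (Z.filter fun y => R z y)
    have h₃ := hd z hz
    rw [← hN] at h₁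
    omega
  have hzN : z ∈ N := Finset.mem_insert_self _ _
  obtain ⟨T, hTZ, hT, hcard⟩ := ih (Z \ N)
    (Finset.ssubset_iff_subset_ne.2 ⟨Finset.sdiff_subset, fun h => by
      rw [← h] at hz
      exact (Finset.mem_sdiff.1 hz).2 hzN⟩)
    (fun x hx => (Finset.card_le_card
      (Finset.filter_subset_filter _ Finset.sdiff_subset)).trans
        (hd x (Finset.mem_sdiff.1 hx).1))
  have hout' : ∀ x ∈ T, ¬ R x z ∧ ¬ R z x := by
    intro x hx
    have := Finset.mem_sdiff.1 (hTZ hx)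
    simp only [hN, Finset.mem_insert, Finset.mem_union, Finset.mem_filter, this.1] at this
    tauto
  have hzT : z ∉ T := fun h => (Finset.mem_sdiff.1 (hTZ h)).2 hzN
  refine ⟨insert z T, ?_, ?_, ?_⟩
  · exact Finset.insert_subset hz (hTZ.trans Finset.sdiff_subset)
  · intro x hx y hy hxy
    rw [Finset.mem_insert] at hx hy
    rcases hx with rfl | hx <;> rcases hy with rfl | hy
    · rfl
    · exact absurd hxy (hout' y hy).2
    · exact absurd hxy (hout' x hx).1
    · exact hT x hx y hy hxy
  · rw [Finset.card_insert_of_notMem hzT]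
    have := Finset.card_le_card_sdiff_add_card (s := Z) (t := N)
    linarith

/-- If every nonempty set of vertices has a member absorbing a `1 / A` proportion of it, then the
greedy algorithm finds a small absorbing set. -/
theorem exists_absorbing [DecidableEq α] [DecidableRel R] (A : ℝ) (hA : 0 < A)
    (Y : Finset α)
    (h : ∀ Z ⊆ Y, Z.Nonempty →
      ∃ z ∈ Z, R z z ∧ (Z.card : ℝ) ≤ A * (Z.filter fun y => R y z).card) :
    ∃ S ⊆ Y, (∀ y ∈ Y, ∃ s ∈ S, R y s) ∧ (S.card : ℝ) ≤ A * (1 + Real.log Y.card) := by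
  induction Y using Finset.strongInduction with
  | H Y ih =>
  rcases Y.eq_empty_or_nonempty with rfl | hne
  · exact ⟨∅, by simp, by simp, by simpa using hA.le⟩
  obtain ⟨z, hz, hzz, hcard⟩ := h Y subset_rfl hne
  set N := Y.filter fun y => R y z with hN
  have hzN : z ∈ N := by simp [hN, hz, hzz]
  have hsub : Y \ N ⊂ Y := Finset.ssubset_iff_subset_ne.2 ⟨Finset.sdiff_subset, fun h => by
    rw [← h] at hz
    exact (Finset.mem_sdiff.1 hz).2 hzN⟩
  obtain ⟨S, hSY, hS, hScard⟩ := ih _ hsub fun Z hZ => h Z (hZ.trans Finset.sdiff_subset)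
  refine ⟨insert z S, Finset.insert_subset hz (hSY.trans Finset.sdiff_subset), ?_, ?_⟩
  · intro y hy
    by_cases hyz : R y z
    · exact ⟨z, Finset.mem_insert_self _ _, hyz⟩
    · obtain ⟨s, hs, hys⟩ := hS y (by simp [hN, hy, hyz])
      exact ⟨s, Finset.mem_insert_of_mem hs, hys⟩
  · have hYpos : (0 : ℝ) < Y.card := by exact_mod_cast hne.card_pos
    have hsum : ((Y \ N).card : ℝ) + N.card = Y.card := by
      exact_mod_cast Finset.card_sdiff_add_card_eq_card (Finset.filter_subset _ Y)
    have hinsert : ((insert z S).card : ℝ) ≤ S.card + 1 := by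
      exact_mod_cast Finset.card_insert_le z S
    rcases (Y \ N).eq_empty_or_nonempty with hem | hne'
    · have hS0 : S = ∅ := Finset.subset_empty.1 (hem ▸ hSY)
      have hNY : (N.card : ℝ) = Y.card := by simpa [hem] using hsum
      rw [hNY] at hcard
      have hA1 : 1 ≤ A := le_of_mul_le_mul_right (by simpa using hcard) hYpos
      have hlog : 0 ≤ Real.log Y.card := Real.log_natCast_nonneg _
      have hScard0 : (S.card : ℝ) = 0 := by simp [hS0]
      nlinarith
    · have hpos' : (0 : ℝ) < (Y \ N).card := by exact_mod_cast hne'.card_pos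
      have hlog := Real.log_le_sub_one_of_pos (div_pos hpos' hYpos)
      rw [Real.log_div hpos'.ne' hYpos.ne'] at hlog
      have hratio : A * (((Y \ N).card : ℝ) / Y.card - 1) ≤ -1 := by
        have : ((Y \ N).card : ℝ) / Y.card - 1 = -(N.card / Y.card) := by
          field_simp
          linarith
        rw [this, mul_neg, neg_le_neg_iff, ← mul_div_assoc, one_le_div hYpos]
        exact hcard
      have := mul_le_mul_of_nonneg_left hlog hA.le
      linarith

/-- A digraph with bounded independence number has a small absorbing set. -/
theorem exists_absorbing_of_independent_le [DecidableEq α] [DecidableRel R]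
    (hrefl : ∀ x, R x x) (c : ℝ) (hc : 0 < c) (Y : Finset α)
    (h : ∀ T ⊆ Y, (∀ x ∈ T, ∀ y ∈ T, R x y → x = y) → (T.card : ℝ) ≤ c) :
    ∃ S ⊆ Y, (∀ y ∈ Y, ∃ s ∈ S, R y s) ∧ (S.card : ℝ) ≤ 3 * c * (1 + Real.log Y.card) := by
  refine exists_absorbing R (3 * c) (by positivity) Y fun Z hZ hne => ?_
  obtain ⟨z, hz, hmax⟩ := Z.exists_max_image (fun z => (Z.filter fun y => R y z).card) hne
  obtain ⟨T, hTZ, hT, hcard⟩ := exists_independent_of_indegree_le R _ Z hmax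
  refine ⟨z, hz, hrefl z, ?_⟩
  set d := (Z.filter fun y => R y z).card
  have hd1 : (1 : ℝ) ≤ d := by
    refine Nat.one_le_cast.2 (Finset.card_pos.2 ⟨z, ?_⟩)
    exact Finset.mem_filter.2 ⟨hz, hrefl z⟩
  calc (Z.card : ℝ) ≤ (2 * d + 1) * T.card := by exact_mod_cast hcard
    _ ≤ (3 * d) * c :=
        mul_le_mul (by linarith) (h T (hTZ.trans hZ) hT) (by positivity) (by positivity)
    _ = 3 * c * d := by ring

end Digraph

/-- If in each of `q` consecutive windows every subset of `X` has an absorbing set of size at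
most `B`, then, outside an exceptional set of size at most `q * B`, every vertex of `X` starts a
temporal walk collecting `q` further vertices. -/
theorem exists_walk_of_absorbing {V : Type*} [DecidableEq V] {G : ℕ → SimpleGraph V}
    {m : ℕ} {B : ℝ} {X : Finset V} (q a : ℕ)
    (habs : ∀ i < q, ∀ Y ⊆ X, ∃ S ⊆ Y,
      (∀ y ∈ Y, ∃ s ∈ S, TemporalReach G (a + i * m) (a + i * m + m) y s) ∧ (S.card : ℝ) ≤ B) :
    ∃ S ⊆ X, (S.card : ℝ) ≤ q * B ∧ ∀ x ∈ X, x ∉ S → ∃ w : ℕ → V, w a = x ∧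
      IsTemporalWalk G a (a + q * m) w ∧ ∃ F ⊆ S, F.card = q ∧
        ∀ y ∈ F, ∃ t, a ≤ t ∧ t ≤ a + q * m ∧ w t = y := by
  induction q generalizing a with
  | zero =>
    exact ⟨∅, by simp, by simp, fun x _ _ => ⟨fun _ => x, rfl, fun _ _ _ => Or.inl rfl, ∅, by simp⟩⟩
  | succ q ih =>
    obtain ⟨S, hSX, hScard, hS⟩ := ih (a + m) fun i hi Y hY => by
      have := habs (i + 1) (by omega) Y hY
      rwa [show a + (i + 1) * m = a + m + i * m by ring] at this
    obtain ⟨S₀, hS₀, hreach, hS₀card⟩ := habs 0 (by omega) (X \ S) Finset.sdiff_subset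
    simp only [zero_mul, add_zero] at hreach
    refine ⟨S ∪ S₀, Finset.union_subset hSX (hS₀.trans Finset.sdiff_subset), ?_, ?_⟩
    · have : ((S ∪ S₀).card : ℝ) ≤ S.card + S₀.card := by
        exact_mod_cast Finset.card_union_le S S₀
      push_cast
      linarith
    · intro x hx hxS
      rw [Finset.mem_union, not_or] at hxS
      obtain ⟨y, hy, w, hwa, hwm, hw⟩ := hreach x (Finset.mem_sdiff.2 ⟨hx, hxS.1⟩)
      obtain ⟨hyX, hyS⟩ := Finset.mem_sdiff.1 (hS₀ hy)
      obtain ⟨w', hwa', hw', F, hFS, hFcard, hF⟩ := hS y hyX hyS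
      have hend : a + m + q * m = a + (q + 1) * m := by ring
      rw [hend] at hw' hF
      refine ⟨_, ?_, hw.concat hw' (hwm.trans hwa'.symm), insert y F, ?_, ?_, ?_⟩
      · simpa using hwa
      · exact Finset.insert_subset (Finset.mem_union_right _ hy)
          (hFS.trans Finset.subset_union_left)
      · rw [Finset.card_insert_of_notMem fun h => hyS (hFS h), hFcard]
      · intro y' hy'
        rcases Finset.mem_insert.1 hy' with rfl | hy'
        · exact ⟨a + m, by omega, by rw [← hend]; omega, by simpa using hwm⟩
        · obtain ⟨t, ht, ht', rfl⟩ := hF y' hy'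
          refine ⟨t, by omega, ht', ?_⟩
          by_cases htm : t ≤ a + m
          · obtain rfl : t = a + m := le_antisymm htm ht
            simp [hwm, hwa']
          · simp [htm]

/-- In an always-connected temporal graph over the interval `I = {l,…,r}`
on `n` vertices with average temporal maximum degree at most `D`, if `X` is a set of at
least two vertices and `|I| ≥ n`, then there is a temporal walk (a sequence
`w_a, …, w_{b+1}` with `{a,…,b} ⊆ I` where at each step one stays put or moves along an
edge of the current snapshot) covering at least `(1/8)·√(|X| / (D · log₂|X|))` vertices
of `X`. -/
theorem exists_temporal_walk_covering_many
    {V : Type} [Fintype V] (G : ℕ → SimpleGraph V) (l r : ℕ) (D : ℝ) (hD : 1 ≤ D)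
    (hconn : ∀ t ∈ Finset.Icc l r, (G t).Connected)
    (hdeg : ((∑ v : V, (Finset.Icc l r).sup fun t => ((G t).neighborSet v).ncard : ℕ) : ℝ)
      ≤ D * Fintype.card V)
    (X : Finset V) (hX : 2 ≤ X.card)
    (hI : Fintype.card V ≤ (Finset.Icc l r).card) :
    ∃ (a b : ℕ) (w : ℕ → V), l ≤ a ∧ a ≤ b + 1 ∧ b ≤ r ∧
      (∀ t : ℕ, a ≤ t → t ≤ b → (w t = w (t + 1) ∨ (G t).Adj (w t) (w (t + 1)))) ∧
      (1 / 8 : ℝ) * Real.sqrt ((X.card : ℝ) / (D * Real.logb 2 X.card))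
        ≤ ({v : V | v ∈ X ∧ ∃ t : ℕ, a ≤ t ∧ t ≤ b + 1 ∧ w t = v}.ncard : ℝ) := by
  classical
  set Δ : V → ℕ := fun v => (Finset.Icc l r).sup fun t => ((G t).neighborSet v).ncard
  set L := Real.logb 2 X.card with hL
  set T := (1 / 8 : ℝ) * Real.sqrt ((X.card : ℝ) / (D * L)) with hT
  have hk : (2 : ℝ) ≤ X.card := by exact_mod_cast hX
  have hL1 : 1 ≤ L := by
    rw [hL, Real.le_logb_iff_rpow_le (by norm_num) (by linarith)]
    simpa using hk
  have hXV : X.card ≤ Fintype.card V := X.card_le_univ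
  have hlr : Fintype.card V ≤ r + 1 - l := by simpa using hI
  rcases le_or_gt T 1 with hT1 | hT1
  · obtain ⟨x, hx⟩ := Finset.card_pos.1 (by omega : 0 < X.card)
    refine ⟨l, l, fun _ => x, le_rfl, by omega, by omega, fun _ _ _ => Or.inl rfl, hT1.trans ?_⟩
    rw [Nat.one_le_cast, Nat.one_le_iff_ne_zero, Ne, Set.ncard_eq_zero (Set.toFinite _)]
    exact Set.nonempty_iff_ne_empty.1 ⟨x, hx, l, le_rfl, by omega, rfl⟩
  have hceil : 1 < ⌈T⌉₊ := Nat.lt_ceil.2 (by simpa using hT1)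
  obtain ⟨q, hq⟩ : ∃ q, ⌈T⌉₊ = q + 1 := ⟨⌈T⌉₊ - 1, by omega⟩
  have hTq : T ≤ (q + 1 : ℕ) := hq ▸ Nat.le_ceil T
  have hqT : (q : ℝ) < T := Nat.lt_ceil.1 (by omega)
  have hq1 : 1 ≤ q := by omega
  have hq1' : (1 : ℝ) ≤ q := by exact_mod_cast hq1
  have hDL : 1 ≤ D * L := by nlinarith
  have hqk : 64 * (q : ℝ) ^ 2 * (D * L) < X.card := by
    have hsq : Real.sqrt ((X.card : ℝ) / (D * L)) ^ 2 = X.card / (D * L) :=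
      Real.sq_sqrt (by positivity)
    have : (8 * (q : ℝ)) ^ 2 < X.card / (D * L) := by
      rw [← hsq]
      exact pow_lt_pow_left₀ (by linarith) (by positivity) (by norm_num)
    rw [lt_div_iff₀ (by linarith)] at this
    linarith
  have hqn : q ≤ Fintype.card V := by
    have : (q : ℝ) ≤ X.card := by nlinarith
    exact (Nat.cast_le.1 this).trans hXV
  set n := Fintype.card V with hn
  set m := n / q with hm
  have hm1 : 1 ≤ m := (Nat.one_le_div_iff hq1).2 hqn
  have hqm : q * m ≤ n := Nat.mul_div_le n q
  have hnm : n ≤ 2 * (q * m) := by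
    have := Nat.lt_mul_div_succ n hq1
    rw [← hm] at this
    nlinarith
  have hwindow : ∀ i < q, l + i * m + m ≤ r + 1 := by
    intro i hi
    have : (i + 1) * m ≤ q * m := Nat.mul_le_mul_right _ hi
    rw [add_mul, one_mul] at this
    omega
  obtain ⟨S, hSX, hScard, hS⟩ := exists_walk_of_absorbing (G := G) (m := m)
    (B := 3 * (4 * D * q) * (1 + Real.log X.card)) (X := X) q l (by
      intro i hi Y hY
      have hw := hwindow i hi
      obtain ⟨S, hSY, hS, hcard⟩ := exists_absorbing_of_independent_le
        (TemporalReach G (l + i * m) (l + i * m + m)) (.refl _ _) (4 * D * q) (by positivity) Y (by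
          intro T _ hT
          rcases lt_or_ge T.card 2 with h | h
          · have : (T.card : ℝ) ≤ 1 := by exact_mod_cast Nat.lt_succ_iff.1 h
            nlinarith
          · have hmem : ∀ t, l + i * m ≤ t → t < l + i * m + m → t ∈ Finset.Icc l r := by
              intro t h₁ h₂
              rw [Finset.mem_Icc]
              omega
            have hle := card_mul_le_of_not_reach (Δ := Δ)
              (fun t h₁ h₂ => hconn t (hmem t h₁ h₂))
              (fun t h₁ h₂ v => Finset.le_sup
                (f := fun t => ((G t).neighborSet v).ncard) (hmem t h₁ h₂)) hT h
            have hle' : (m : ℝ) * T.card ≤ 2 * (∑ v, Δ v : ℕ) := by exact_mod_cast hle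
            have hnm' : (n : ℝ) ≤ 2 * (q * m) := by exact_mod_cast hnm
            have hm0 : (0 : ℝ) < m := by exact_mod_cast hm1
            refine le_of_mul_le_mul_left ?_ hm0
            calc (m : ℝ) * T.card ≤ 2 * (D * n) := by linarith
              _ ≤ 2 * (D * (2 * (q * m))) := by gcongr
              _ = m * (4 * D * q) := by ring)
      refine ⟨S, hSY, hS, hcard.trans ?_⟩
      rcases Y.eq_empty_or_nonempty with rfl | hne
      · have := Real.log_natCast_nonneg X.card
        simp only [Finset.card_empty, Nat.cast_zero, Real.log_zero]
        gcongr
      · have := hne.card_pos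
        gcongr)
  have hlogL : Real.log X.card ≤ L := by
    rw [hL, Real.logb, le_div_iff₀ (Real.log_pos (by norm_num))]
    have := Real.log_natCast_nonneg X.card
    have := Real.log_two_lt_d9
    nlinarith
  have hlt : S.card < X.card := by
    have : (S.card : ℝ) < X.card := by
      calc (S.card : ℝ) ≤ q * (3 * (4 * D * q) * (1 + Real.log X.card)) := hScard
        _ ≤ q * (3 * (4 * D * q) * (2 * L)) := by gcongr; linarith
        _ ≤ 64 * (q : ℝ) ^ 2 * (D * L) := by
            have : 0 ≤ (q : ℝ) ^ 2 * (D * L) := by positivity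
            linarith
        _ < X.card := hqk
    exact_mod_cast this
  obtain ⟨x, hx, hxS⟩ := Finset.exists_mem_notMem_of_card_lt_card hlt
  obtain ⟨w, hwl, hw, F, hFS, hFcard, hF⟩ := hS x hx hxS
  have hqm1 : 1 ≤ q * m := Nat.mul_pos hq1 hm1
  refine ⟨l, l + q * m - 1, w, le_rfl, by omega, by omega,
    fun t h₁ h₂ => hw t h₁ (by omega), hTq.trans ?_⟩
  have hcard : (insert x F).card = q + 1 := by
    rw [Finset.card_insert_of_notMem fun h => hxS (hFS h), hFcard]
  rw [Nat.cast_le, ← hcard, ← Set.ncard_coe_finset]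
  refine Set.ncard_le_ncard (fun y hy => ?_) (Set.toFinite _)
  rcases Finset.mem_insert.1 (Finset.mem_coe.1 hy) with rfl | hy
  · exact ⟨hx, l, le_rfl, by omega, hwl⟩
  · obtain ⟨t, h₁, h₂, rfl⟩ := hF y hy
    exact ⟨hSX (hFS hy), t, h₁, by omega, rfl⟩
end
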